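/- Let q ≥ 2 be an integer and R a real number with 0 < R < 1. Every M_q-function f that is analytic on the open disk D(0,R) is annihilated by a σ_q-operator L = b_0(z) + b_1(z)σ_q + ⋯ + b_n(z)σ_q^n without singularities on the punctured disk D*(0,R); that is, b_0(z)f(z) + b_1(z)f(z^q) + ⋯ + b_n(z)f(z^{q^n}) = 0 and, for every α ∈ D*(0,R) and every integer ℓ ≥ 0, b_0(α^{q^ℓ}) ≠ 0 and b_n(α^{q^ℓ}) ≠ 0. -/

import Mathlib

noncomputable section

/-- The derivative `d/dz` of a formal power series over `ℂ`. -/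
def psD (f : PowerSeries ℂ) : PowerSeries ℂ :=
  PowerSeries.mk fun n => ((n : ℂ) + 1) * PowerSeries.coeff (n + 1) f

/-- The Mahler operator `σ_q : f(z) ↦ f(z^q)` on formal power series over `ℂ`. -/
def psSigma (q : ℕ) (f : PowerSeries ℂ) : PowerSeries ℂ :=
  PowerSeries.mk fun n => if q ∣ n then PowerSeries.coeff (n / q) f else 0

/-- The canonical embedding of polynomials into power series. -/
def polyPS : Polynomial ℂ →+* PowerSeries ℂ := Polynomial.coeToPowerSeries.ringHom

/-- The power series `∑ (a n / n!) zⁿ` attached to a sequence `a` of coefficients. -/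
def ePS (a : ℕ → ℂ) : PowerSeries ℂ := PowerSeries.mk fun n => a n / (n.factorial : ℂ)

/-- `IsE a` : the power series `∑ (a n / n!) zⁿ` is an E-function: its coefficients are
algebraic, it satisfies a nonzero linear differential equation over `ℚ̄[z]`, and the size of
the conjugates of the `a n` as well as their common denominators grow at most geometrically. -/
def IsE (a : ℕ → ℂ) : Prop :=
  (∀ n, IsAlgebraic ℚ (a n)) ∧
  (∃ (m : ℕ) (p : ℕ → Polynomial ℂ),
      (∀ i k, IsAlgebraic ℚ ((p i).coeff k)) ∧ (∃ i, i ≤ m ∧ p i ≠ 0) ∧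
      ∑ i ∈ Finset.range (m + 1), polyPS (p i) * psD^[i] (ePS a) = 0) ∧
  (∃ C : ℝ, 0 < C ∧ ∃ d : ℕ → ℕ, ∀ n : ℕ, 1 ≤ n →
      1 ≤ d n ∧ (d n : ℝ) ≤ C ^ n ∧
      (∀ σ : (integralClosure ℚ ℂ) →+* ℂ, ∀ h : a n ∈ integralClosure ℚ ℂ,
        ‖σ ⟨a n, h⟩‖ ≤ C ^ n) ∧
      (∀ i, 1 ≤ i → i ≤ n → IsIntegral ℤ ((d n : ℂ) * a i)))

/-- The value at `α` of the E-function with coefficient sequence `a`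
(E-functions are entire, so this series converges for all `α`). -/
def evalE (a : ℕ → ℂ) (α : ℂ) : ℂ := ∑' n : ℕ, a n / (n.factorial : ℂ) * α ^ n

/-- `IsM q f` : the formal power series `f` is an M_q-function, i.e. it has algebraic
coefficients and satisfies a linear `σ_q`-difference equation over `ℚ̄[z]` with
not-all-zero polynomial coefficients. -/
def IsM (q : ℕ) (f : PowerSeries ℂ) : Prop :=
  (∀ n, IsAlgebraic ℚ (PowerSeries.coeff n f)) ∧
  ∃ (m : ℕ) (p : ℕ → Polynomial ℂ),
    (∀ i k, IsAlgebraic ℚ ((p i).coeff k)) ∧ (∃ i, i ≤ m ∧ p i ≠ 0) ∧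
    ∑ i ∈ Finset.range (m + 1), polyPS (p i) * (psSigma q)^[i] f = 0

/-- `MahlerValue f α v` : the meromorphic extension of (the sum of) the power series `f`
to the open unit disk has no pole at `α` and takes the value `v` there. -/
def MahlerValue (f : PowerSeries ℂ) (α v : ℂ) : Prop :=
  ∃ F : ℂ → ℂ, MeromorphicOn F (Metric.ball (0 : ℂ) 1) ∧
    (∀ᶠ z in nhds (0 : ℂ), HasSum (fun n => PowerSeries.coeff n f * z ^ n) (F z)) ∧
    AnalyticAt ℂ F α ∧ F α = v

/-- The power series `f` converges (hence defines an analytic function) on the open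
disk `D(0,R)`. -/
def AnOnBall (f : PowerSeries ℂ) (R : ℝ) : Prop :=
  ∀ z : ℂ, ‖z‖ < R → Summable fun n => PowerSeries.coeff n f * z ^ n

/-- The value at `z` of (the sum of) the power series `f`. -/
def psEval (f : PowerSeries ℂ) (z : ℂ) : ℂ := ∑' n : ℕ, PowerSeries.coeff n f * z ^ n

/-- `Banal fv α P` : the homogeneous algebraic relation `P` among the values at `α` of the
power series `fv 1, …, fv r` is banal: it is the specialization at `z = α` of some
`Q ∈ ℚ̄[z, X₁, …, X_r]`, homogeneous in `X₁, …, X_r`, with `Q(z, fv 1, …, fv r) = 0`. -/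
def Banal {r : ℕ} (fv : Fin r → PowerSeries ℂ) (α : ℂ) (P : MvPolynomial (Fin r) ℂ) : Prop :=
  ∃ Q : MvPolynomial (Fin r) (Polynomial ℂ),
    (∀ v k, IsAlgebraic ℚ ((MvPolynomial.coeff v Q).coeff k)) ∧
    (∃ e, Q.IsHomogeneous e) ∧
    MvPolynomial.eval₂ polyPS fv Q = 0 ∧
    MvPolynomial.map (Polynomial.evalRingHom α) Q = P

/-- `Eset S` : the set of values at `z = 1` of all E-functions with coefficients in `S`. -/
def Eset (S : Set ℂ) : Set ℂ :=
  {x | ∃ a : ℕ → ℂ, IsE a ∧ (∀ n, a n ∈ S) ∧ x = evalE a 1}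

/-- `Mset q α S` : the set of values at `α` of all M_q-functions with coefficients in `S`
having no pole at `α`. -/
def Mset (q : ℕ) (α : ℂ) (S : Set ℂ) : Set ℂ :=
  {x | ∃ f : PowerSeries ℂ, IsM q f ∧ (∀ n, PowerSeries.coeff n f ∈ S) ∧ MahlerValue f α x}

namespace MahlerAux

open PowerSeries

section Operators

variable {K : Type*} [Field K]

/-- The section operator `Λ_r`, taking `∑ aₙ zⁿ` to `∑ a_{qn+r} zⁿ`. -/
noncomputable def sect (q r : ℕ) : K⟦X⟧ →ₗ[K] K⟦X⟧ where
  toFun g := PowerSeries.mk fun n => coeff (q * n + r) g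
  map_add' g h := by ext; simp
  map_smul' c g := by ext; simp

@[simp] lemma coeff_sect (q r n : ℕ) (g : K⟦X⟧) :
    coeff n (sect q r g) = coeff (q * n + r) g := by simp [sect]

/-- The Euler derivation `z d/dz`. -/
noncomputable def euler : Derivation K K⟦X⟧ K⟦X⟧ := (X : K⟦X⟧) • PowerSeries.derivative K

@[simp] lemma coeff_euler (n : ℕ) (g : K⟦X⟧) : coeff n (euler g) = n * coeff n g := by
  cases n with
  | zero => simp [euler]
  | succ n => simp [euler, coeff_succ_X_mul, coeff_derivative, mul_comm]

variable {q : ℕ} (hq : q ≠ 0)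

lemma eq_sum_sect (g : K⟦X⟧) :
    g = ∑ r ∈ Finset.range q, X ^ r * expand q hq (sect q r g) := by
  ext n
  have hlt : n % q < q := Nat.mod_lt _ (Nat.pos_of_ne_zero hq)
  rw [map_sum, Finset.sum_eq_single (n % q)]
  · rw [coeff_X_pow_mul', if_pos (Nat.mod_le n q)]
    have : n - n % q = q * (n / q) := by have := Nat.mod_add_div n q; omega
    rw [this, coeff_expand_mul, coeff_sect, Nat.div_add_mod]
  · intro r hr hne
    rw [coeff_X_pow_mul']
    split_ifs with h
    · refine coeff_expand_of_not_dvd q hq _ fun ⟨d, hd⟩ => hne ?_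
      have : n = r + q * d := by omega
      rw [this, Nat.add_mul_mod_self_left, Nat.mod_eq_of_lt (Finset.mem_range.1 hr)]
    · rfl
  · intro h; exact absurd (Finset.mem_range.2 hlt) h

lemma sect_X_pow_mul_expand {r s : ℕ} (hr : r < q) (hs : s < q) (h : K⟦X⟧) :
    sect q r (X ^ s * expand q hq h) = if r = s then h else 0 := by
  ext n
  rw [coeff_sect, coeff_X_pow_mul']
  split_ifs with h1 h2 h2
  · subst h2; simp [coeff_expand_mul]
  · rw [coeff_expand_of_not_dvd]
    · simp
    · rintro ⟨d, hd⟩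
      have h3 : q * n + r = s + q * d := by omega
      have := congrArg (· % q) h3
      simp [Nat.add_mod, Nat.mod_eq_of_lt hr, Nat.mod_eq_of_lt hs] at this
      exact h2 this
  · omega
  · simp

lemma sect_expand_mul {r : ℕ} (hr : r < q) (h g : K⟦X⟧) :
    sect q r (expand q hq h * g) = h * sect q r g := by
  conv_lhs => rw [eq_sum_sect hq g]
  have : ∀ s ∈ Finset.range q, sect q r (expand q hq h * (X ^ s * expand q hq (sect q s g))) =
      if r = s then h * sect q s g else 0 := by
    intro s hs
    rw [mul_left_comm, ← map_mul, sect_X_pow_mul_expand hq hr (Finset.mem_range.1 hs)]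
  rw [Finset.mul_sum, map_sum, Finset.sum_congr rfl this]
  simp [hr]

lemma euler_expand (g : K⟦X⟧) : euler (expand q hq g) = (q : K) • expand q hq (euler g) := by
  ext n
  by_cases h : q ∣ n
  · obtain ⟨d, rfl⟩ := h
    simp [coeff_expand_mul]; ring
  · simp [coeff_expand_of_not_dvd q hq _ h]

lemma sect_euler (r : ℕ) (g : K⟦X⟧) :
    sect q r (euler g) = (q : K) • euler (sect q r g) + (r : K) • sect q r g := by
  ext n
  simp; ring

/-- The section operator on polynomials. -/
noncomputable def polySect (q r : ℕ) (P : Polynomial K) : Polynomial K :=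
  Polynomial.contract q (Polynomial.divX^[r] P)

lemma coeff_polySect (q r n : ℕ) (hq : q ≠ 0) (P : Polynomial K) :
    (polySect q r P).coeff n = P.coeff (q * n + r) := by
  have : ∀ (r : ℕ) (P : Polynomial K) (n), (Polynomial.divX^[r] P).coeff n = P.coeff (n + r) := by
    intro r
    induction r with
    | zero => simp
    | succ r ih => intro P n; rw [Function.iterate_succ_apply, ih, Polynomial.coeff_divX]; rfl
  rw [polySect, Polynomial.coeff_contract hq, this, mul_comm]

lemma coe_polySect (hq : q ≠ 0) (r : ℕ) (P : Polynomial K) :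
    ((polySect q r P : Polynomial K) : K⟦X⟧) = sect q r (P : K⟦X⟧) := by
  ext n; simp [coeff_polySect _ _ _ hq]

lemma natDegree_polySect_mul_le (hq : q ≠ 0) (r : ℕ) (P : Polynomial K) :
    q * (polySect q r P).natDegree ≤ P.natDegree := by
  by_cases h : polySect q r P = 0
  · simp [h]
  have : (polySect q r P).coeff (polySect q r P).natDegree ≠ 0 := by simpa using h
  rw [coeff_polySect _ _ _ hq] at this
  have := Polynomial.le_natDegree_of_ne_zero this
  omega

lemma exists_polySect_ne_zero (hq : q ≠ 0) {P : Polynomial K} (hP : P ≠ 0) :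
    ∃ r < q, polySect q r P ≠ 0 := by
  refine ⟨P.natDegree % q, Nat.mod_lt _ (Nat.pos_of_ne_zero hq), fun h => ?_⟩
  have := congrArg (fun Q => Polynomial.coeff Q (P.natDegree / q)) h
  simp [coeff_polySect _ _ _ hq, Nat.div_add_mod] at this
  exact hP this

lemma coe_polyExpand (P : Polynomial K) :
    ((Polynomial.expand K q P : Polynomial K) : K⟦X⟧) = expand q hq (P : K⟦X⟧) := by
  ext n
  rw [Polynomial.coeff_coe, Polynomial.coeff_expand (Nat.pos_of_ne_zero hq), coeff_expand]
  simp

lemma exists_dvd_polyExpand (hq : q ≠ 0) {D : Polynomial K} (hD : D ≠ 0) :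
    ∃ E : Polynomial K, E ≠ 0 ∧ D ∣ Polynomial.expand K q E := by
  have : Module.Finite K (AdjoinRoot D) := (AdjoinRoot.powerBasis hD).finite
  have hint : IsIntegral K (AdjoinRoot.root D ^ q) := Algebra.IsIntegral.isIntegral _
  refine ⟨minpoly K (AdjoinRoot.root D ^ q), minpoly.ne_zero hint, ?_⟩
  rw [← AdjoinRoot.mk_eq_zero, ← AdjoinRoot.aeval_eq, Polynomial.expand_aeval, minpoly.aeval]

lemma expand_injective : Function.Injective (expand q hq : K⟦X⟧ → K⟦X⟧) := by
  intro f g h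
  ext n
  rw [← coeff_expand_mul q hq f, h, coeff_expand_mul]

end Operators
end MahlerAux

namespace MahlerAux

open PowerSeries

lemma isIntegralElem_comp {R A B : Type*} [CommRing R] [CommRing A] [CommRing B]
    (φ : R →+* A) (ψ : A →+* B) (hφ : φ.IsIntegral) {x : B} (hx : ψ.IsIntegralElem x) :
    (ψ.comp φ).IsIntegralElem x := by
  algebraize [φ, ψ, ψ.comp φ]
  have : Algebra.IsIntegral R A := ⟨hφ⟩
  exact isIntegral_trans (R := R) (A := A) x hx

section Stable

variable {K : Type*} [Field K] {q : ℕ} (hq : q ≠ 0)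

lemma algebraMap_poly (P : Polynomial K) : algebraMap (Polynomial K) K⟦X⟧ P = (P : K⟦X⟧) := by
  simp [PowerSeries.algebraMap_apply']

lemma poly_smul (P : Polynomial K) (g : K⟦X⟧) : P • g = (P : K⟦X⟧) * g := by
  rw [Algebra.smul_def, algebraMap_poly]

lemma isIntegral_expand {g : K⟦X⟧} (hg : IsIntegral (Polynomial K) g) :
    IsIntegral (Polynomial K) (expand q hq g) := by
  refine hg.map_of_comp_eq (φ := (Polynomial.expand K q : Polynomial K →+* Polynomial K))
    (ψ := ((expand q hq : K⟦X⟧ →ₐ[K] K⟦X⟧) : K⟦X⟧ →+* K⟦X⟧)) ?_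
  ext1
  · ext1; simp [algebraMap_poly, expand_C]
  · simp [algebraMap_poly]

lemma isIntegral_polyExpand {q : ℕ} (hq : q ≠ 0) :
    (Polynomial.expand K q : Polynomial K →+* Polynomial K).IsIntegral := by
  have hX : (Polynomial.expand K q : Polynomial K →+* Polynomial K).IsIntegralElem
      Polynomial.X := by
    refine ⟨Polynomial.X ^ q - Polynomial.C Polynomial.X, Polynomial.monic_X_pow_sub_C _ hq, ?_⟩
    simp
  have hC : ∀ a, (Polynomial.expand K q : Polynomial K →+* Polynomial K).IsIntegralElem
      (Polynomial.C a) := fun a => by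
    have := (Polynomial.expand K q : Polynomial K →+* Polynomial K).isIntegralElem_map
      (x := Polynomial.C a)
    simpa using this
  intro P
  induction P using Polynomial.induction_on with
  | C a => exact hC a
  | add P Q hP hQ => exact hP.add _ hQ
  | monomial n a h =>
    rw [pow_succ, ← mul_assoc]
    exact h.mul _ hX

lemma isIntegral_of_expand {g : K⟦X⟧} (hg : IsIntegral (Polynomial K) (expand q hq g)) :
    IsIntegral (Polynomial K) g := by
  obtain ⟨P, hP, h0⟩ := isIntegralElem_comp _ _ (isIntegral_polyExpand hq) hg
  refine ⟨P, hP, expand_injective hq ?_⟩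
  have : (algebraMap (Polynomial K) K⟦X⟧).comp (Polynomial.expand K q : Polynomial K →+* Polynomial K)
      = ((expand q hq : K⟦X⟧ →ₐ[K] K⟦X⟧) : K⟦X⟧ →+* K⟦X⟧).comp (algebraMap (Polynomial K) K⟦X⟧) := by
    ext1
    · ext1; simp [algebraMap_poly, expand_C]
    · simp [algebraMap_poly]
  rw [this] at h0
  rw [map_zero, ← h0]
  exact Polynomial.hom_eval₂ P (algebraMap (Polynomial K) K⟦X⟧) ((expand q hq : K⟦X⟧ →ₐ[K] K⟦X⟧) : K⟦X⟧ →+* K⟦X⟧) g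

lemma rescale_C' (c a : K) : rescale c (C a : K⟦X⟧) = C a := by
  ext n
  cases n <;> simp [coeff_rescale, coeff_C]

lemma isIntegral_rescale {g : K⟦X⟧} (c : K) (hg : IsIntegral (Polynomial K) g) :
    IsIntegral (Polynomial K) (rescale c g) := by
  refine hg.map_of_comp_eq (φ := (Polynomial.compRingHom (Polynomial.C c * Polynomial.X)))
    (ψ := rescale c) ?_
  ext1
  · ext1; simp [algebraMap_poly, rescale_C']
  · simp [algebraMap_poly]

/-- Extraction of the part of a power series supported on a residue class. -/
lemma X_pow_mul_expand_sect [CharZero K] {ζ : K} (hζ : IsPrimitiveRoot ζ q) {r : ℕ} (hr : r < q)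
    (g : K⟦X⟧) : X ^ r * expand q hq (sect q r g) =
      (q : K)⁻¹ • ∑ i ∈ Finset.range q, (ζ ^ (i * (q - r))) • rescale (ζ ^ i) g := by
  ext n
  have hq0 : (q : K) ≠ 0 := Nat.cast_ne_zero.2 hq
  have hsum : ∑ i ∈ Finset.range q, (ζ ^ (n + (q - r))) ^ i =
      if q ∣ n + (q - r) then (q : K) else 0 := by
    split_ifs with h
    · rw [(hζ.pow_eq_one_iff_dvd _).2 h]; simp
    · have h1 : ζ ^ (n + (q - r)) ≠ 1 := fun h' => h ((hζ.pow_eq_one_iff_dvd _).1 h')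
      rw [geom_sum_eq h1, ← pow_mul, mul_comm, pow_mul, hζ.pow_eq_one]; simp
  have hR : coeff n ((q : K)⁻¹ • ∑ i ∈ Finset.range q, (ζ ^ (i * (q - r))) • rescale (ζ ^ i) g) =
      (q : K)⁻¹ * ((∑ i ∈ Finset.range q, (ζ ^ (n + (q - r))) ^ i) * coeff n g) := by
    simp only [map_smul, map_sum, coeff_rescale, smul_eq_mul, Finset.sum_mul]
    congr 1
    refine Finset.sum_congr rfl fun i _ => ?_
    ring
  rw [hR, hsum, coeff_X_pow_mul']
  by_cases h1 : q ∣ n + (q - r)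
  · obtain ⟨d, hd⟩ := h1
    have hd1 : d ≠ 0 := by rintro rfl; omega
    obtain ⟨e, rfl⟩ := Nat.exists_eq_succ_of_ne_zero hd1
    have hn : n = r + q * e := by rw [Nat.mul_succ] at hd; omega
    subst hn
    rw [if_pos (Nat.le_add_right _ _), if_pos ⟨_, hd⟩, Nat.add_sub_cancel_left, coeff_expand_mul,
      coeff_sect, add_comm r]
    field_simp
  · rw [if_neg h1]
    split_ifs with h2
    · rw [coeff_expand_of_not_dvd]
      · simp
      · rintro ⟨d, hd⟩
        refine h1 ⟨d + 1, ?_⟩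
        rw [Nat.mul_succ]; omega
    · simp

lemma isIntegral_X_pow_mul_expand_sect [CharZero K] {ζ : K} (hζ : IsPrimitiveRoot ζ q) {r : ℕ}
    (hr : r < q) {g : K⟦X⟧} (hg : IsIntegral (Polynomial K) g) :
    IsIntegral (Polynomial K) (X ^ r * expand q hq (sect q r g)) := by
  rw [X_pow_mul_expand_sect hq hζ hr]
  have hK : ∀ (c : K) (h : K⟦X⟧), IsIntegral (Polynomial K) h → IsIntegral (Polynomial K) (c • h) := by
    intro c h hh
    have : c • h = (Polynomial.C c : Polynomial K) • h := by
      rw [poly_smul]; ext; simp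
    rw [this]
    exact hh.smul _
  refine hK _ _ (IsIntegral.sum _ fun i _ => hK _ _ (isIntegral_rescale _ hg))

end Stable

section Derivation
variable {K : Type*} [Field K]

lemma euler_aeval (Φ : Polynomial (Polynomial K)) (g : K⟦X⟧) :
    ∃ Ψ : Polynomial (Polynomial K), euler (Polynomial.aeval g Φ) =
      Polynomial.aeval g Ψ + Polynomial.aeval g Φ.derivative * euler g := by
  induction Φ using Polynomial.induction_on' with
  | add P Q hP hQ =>
    obtain ⟨A, hA⟩ := hP
    obtain ⟨B, hB⟩ := hQ
    refine ⟨A + B, ?_⟩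
    simp only [map_add, hA, hB]
    ring
  | monomial n P =>
    refine ⟨Polynomial.monomial n (Polynomial.X * P.derivative), ?_⟩
    simp only [Polynomial.aeval_monomial, Polynomial.derivative_monomial, algebraMap_poly,
      Derivation.leibniz, Derivation.leibniz_pow]
    have : euler (P : K⟦X⟧) = ((Polynomial.X * P.derivative : Polynomial K) : K⟦X⟧) := by
      simp [euler, derivative_coe]
    have hn : ((n : Polynomial K) : K⟦X⟧) = n :=
      map_natCast (Polynomial.coeToPowerSeries.ringHom (R := K)) n
    rw [this]
    simp only [Polynomial.coe_mul, Polynomial.coe_X, nsmul_eq_mul, smul_eq_mul, hn]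
    ring

variable [CharZero K]

/-- A division-closed algebra of algebraic power series is stable under `z d/dz`. -/
lemma euler_mem {A : Subalgebra (Polynomial K) K⟦X⟧}
    (hdiv : ∀ b ∈ A, b ≠ 0 → ∀ h, b * h ∈ A → h ∈ A)
    {g : K⟦X⟧} (hg : g ∈ A) (halg : IsAlgebraic (Polynomial K) g) : euler g ∈ A := by
  obtain ⟨Φ₀, hΦ₀⟩ := halg
  have hex : ∃ n, ∃ Φ : Polynomial (Polynomial K), Φ ≠ 0 ∧ Polynomial.aeval g Φ = 0 ∧
    Φ.natDegree = n := ⟨_, Φ₀, hΦ₀.1, hΦ₀.2, rfl⟩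
  classical
  obtain ⟨Φ, hΦ, hΦg, hdeg⟩ := Nat.find_spec hex
  have hmin := fun m => Nat.find_min hex (m := m)
  rw [← hdeg] at hmin
  have hpos : Φ.natDegree ≠ 0 := by
    intro h0
    rw [Polynomial.eq_C_of_natDegree_eq_zero h0] at hΦg hΦ
    simp [algebraMap_poly] at hΦg
    simp [hΦg] at hΦ
  have hder : Polynomial.aeval g Φ.derivative ≠ 0 := by
    intro h
    have hlt : Φ.derivative.natDegree < Φ.natDegree := Polynomial.natDegree_derivative_lt hpos
    refine hmin _ hlt ⟨_, fun h0 => hpos ?_, h, rfl⟩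
    exact Polynomial.derivative_eq_zero.1 h0
  obtain ⟨Ψ, hΨ⟩ := euler_aeval Φ g
  rw [hΦg, map_zero] at hΨ
  have hmem : ∀ Ξ : Polynomial (Polynomial K), Polynomial.aeval g Ξ ∈ A := fun Ξ =>
    Algebra.adjoin_le (Set.singleton_subset_iff.2 hg) (Polynomial.aeval_mem_adjoin_singleton _ _)
  refine hdiv _ (hmem Φ.derivative) hder _ ?_
  have : Polynomial.aeval g Φ.derivative * euler g = - Polynomial.aeval g Ψ := by
    linear_combination -hΨ
  rw [this]
  exact neg_mem (hmem _)

end Derivation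
end MahlerAux

namespace MahlerAux

open PowerSeries

section Stable

variable {K : Type*} [Field K]

lemma X_mem (A : Subalgebra (Polynomial K) K⟦X⟧) (P : Polynomial K) : (P : K⟦X⟧) ∈ A := by
  rw [← algebraMap_poly]; exact A.algebraMap_mem P

/-- A division-closed algebra of power series of finite rank over the polynomials, stable under
`z ↦ z^q`, whose integral elements form a finitely generated module. -/
structure IsMahlerStable (q : ℕ) (hq : q ≠ 0) (A : Subalgebra (Polynomial K) K⟦X⟧) : Prop where
  div : ∀ b ∈ A, b ≠ 0 → ∀ h, b * h ∈ A → h ∈ A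
  expand_mem : ∀ g ∈ A, expand q hq g ∈ A
  rank : ∃ (n : ℕ) (y : Fin n → K⟦X⟧), (∀ i, y i ∈ A) ∧ LinearIndependent (Polynomial K) y ∧
    ∀ y' : Fin n → K⟦X⟧, (∀ i, y' i ∈ A) → LinearIndependent (Polynomial K) y' →
      ∀ g ∈ A, ∃ D : Polynomial K, D ≠ 0 ∧ D • g ∈ Submodule.span (Polynomial K) (Set.range y')
  algebraic : ∀ g ∈ A, IsAlgebraic (Polynomial K) g
  fg : (Subalgebra.toSubmodule (A ⊓ integralClosure (Polynomial K) K⟦X⟧)).FG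

lemma linearIndependent_expand {q : ℕ} (hq : q ≠ 0) {n : ℕ} {y : Fin n → K⟦X⟧}
    (hy : LinearIndependent (Polynomial K) y) :
    LinearIndependent (Polynomial K) fun i => expand q hq (y i) := by
  rw [Fintype.linearIndependent_iff] at hy ⊢
  intro c hc i
  ext n
  have key : ∀ r < q, ∑ i, polySect q r (c i) • y i = 0 := by
    intro r hr
    have := congrArg (sect q r) hc
    rw [map_sum, map_zero] at this
    rw [← this]
    refine Finset.sum_congr rfl fun i _ => ?_
    rw [poly_smul, poly_smul, mul_comm, mul_comm (c i : K⟦X⟧), sect_expand_mul hq hr,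
      coe_polySect hq]
  have h := hy _ (key (n % q) (Nat.mod_lt _ (Nat.pos_of_ne_zero hq))) i
  have := congrArg (fun P => Polynomial.coeff P (n / q)) h
  simpa [coeff_polySect _ _ _ hq, Nat.div_add_mod] using this

/-- Elements of the algebra that become integral after multiplication by a power of `z`. -/
def LocInt (A : Subalgebra (Polynomial K) K⟦X⟧) (g : K⟦X⟧) : Prop :=
  g ∈ A ∧ ∃ n : ℕ, IsIntegral (Polynomial K) (X ^ n * g)

variable {A : Subalgebra (Polynomial K) K⟦X⟧}

lemma isIntegral_coe (P : Polynomial K) : IsIntegral (Polynomial K) (P : K⟦X⟧) := by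
  rw [← algebraMap_poly]; exact isIntegral_algebraMap

lemma isIntegral_X_pow (n : ℕ) : IsIntegral (Polynomial K) (X ^ n : K⟦X⟧) := by
  have := isIntegral_coe (Polynomial.X ^ n : Polynomial K)
  simpa using this

lemma LocInt.mul {g h : K⟦X⟧} (hg : LocInt A g) (hh : LocInt A h) : LocInt A (g * h) := by
  obtain ⟨hg, n, hn⟩ := hg
  obtain ⟨hh, m, hm⟩ := hh
  refine ⟨mul_mem hg hh, n + m, ?_⟩
  have : (X ^ (n + m) * (g * h) : K⟦X⟧) = (X ^ n * g) * (X ^ m * h) := by ring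
  rw [this]
  exact hn.mul hm

lemma locInt_coe (P : Polynomial K) : LocInt A (P : K⟦X⟧) :=
  ⟨X_mem A P, 0, by simpa using isIntegral_coe P⟩

lemma LocInt.smul {g : K⟦X⟧} (c : K) (hg : LocInt A g) : LocInt A (c • g) := by
  have := (locInt_coe (A := A) (Polynomial.C c)).mul hg
  rwa [show ((Polynomial.C c : Polynomial K) : K⟦X⟧) * g = c • g by ext; simp] at this

lemma LocInt.of_X_pow_mul (hdiv : ∀ b ∈ A, b ≠ 0 → ∀ h, b * h ∈ A → h ∈ A) {n : ℕ} {g : K⟦X⟧}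
    (h : LocInt A (X ^ n * g)) : LocInt A g := by
  obtain ⟨h1, m, h2⟩ := h
  refine ⟨hdiv _ (by simpa using X_mem A (Polynomial.X ^ n)) (pow_ne_zero _ X_ne_zero) _ h1,
    m + n, ?_⟩
  rwa [pow_add, mul_assoc]

variable {q : ℕ} {hq : q ≠ 0}

lemma IsMahlerStable.sect_mem (hA : IsMahlerStable q hq A) {r : ℕ} (hr : r < q) {g : K⟦X⟧}
    (hg : g ∈ A) : sect q r g ∈ A := by
  obtain ⟨n, y, hyA, hy, hmax⟩ := hA.rank
  obtain ⟨D, hD, hDg⟩ := hmax _ (fun i => hA.expand_mem _ (hyA i)) (linearIndependent_expand hq hy)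
    g hg
  obtain ⟨E, hE, F, hF⟩ := exists_dvd_polyExpand hq hD
  obtain ⟨c, hc⟩ := (Submodule.mem_span_range_iff_exists_fun _).1 (Submodule.smul_mem _ F hDg)
  rw [smul_smul, mul_comm F, ← hF, poly_smul, coe_polyExpand hq] at hc
  have h2 := congrArg (sect q r) hc
  rw [sect_expand_mul hq hr, map_sum] at h2
  refine hA.div _ (X_mem A E) (by simpa using hE) _ ?_
  rw [← h2]
  refine sum_mem fun i _ => ?_
  rw [poly_smul, mul_comm, sect_expand_mul hq hr, ← coe_polySect hq]
  exact mul_mem (hyA i) (X_mem A _)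

lemma IsMahlerStable.locInt_expand (hA : IsMahlerStable q hq A) {g : K⟦X⟧} (hg : LocInt A g) :
    LocInt A (expand q hq g) := by
  obtain ⟨hg, n, hn⟩ := hg
  refine ⟨hA.expand_mem _ hg, q * n, ?_⟩
  have := isIntegral_expand hq hn
  rwa [map_mul, map_pow, expand_X, ← pow_mul] at this

lemma IsMahlerStable.locInt_sect [CharZero K] {ζ : K} (hζ : IsPrimitiveRoot ζ q)
    (hA : IsMahlerStable q hq A) {r : ℕ} (hr : r < q) {g : K⟦X⟧} (hg : LocInt A g) :
    LocInt A (sect q r g) := by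
  obtain ⟨hg, n, hn⟩ := hg
  refine ⟨hA.sect_mem hr hg, n + 1, isIntegral_of_expand hq ?_⟩
  have h1 : IsIntegral (Polynomial K) (X ^ (q * n) * g) := by
    have : (X ^ (q * n) * g : K⟦X⟧) = X ^ (q * n - n) * (X ^ n * g) := by
      rw [← mul_assoc, ← pow_add, Nat.sub_add_cancel (Nat.le_mul_of_pos_left n (by omega))]
    rw [this]
    exact (isIntegral_X_pow _).mul hn
  have h2 := isIntegral_X_pow_mul_expand_sect hq hζ hr h1
  rw [pow_mul, ← expand_X q hq, ← map_pow, sect_expand_mul hq hr] at h2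
  have h3 := (isIntegral_X_pow (q - r)).mul h2
  rw [← mul_assoc, ← pow_add, Nat.sub_add_cancel hr.le] at h3
  rw [pow_succ', mul_assoc, map_mul, expand_X]
  exact h3

lemma IsMahlerStable.exists_mul_euler (hA : IsMahlerStable q hq A) [CharZero K] :
    ∃ D : Polynomial K, D ≠ 0 ∧ ∀ g, LocInt A g → LocInt A ((D : K⟦X⟧) * euler g) := by
  obtain ⟨S, hS⟩ := hA.fg
  have hSA : ∀ w ∈ S, w ∈ A ∧ IsIntegral (Polynomial K) w := fun w hw => by
    have : w ∈ Subalgebra.toSubmodule (A ⊓ integralClosure (Polynomial K) K⟦X⟧) := by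
      rw [← hS]; exact Submodule.subset_span hw
    simpa [mem_integralClosure_iff] using this
  have heu : ∀ w : K⟦X⟧, w ∈ A → euler w ∈ A := fun w hw =>
    euler_mem hA.div hw (hA.algebraic w hw)
  have : ∀ w : K⟦X⟧, ∃ D : Polynomial K, D ≠ 0 ∧ (w ∈ S → IsIntegral (Polynomial K) (D • euler w)) := by
    intro w
    by_cases hw : w ∈ S
    · obtain ⟨y, hy, hy'⟩ := (hA.algebraic _ (heu w (hSA w hw).1)).exists_integral_multiple
      exact ⟨y, hy, fun _ => hy'⟩
    · exact ⟨1, one_ne_zero, fun h => absurd h hw⟩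
  choose D hD0 hD using this
  refine ⟨∏ w ∈ S, D w, Finset.prod_ne_zero_iff.2 fun w _ => hD0 w, ?_⟩
  set E := ∏ w ∈ S, D w
  have hEw : ∀ w ∈ S, IsIntegral (Polynomial K) ((E : K⟦X⟧) * euler w) := by
    intro w hw
    obtain ⟨F, hF⟩ := Finset.dvd_prod_of_mem D hw
    have : (E : K⟦X⟧) * euler w = (F : K⟦X⟧) * (D w • euler w) := by
      rw [poly_smul, show E = D w * F from hF]; push_cast; ring
    rw [this]
    exact (isIntegral_coe F).mul (hD w hw)
  have hO : ∀ g ∈ Submodule.span (Polynomial K) (S : Set K⟦X⟧),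
      IsIntegral (Polynomial K) ((E : K⟦X⟧) * euler g) := by
    intro g hg
    induction hg using Submodule.span_induction with
    | mem w hw => exact hEw w hw
    | zero => simp [isIntegral_zero]
    | add x y _ _ hx hy => rw [map_add, mul_add]; exact hx.add hy
    | smul P x hx' hx =>
      have hxi : IsIntegral (Polynomial K) x := by
        rw [hS] at hx'
        have : x ∈ A ∧ IsIntegral (Polynomial K) x := by
          simpa [mem_integralClosure_iff] using hx'
        exact this.2
      have h1 : euler (P : K⟦X⟧) = ((Polynomial.X * P.derivative : Polynomial K) : K⟦X⟧) := by
        simp [euler, derivative_coe]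
      have : (E : K⟦X⟧) * euler (P • x) = (P : K⟦X⟧) * (E * euler x) +
          ((E * (Polynomial.X * P.derivative) : Polynomial K) : K⟦X⟧) * x := by
        rw [poly_smul, Derivation.leibniz, h1, smul_eq_mul, smul_eq_mul, Polynomial.coe_mul E]; ring
      rw [this]
      exact ((isIntegral_coe P).mul hx).add ((isIntegral_coe _).mul hxi)
  rintro g ⟨hg, n, hn⟩
  refine ⟨mul_mem (X_mem A _) (heu g hg), n, ?_⟩
  have hmem : X ^ n * g ∈ Submodule.span (Polynomial K) (S : Set K⟦X⟧) := by
    rw [hS]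
    have h1 : (X ^ n * g : K⟦X⟧) ∈ A := mul_mem (by simpa using X_mem A (Polynomial.X ^ n)) hg
    simpa [mem_integralClosure_iff] using And.intro h1 hn
  have h1 := hO _ hmem
  have h2 : euler (X ^ n : K⟦X⟧) = (n : K⟦X⟧) * X ^ n := by
    ext m; simp only [coeff_euler, coeff_X_pow]
    rw [show (n : K⟦X⟧) = C (n : K) by simp, coeff_C_mul, coeff_X_pow]
    split_ifs with h <;> simp [h]
  have h3 : X ^ n * ((E : K⟦X⟧) * euler g) =
      (E : K⟦X⟧) * euler (X ^ n * g) - ((E * (n : Polynomial K) : Polynomial K) : K⟦X⟧) * (X ^ n * g) := by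
    rw [Derivation.leibniz, h2, smul_eq_mul, smul_eq_mul, Polynomial.coe_mul,
      show ((n : Polynomial K) : K⟦X⟧) = n from
        map_natCast (Polynomial.coeToPowerSeries.ringHom (R := K)) n]
    ring
  rw [h3]
  exact h1.sub ((isIntegral_coe _).mul hn)

lemma IsMahlerStable.locInt_euler [CharZero K] {ζ : K} (hζ : IsPrimitiveRoot ζ q) (hq2 : 2 ≤ q)
    (hA : IsMahlerStable q hq A) {g : K⟦X⟧} (hg : LocInt A g) : LocInt A (euler g) := by
  classical
  have hex : ∃ n, ∃ D : Polynomial K, D ≠ 0 ∧ (∀ g, LocInt A g → LocInt A ((D : K⟦X⟧) * euler g)) ∧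
      D.natDegree = n := by
    obtain ⟨D, h1, h2⟩ := hA.exists_mul_euler
    exact ⟨_, D, h1, h2, rfl⟩
  obtain ⟨D, hD0, hD, hdeg⟩ := Nat.find_spec hex
  have hmin := fun m => Nat.find_min' hex (m := m)
  rw [← hdeg] at hmin
  obtain ⟨r, hr, hr0⟩ := exists_polySect_ne_zero hq hD0
  have hDr : ∀ g, LocInt A g → LocInt A ((polySect q r D : K⟦X⟧) * euler g) := by
    intro g hg
    have h1 := hA.locInt_sect hζ hr (hD _ (hA.locInt_expand hg))
    have hq0 : (q : K) ≠ 0 := Nat.cast_ne_zero.2 hq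
    rw [euler_expand, mul_smul_comm, map_smul, mul_comm, sect_expand_mul hq hr,
      ← coe_polySect hq] at h1
    have := h1.smul (q : K)⁻¹
    rwa [smul_smul, inv_mul_cancel₀ hq0, one_smul, mul_comm] at this
  have hle := hmin _ ⟨_, hr0, hDr, rfl⟩
  have h2 := natDegree_polySect_mul_le hq r D
  have h3 : D.natDegree = 0 := by nlinarith
  rw [Polynomial.eq_C_of_natDegree_eq_zero h3] at hD hD0
  have hc : D.coeff 0 ≠ 0 := by simpa using hD0
  have := (hD g hg).smul (D.coeff 0)⁻¹
  rwa [show (D.coeff 0)⁻¹ • (((Polynomial.C (D.coeff 0) : Polynomial K) : K⟦X⟧) * euler g) =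
    euler g by ext; simp [hc]] at this

end Stable
end MahlerAux

namespace MahlerAux

open PowerSeries

section Filtration

variable {K : Type*} [Field K]

/-- The `K`-span of the products `z^a w` with `a ≤ e` and `w ∈ S`. -/
noncomputable def gradedSpan (S : Finset K⟦X⟧) (e : ℕ) : Submodule K K⟦X⟧ :=
  Submodule.span K (Set.image2 (fun a w => X ^ a * w) (Set.Iic e) (S : Set K⟦X⟧))

/-- The series `g` such that `z^B g` lies in the span of the `z^a w` with `a ≤ 2B`, `w ∈ S`. -/
noncomputable def filt (S : Finset K⟦X⟧) (B : ℕ) : Submodule K K⟦X⟧ :=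
  (gradedSpan S (2 * B)).comap (LinearMap.mulLeft K (X ^ B))

variable {S : Finset K⟦X⟧}

lemma mem_filt {B : ℕ} {g : K⟦X⟧} : g ∈ filt S B ↔ X ^ B * g ∈ gradedSpan S (2 * B) := Iff.rfl

lemma gradedSpan_mono {e e' : ℕ} (h : e ≤ e') : gradedSpan S e ≤ gradedSpan S e' :=
  Submodule.span_mono (Set.image2_subset (Set.Iic_subset_Iic.2 h) subset_rfl)

lemma X_pow_mul_mem_gradedSpan {e : ℕ} (b : ℕ) {g : K⟦X⟧} (hg : g ∈ gradedSpan S e) :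
    X ^ b * g ∈ gradedSpan S (e + b) := by
  induction hg using Submodule.span_induction with
  | mem g hg =>
    obtain ⟨a, ha, w, hw, rfl⟩ := hg
    refine Submodule.subset_span ⟨a + b, ?_, w, hw, ?_⟩
    · simpa using ha
    · simp only; ring
  | zero => simp
  | add x y _ _ hx hy => rw [mul_add]; exact add_mem hx hy
  | smul c x _ hx => rw [mul_smul_comm]; exact Submodule.smul_mem _ c hx

lemma poly_mul_mem_gradedSpan {e : ℕ} (P : Polynomial K) {g : K⟦X⟧} (hg : g ∈ gradedSpan S e) :
    (P : K⟦X⟧) * g ∈ gradedSpan S (e + P.natDegree) := by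
  have : (P : K⟦X⟧) = ∑ i ∈ Finset.range (P.natDegree + 1), P.coeff i • X ^ i := by
    conv_lhs => rw [P.as_sum_range_C_mul_X_pow]
    rw [← Polynomial.coeToPowerSeries.ringHom_apply, map_sum]
    refine Finset.sum_congr rfl fun i _ => ?_
    simp [smul_eq_C_mul]
  rw [this, Finset.sum_mul]
  refine sum_mem fun i hi => ?_
  rw [smul_mul_assoc]
  refine Submodule.smul_mem _ _ (gradedSpan_mono ?_ (X_pow_mul_mem_gradedSpan i hg))
  have := Finset.mem_range.1 hi
  omega

lemma exists_mem_gradedSpan {g : K⟦X⟧}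
    (hg : g ∈ Submodule.span (Polynomial K) (S : Set K⟦X⟧)) : ∃ e, g ∈ gradedSpan S e := by
  induction hg using Submodule.span_induction with
  | mem g hg => exact ⟨0, Submodule.subset_span ⟨0, by simp, g, hg, by simp⟩⟩
  | zero => exact ⟨0, zero_mem _⟩
  | add x y _ _ hx hy =>
    obtain ⟨e, he⟩ := hx
    obtain ⟨e', he'⟩ := hy
    exact ⟨max e e', add_mem (gradedSpan_mono (le_max_left _ _) he)
      (gradedSpan_mono (le_max_right _ _) he')⟩
  | smul P x _ hx =>
    obtain ⟨e, he⟩ := hx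
    exact ⟨_, by rw [poly_smul]; exact poly_mul_mem_gradedSpan P he⟩

lemma gradedSpan_le {e : ℕ} {g : K⟦X⟧} (hg : g ∈ gradedSpan S e) :
    g ∈ Submodule.span (Polynomial K) (S : Set K⟦X⟧) := by
  induction hg using Submodule.span_induction with
  | mem g hg =>
    obtain ⟨a, -, w, hw, rfl⟩ := hg
    have := Submodule.smul_mem _ (Polynomial.X ^ a : Polynomial K)
      (Submodule.subset_span (R := Polynomial K) hw)
    simpa [poly_smul] using this
  | zero => exact zero_mem _
  | add x y _ _ hx hy => exact add_mem hx hy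
  | smul c x _ hx =>
    have := Submodule.smul_mem _ (Polynomial.C c) hx
    rwa [poly_smul, show ((Polynomial.C c : Polynomial K) : K⟦X⟧) * x = c • x by ext; simp] at this

lemma filt_mono {B B' : ℕ} (h : B ≤ B') : filt S B ≤ filt S B' := by
  intro g hg
  rw [mem_filt] at hg ⊢
  have := X_pow_mul_mem_gradedSpan (B' - B) hg
  rw [← mul_assoc, ← pow_add, Nat.sub_add_cancel h] at this
  exact gradedSpan_mono (by omega) this

instance finite_gradedSpan (e : ℕ) : Module.Finite K (gradedSpan S e) := by
  refine Module.Finite.span_of_finite K (Set.Finite.image2 _ (Set.finite_Iic e) S.finite_toSet)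

instance finite_filt (B : ℕ) : Module.Finite K (filt S B) := by
  let φ : filt S B →ₗ[K] gradedSpan S (2 * B) :=
    (LinearMap.mulLeft K (X ^ B)).restrict fun g hg => hg
  refine Module.Finite.of_injective φ fun x y h => Subtype.ext ?_
  have := congrArg Subtype.val h
  exact mul_left_cancel₀ (pow_ne_zero B (X_ne_zero (R := K))) this

variable {A : Subalgebra (Polynomial K) K⟦X⟧}

lemma locInt_iff_exists_mem_filt (hdiv : ∀ b ∈ A, b ≠ 0 → ∀ h, b * h ∈ A → h ∈ A)
    (hS : Submodule.span (Polynomial K) (S : Set K⟦X⟧) =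
      Subalgebra.toSubmodule (A ⊓ integralClosure (Polynomial K) K⟦X⟧)) {g : K⟦X⟧} :
    LocInt A g ↔ ∃ B, g ∈ filt S B := by
  constructor
  · rintro ⟨hg, n, hn⟩
    have hmem : X ^ n * g ∈ Submodule.span (Polynomial K) (S : Set K⟦X⟧) := by
      rw [hS]
      have h1 : (X ^ n * g : K⟦X⟧) ∈ A := mul_mem (by simpa using X_mem A (Polynomial.X ^ n)) hg
      simpa [mem_integralClosure_iff] using And.intro h1 hn
    obtain ⟨e, he⟩ := exists_mem_gradedSpan hmem
    refine ⟨e + n, ?_⟩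
    rw [mem_filt, pow_add, mul_assoc]
    exact gradedSpan_mono (by omega) (X_pow_mul_mem_gradedSpan e he)
  · rintro ⟨B, hB⟩
    have h1 := gradedSpan_le (mem_filt.1 hB)
    rw [hS] at h1
    have h2 : X ^ B * g ∈ A ∧ IsIntegral (Polynomial K) (X ^ B * g) := by
      simpa [mem_integralClosure_iff] using h1
    exact LocInt.of_X_pow_mul (n := B) hdiv ⟨h2.1, 0, by simpa using h2.2⟩

variable {q : ℕ} {hq : q ≠ 0}

lemma IsMahlerStable.exists_sect_filt [CharZero K] {ζ : K} (hζ : IsPrimitiveRoot ζ q)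
    (hq2 : 2 ≤ q) (hA : IsMahlerStable q hq A)
    (hS : Submodule.span (Polynomial K) (S : Set K⟦X⟧) =
      Subalgebra.toSubmodule (A ⊓ integralClosure (Polynomial K) K⟦X⟧)) :
    ∃ c, ∀ B, ∀ r < q, ∀ g ∈ filt S B, sect q r g ∈ filt S (B / 2 + c) := by
  have h1 : ∀ (r s : ℕ) (w : K⟦X⟧), ∃ c, r < q → w ∈ S → sect q r (X ^ s * w) ∈ filt S c := by
    intro r s w
    by_cases h : r < q ∧ w ∈ S
    · have hw : LocInt A w := (locInt_iff_exists_mem_filt hA.div hS).2 ⟨0, by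
        rw [mem_filt]
        exact Submodule.subset_span ⟨0, by simp, w, h.2, by simp⟩⟩
      have hXw : LocInt A (X ^ s * w) := by
        have := (locInt_coe (A := A) (Polynomial.X ^ s)).mul hw
        simpa using this
      obtain ⟨c, hc⟩ := (locInt_iff_exists_mem_filt hA.div hS).1 (hA.locInt_sect hζ h.1 hXw)
      exact ⟨c, fun _ _ => hc⟩
    · exact ⟨0, fun h1 h2 => absurd ⟨h1, h2⟩ h⟩
  choose c hc using h1
  obtain ⟨c₀, hc₀⟩ : ∃ c₀, ∀ r < q, ∀ s < q, ∀ w ∈ S, sect q r (X ^ s * w) ∈ filt S c₀ := by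
    refine ⟨(Finset.range q).sup fun r => (Finset.range q).sup fun s => S.sup fun w => c r s w, ?_⟩
    intro r hr s hs w hw
    refine filt_mono ?_ (hc r s w hr hw)
    refine le_trans ?_ (Finset.le_sup (Finset.mem_range.2 hr))
    refine le_trans ?_ (Finset.le_sup (Finset.mem_range.2 hs))
    exact Finset.le_sup (f := fun w => c r s w) hw
  have h2 : ∀ r < q, ∀ e, ∀ h ∈ gradedSpan S e,
      X ^ c₀ * sect q r h ∈ gradedSpan S (2 * c₀ + e / q) := by
    intro r hr e h hh
    induction hh using Submodule.span_induction with
    | mem g hg =>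
      obtain ⟨a, ha, w, hw, rfl⟩ := hg
      have h3 : (X ^ a * w : K⟦X⟧) = expand q hq (X ^ (a / q)) * (X ^ (a % q) * w) := by
        rw [map_pow, expand_X, ← pow_mul, ← mul_assoc, ← pow_add, Nat.div_add_mod]
      simp only
      rw [h3, sect_expand_mul hq hr, mul_left_comm]
      refine gradedSpan_mono ?_ (X_pow_mul_mem_gradedSpan (a / q)
        (mem_filt.1 (hc₀ r hr _ (Nat.mod_lt _ (by omega)) w hw)))
      have := Nat.div_le_div_right (c := q) (Set.mem_Iic.1 ha)
      omega
    | zero => simp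
    | add x y _ _ hx hy => rw [map_add, mul_add]; exact add_mem hx hy
    | smul c x _ hx => rw [map_smul, mul_smul_comm]; exact Submodule.smul_mem _ c hx
  refine ⟨c₀ + 1, fun B r hr g hg => ?_⟩
  set B' := B / 2 + 1
  have hB : B ≤ q * B' := by
    have : 2 * B' ≤ q * B' := Nat.mul_le_mul_right _ hq2
    omega
  have h3 := X_pow_mul_mem_gradedSpan (q * B' - B) (mem_filt.1 hg)
  rw [← mul_assoc, ← pow_add, Nat.sub_add_cancel hB] at h3
  have h4 := h2 r hr _ _ h3
  rw [pow_mul, ← expand_X q hq, ← map_pow, sect_expand_mul hq hr, ← mul_assoc, ← pow_add] at h4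
  rw [mem_filt, show B / 2 + (c₀ + 1) = c₀ + B' by omega]
  refine gradedSpan_mono ?_ h4
  have h5 : (2 * B + (q * B' - B)) / q = B / q + B' := by
    rw [show 2 * B + (q * B' - B) = B + q * B' by omega, Nat.add_mul_div_left _ _ (by omega)]
  have h6 : B / q ≤ B / 2 := Nat.div_le_div_left hq2 (by norm_num)
  omega

/-- The span of the images of a space of power series under the section operators. -/
noncomputable def sectSpan (q : ℕ) (V : Submodule K K⟦X⟧) : Submodule K K⟦X⟧ :=
  ⨆ r : Fin q, V.map (sect q r)

lemma sectSpan_mono {V W : Submodule K K⟦X⟧} (h : V ≤ W) : sectSpan q V ≤ sectSpan q W :=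
  iSup_mono fun _ => Submodule.map_mono h

lemma sectSpan_iterate_mono (k : ℕ) {V W : Submodule K K⟦X⟧} (h : V ≤ W) :
    (sectSpan q)^[k] V ≤ (sectSpan q)^[k] W :=
  Monotone.iterate (f := sectSpan q) (fun _ _ => sectSpan_mono) k h

lemma sectSpan_le {V W : Submodule K K⟦X⟧} (h : ∀ r < q, ∀ g ∈ V, sect q r g ∈ W) :
    sectSpan q V ≤ W :=
  iSup_le fun r => Submodule.map_le_iff_le_comap.2 fun g hg => h r r.2 g hg

lemma sect_mem_sectSpan {V : Submodule K K⟦X⟧} {r : ℕ} (hr : r < q) {g : K⟦X⟧} (hg : g ∈ V) :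
    sect q r g ∈ sectSpan q V :=
  (le_iSup (fun r : Fin q => V.map (sect q r)) ⟨r, hr⟩) (Submodule.mem_map_of_mem hg)

lemma euler_sectSpan [CharZero K] (hq : q ≠ 0) {V W : Submodule K K⟦X⟧} (hVW : V ≤ W)
    (hW : ∀ g ∈ V, euler g ∈ W) : ∀ g ∈ sectSpan q V, euler g ∈ sectSpan q W := by
  have : sectSpan q V ≤ (sectSpan q W).comap (euler (K := K) : K⟦X⟧ →ₗ[K] K⟦X⟧) := by
    refine sectSpan_le fun r hr g hg => ?_
    have hq0 : (q : K) ≠ 0 := Nat.cast_ne_zero.2 hq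
    have h1 : euler (sect q r g) = (q : K)⁻¹ • (sect q r (euler g) - (r : K) • sect q r g) := by
      rw [sect_euler, add_sub_cancel_right, smul_smul, inv_mul_cancel₀ hq0, one_smul]
    change euler (sect q r g) ∈ sectSpan q W
    rw [h1]
    exact Submodule.smul_mem _ _ (sub_mem (sect_mem_sectSpan hr (hW g hg))
      (Submodule.smul_mem _ _ (sect_mem_sectSpan hr (hVW hg))))
  exact fun g hg => this hg

lemma euler_sectSpan_iterate [CharZero K] (hq : q ≠ 0) (k : ℕ) {V W : Submodule K K⟦X⟧}
    (hVW : V ≤ W) (hW : ∀ g ∈ V, euler g ∈ W) :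
    ∀ g ∈ (sectSpan q)^[k] V, euler g ∈ (sectSpan q)^[k] W := by
  induction k with
  | zero => exact hW
  | succ k ih =>
    simp only [Function.iterate_succ_apply']
    exact euler_sectSpan hq (sectSpan_iterate_mono k hVW) ih

lemma exists_poly_of_sect (hq : q ≠ 0) {g : K⟦X⟧}
    (h : ∀ r < q, ∃ P : Polynomial K, sect q r g = P) : ∃ P : Polynomial K, g = P := by
  choose! P hP using h
  refine ⟨∑ r ∈ Finset.range q, Polynomial.X ^ r * Polynomial.expand K q (P r), ?_⟩
  rw [← Polynomial.coeToPowerSeries.ringHom_apply, map_sum]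
  conv_lhs => rw [eq_sum_sect hq g]
  refine Finset.sum_congr rfl fun r hr => ?_
  rw [hP r (Finset.mem_range.1 hr), Polynomial.coeToPowerSeries.ringHom_apply, Polynomial.coe_mul,
    coe_polyExpand hq]
  simp

lemma exists_poly_of_sectSpan_iterate (hq : q ≠ 0) (k : ℕ) (V : Submodule K K⟦X⟧)
    (h : ∀ g ∈ (sectSpan q)^[k] V, ∃ P : Polynomial K, g = P) :
    ∀ g ∈ V, ∃ P : Polynomial K, g = P := by
  induction k generalizing V with
  | zero => exact h
  | succ k ih =>
    intro g hg
    exact exists_poly_of_sect hq fun r hr => ih (sectSpan q V) h _ (sect_mem_sectSpan hr hg)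

/-- A finite-dimensional space of power series stable under `z d/dz` consists of polynomials. -/
lemma exists_poly_of_euler_stable [CharZero K] (V : Submodule K K⟦X⟧) [Module.Finite K V]
    (hV : ∀ g ∈ V, euler g ∈ V) : ∀ g ∈ V, ∃ P : Polynomial K, g = P := by
  intro g hg
  let φ : Module.End K V := (euler (K := K) : K⟦X⟧ →ₗ[K] K⟦X⟧).restrict hV
  have hpow : ∀ (k : ℕ) (v : V) (n : ℕ), coeff n ((φ ^ k) v : K⟦X⟧) = (n : K) ^ k * coeff n (v : K⟦X⟧) := by
    intro k
    induction k with
    | zero => simp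
    | succ k ih =>
      intro v n
      rw [pow_succ, Module.End.mul_apply, ih]
      have : ((φ v : V) : K⟦X⟧) = euler (v : K⟦X⟧) := rfl
      rw [this, coeff_euler, pow_succ, mul_assoc]
  have haeval : ∀ (χ : Polynomial K) (v : V) (n : ℕ),
      coeff n ((Polynomial.aeval φ χ v : V) : K⟦X⟧) = χ.eval (n : K) * coeff n (v : K⟦X⟧) := by
    intro χ v n
    rw [Polynomial.aeval_eq_sum_range, Polynomial.eval_eq_sum_range, Finset.sum_mul,
      LinearMap.sum_apply, AddSubmonoidClass.coe_finsetSum, map_sum]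
    refine Finset.sum_congr rfl fun i _ => ?_
    simp [hpow, mul_assoc]
  have h0 : minpoly K φ ≠ 0 := minpoly.ne_zero (Algebra.IsIntegral.isIntegral φ)
  have hz : ∀ n : ℕ, (minpoly K φ).eval (n : K) * coeff n g = 0 := by
    intro n
    have := haeval (minpoly K φ) ⟨g, hg⟩ n
    have h1 : Polynomial.aeval φ (minpoly K φ) = 0 := minpoly.aeval K φ
    rw [h1] at this
    simpa using this.symm
  classical
  have hfin : {n : ℕ | (minpoly K φ).eval (n : K) = 0}.Finite := by
    refine Set.Finite.of_finite_image (f := fun n : ℕ => (n : K)) ?_ Nat.cast_injective.injOn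
    refine ((minpoly K φ).roots.toFinset.finite_toSet).subset ?_
    rintro _ ⟨n, hn, rfl⟩
    simpa [h0] using hn
  obtain ⟨N, hN⟩ := hfin.bddAbove
  refine ⟨trunc (N + 1) g, ?_⟩
  ext n
  rw [Polynomial.coeff_coe, coeff_trunc]
  split_ifs with h
  · rfl
  · rcases mul_eq_zero.1 (hz n) with h1 | h1
    · exact absurd (hN h1) (by omega)
    · exact h1

theorem IsMahlerStable.exists_poly_mul_eq [CharZero K] {ζ : K} (hζ : IsPrimitiveRoot ζ q)
    (hq2 : 2 ≤ q) (hA : IsMahlerStable q hq A) {g : K⟦X⟧} (hg : g ∈ A) :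
    ∃ P Q : Polynomial K, Q ≠ 0 ∧ (Q : K⟦X⟧) * g = P := by
  obtain ⟨S, hS⟩ := hA.fg
  have hloc := fun {g : K⟦X⟧} => locInt_iff_exists_mem_filt (g := g) hA.div hS
  obtain ⟨c, hc⟩ := hA.exists_sect_filt hζ hq2 hS
  set T := filt S (2 * c) with hT
  have hYT : sectSpan q T ≤ T := sectSpan_le fun r hr g hg =>
    filt_mono (by omega) (hc _ r hr g hg)
  have hreach : ∀ B, ∃ k, (sectSpan q)^[k] (filt S B) ≤ T := by
    intro B
    induction B using Nat.strong_induction_on with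
    | _ B ih =>
      by_cases hB : B ≤ 2 * c
      · exact ⟨0, filt_mono hB⟩
      · obtain ⟨k, hk⟩ := ih (B / 2 + c) (by omega)
        refine ⟨k + 1, le_trans ?_ hk⟩
        rw [Function.iterate_succ_apply]
        exact sectSpan_iterate_mono k (sectSpan_le fun r hr g hg => hc B r hr g hg)
  have hanti : Antitone fun k => (sectSpan q)^[k] T := by
    refine antitone_nat_of_succ_le fun k => ?_
    rw [Function.iterate_succ_apply]
    exact sectSpan_iterate_mono k hYT
  have hfd : ∀ k, Module.Finite K ((sectSpan q)^[k] T : Submodule K K⟦X⟧) := fun k =>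
    have : (sectSpan q)^[k] T ≤ T := hanti (Nat.zero_le k)
    Submodule.finiteDimensional_of_le this
  obtain ⟨k₁, hk₁⟩ : ∃ k₁, ∀ k, (sectSpan q)^[k₁ + k] T = (sectSpan q)^[k₁] T := by
    let d : ℕ → ℕ := fun k => Module.finrank K ((sectSpan q)^[k] T : Submodule K K⟦X⟧)
    refine ⟨Function.argmin d, fun k => ?_⟩
    have := hfd (Function.argmin d)
    exact Submodule.eq_of_le_of_finrank_le (hanti (Nat.le_add_right _ _))
      (Function.argmin_le d _)
  obtain ⟨B, hTB⟩ : ∃ B, ∀ g ∈ T, euler g ∈ filt S B := by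
    obtain ⟨s, hs⟩ : T.FG := Module.Finite.iff_fg.1 inferInstance
    have : ∀ g : K⟦X⟧, ∃ B, g ∈ s → euler g ∈ filt S B := by
      intro g
      by_cases hgs : g ∈ s
      · have hgT : g ∈ T := by rw [← hs]; exact Submodule.subset_span hgs
        obtain ⟨B, hB⟩ := hloc.1 (hA.locInt_euler hζ hq2 (hloc.2 ⟨_, hgT⟩))
        exact ⟨B, fun _ => hB⟩
      · exact ⟨0, fun h => absurd h hgs⟩
    choose b hb using this
    refine ⟨s.sup b, ?_⟩
    have hle : T ≤ (filt S (s.sup b)).comap (euler (K := K) : K⟦X⟧ →ₗ[K] K⟦X⟧) := by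
      rw [← hs, Submodule.span_le]
      intro g hg
      have h1 : b g ≤ s.sup b := Finset.le_sup hg
      have h2 : euler g ∈ filt S (s.sup b) := filt_mono h1 (hb g hg)
      exact h2
    exact fun g hg => hle hg
  obtain ⟨k₀, hk₀⟩ := hreach (max B (2 * c))
  have hX : ∀ g ∈ (sectSpan q)^[k₁] T, euler g ∈ (sectSpan q)^[k₁] T := by
    intro g hg
    rw [← hk₁ k₀] at hg
    have := euler_sectSpan_iterate hq (k₁ + k₀) (V := T) (W := filt S (max B (2 * c)))
      (filt_mono (le_max_right _ _)) (fun g hg => filt_mono (le_max_left _ _) (hTB g hg)) g hg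
    rw [Function.iterate_add_apply] at this
    exact sectSpan_iterate_mono k₁ hk₀ this
  have := hfd k₁
  have hXpoly := exists_poly_of_euler_stable _ hX
  obtain ⟨Q, hQ, hQg⟩ := (hA.algebraic g hg).exists_integral_multiple
  rw [poly_smul] at hQg
  obtain ⟨B', hB'⟩ := hloc.1 ⟨mul_mem (X_mem A Q) hg, 0, by simpa using hQg⟩
  obtain ⟨k, hk⟩ := hreach B'
  obtain ⟨P, hP⟩ := exists_poly_of_sectSpan_iterate hq (k₁ + k) (filt S B')
    (fun g hg => hXpoly g (by
      rw [Function.iterate_add_apply] at hg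
      exact sectSpan_iterate_mono k₁ hk hg)) _ hB'
  exact ⟨P, Q, hQ, hP⟩

end Filtration
end MahlerAux

namespace MahlerAux

open PowerSeries

section Field

variable {K : Type*} [Field K] {F E : Type*} [Field F] [Field E]
  [Algebra (Polynomial K) F] [IsFractionRing (Polynomial K) F]
  [Algebra K⟦X⟧ E] [IsFractionRing K⟦X⟧ E] [Algebra (Polynomial K) E]
  [IsScalarTower (Polynomial K) K⟦X⟧ E] [Algebra F E] [IsScalarTower (Polynomial K) F E]

lemma algebraMap_coe_poly (P : Polynomial K) :
    algebraMap K⟦X⟧ E (P : K⟦X⟧) = algebraMap (Polynomial K) E P := by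
  rw [← algebraMap_poly, ← IsScalarTower.algebraMap_apply]

variable (K) in
lemma exists_X_pow_smul_eq (x : E) :
    ∃ (n : ℕ) (g : K⟦X⟧), (Polynomial.X ^ n : Polynomial K) • x = algebraMap K⟦X⟧ E g := by
  obtain ⟨g, h, hh, rfl⟩ := IsFractionRing.div_surjective K⟦X⟧ x
  have hh0 : h ≠ 0 := nonZeroDivisors.ne_zero hh
  refine ⟨h.order.toNat, g * Inv_divided_by_X_pow_order hh0, ?_⟩
  have h1 : h * Inv_divided_by_X_pow_order hh0 = X ^ h.order.toNat := by
    conv_lhs => enter [1]; rw [← X_pow_order_mul_divXPowOrder (f := h)]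
    rw [mul_assoc, Inv_divided_by_X_pow_order_rightInv, mul_one]
  have h2 : algebraMap K⟦X⟧ E h ≠ 0 := by
    simpa using hh0
  rw [Algebra.smul_def, ← algebraMap_coe_poly, Polynomial.coe_pow, Polynomial.coe_X, ← h1, map_mul,
    map_mul]
  field_simp

/-- The power series lying in an intermediate field. -/
noncomputable def seriesIn (k : IntermediateField F E) : Subalgebra (Polynomial K) K⟦X⟧ :=
  (k.toSubalgebra.restrictScalars (Polynomial K)).comap
    (IsScalarTower.toAlgHom (Polynomial K) K⟦X⟧ E)

lemma mem_seriesIn {k : IntermediateField F E} {g : K⟦X⟧} :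
    g ∈ seriesIn (K := K) k ↔ algebraMap K⟦X⟧ E g ∈ k := Iff.rfl

lemma linearIndependent_algebraMap_iff {ι : Type*} {y : ι → K⟦X⟧} :
    LinearIndependent (Polynomial K) y ↔
      LinearIndependent F fun i => algebraMap K⟦X⟧ E (y i) := by
  rw [← LinearIndependent.iff_fractionRing (Polynomial K) F]
  have hinj : Function.Injective (algebraMap K⟦X⟧ E) := IsFractionRing.injective _ _
  exact ((IsScalarTower.toAlgHom (Polynomial K) K⟦X⟧ E).toLinearMap.linearIndependent_iff
    (LinearMap.ker_eq_bot.2 hinj)).symm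

lemma rank_seriesIn (k : IntermediateField F E) [FiniteDimensional F k] :
    ∃ (n : ℕ) (y : Fin n → K⟦X⟧), (∀ i, y i ∈ seriesIn (K := K) k) ∧
      LinearIndependent (Polynomial K) y ∧
      ∀ y' : Fin n → K⟦X⟧, (∀ i, y' i ∈ seriesIn (K := K) k) →
        LinearIndependent (Polynomial K) y' → ∀ g ∈ seriesIn (K := K) k,
        ∃ D : Polynomial K, D ≠ 0 ∧ D • g ∈ Submodule.span (Polynomial K) (Set.range y') := by
  have hinj : Function.Injective (algebraMap K⟦X⟧ E) := IsFractionRing.injective _ _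
  classical
  let w := Module.finBasis F k
  choose n g hg using fun i => exists_X_pow_smul_eq K (w i : E)
  refine ⟨Module.finrank F k, g, fun i => ?_, ?_, ?_⟩
  · rw [mem_seriesIn, ← hg]
    rw [← algebraMap_smul F]
    exact k.smul_mem (w i).2
  · rw [linearIndependent_algebraMap_iff (F := F) (E := E)]
    have h0 : ∀ i, algebraMap (Polynomial K) F (Polynomial.X ^ n i) ≠ 0 := fun i => by simp
    have h1 : LinearIndependent F fun i => (w i : E) :=
      w.linearIndependent.map' k.val.toLinearMap (LinearMap.ker_eq_bot.2 k.val.injective)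
    have := h1.units_smul fun i => Units.mk0 _ (h0 i)
    convert this using 2 with i
    rw [← hg]
    simp only [Pi.smul_apply', Units.smul_mk0]
    rw [algebraMap_smul]
  · intro y' hy' hli g hg
    rw [linearIndependent_algebraMap_iff (F := F) (E := E)] at hli
    let v : Fin (Module.finrank F k) → k := fun i => ⟨algebraMap K⟦X⟧ E (y' i), hy' i⟩
    have hv : LinearIndependent F v := LinearIndependent.of_comp k.val.toLinearMap hli
    have hspan := hv.span_eq_top_of_card_eq_finrank' (by simp)
    obtain ⟨c, hc⟩ := (Submodule.mem_span_range_iff_exists_fun F).1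
      (hspan ▸ Submodule.mem_top : (⟨algebraMap K⟦X⟧ E g, hg⟩ : k) ∈ _)
    obtain ⟨D, hD⟩ := IsLocalization.exist_integer_multiples_of_finset
      (nonZeroDivisors (Polynomial K)) (Finset.univ.image c)
    have : ∀ i, ∃ P : Polynomial K, algebraMap (Polynomial K) F P = (D : Polynomial K) • c i :=
      fun i => hD _ (Finset.mem_image_of_mem _ (Finset.mem_univ i))
    choose P hP using this
    refine ⟨D, nonZeroDivisors.ne_zero D.2, ?_⟩
    rw [Submodule.mem_span_range_iff_exists_fun]
    refine ⟨P, hinj ?_⟩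
    have hc' := congrArg (Subtype.val : k → E) hc
    simp only [AddSubmonoidClass.coe_finsetSum, IntermediateField.coe_smul, v] at hc'
    rw [map_sum]
    have e : ∀ (Q : Polynomial K) (h : K⟦X⟧),
        algebraMap K⟦X⟧ E (Q • h) = Q • algebraMap K⟦X⟧ E h := fun Q h =>
      map_smul (IsScalarTower.toAlgHom (Polynomial K) K⟦X⟧ E) Q h
    rw [e, ← hc', Finset.smul_sum]
    refine Finset.sum_congr rfl fun i _ => ?_
    rw [e, ← algebraMap_smul F, hP, smul_assoc]

lemma isMahlerStable_seriesIn [CharZero K] {q : ℕ} (hq : q ≠ 0) (k : IntermediateField F E)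
    [FiniteDimensional F k]
    (hσ : ∀ g : K⟦X⟧, algebraMap K⟦X⟧ E g ∈ k → algebraMap K⟦X⟧ E (expand q hq g) ∈ k) :
    IsMahlerStable q hq (seriesIn (K := K) k) where
  div b hb hb0 h hbh := by
    have hinj : Function.Injective (algebraMap K⟦X⟧ E) := IsFractionRing.injective _ _
    rw [mem_seriesIn] at hb hbh ⊢
    have : algebraMap K⟦X⟧ E b ≠ 0 := by simpa using hb0
    rw [map_mul] at hbh
    have := k.mul_mem (k.inv_mem hb) hbh
    rwa [inv_mul_cancel_left₀ ‹_›] at this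
  expand_mem g hg := hσ g hg
  rank := rank_seriesIn k
  algebraic g hg := by
    have hinj : Function.Injective (algebraMap K⟦X⟧ E) := IsFractionRing.injective _ _
    rw [← isAlgebraic_algebraMap_iff (A := E) hinj, IsFractionRing.isAlgebraic_iff _ F]
    have : IsAlgebraic F (⟨algebraMap K⟦X⟧ E g, hg⟩ : k) := Algebra.IsAlgebraic.isAlgebraic _
    exact this.algebraMap (A := E)
  fg := by
    have hinj : Function.Injective (algebraMap K⟦X⟧ E) := IsFractionRing.injective _ _
    have : CharZero F := charZero_of_injective_algebraMap (IsFractionRing.injective (Polynomial K) F)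
    have := IsIntegralClosure.isNoetherian (Polynomial K) F k (integralClosure (Polynomial K) k)
    rw [← Module.Finite.iff_fg]
    have hint : ∀ g : (seriesIn (K := K) k ⊓ integralClosure (Polynomial K) K⟦X⟧ :
        Subalgebra (Polynomial K) K⟦X⟧),
        IsIntegral (Polynomial K) (⟨algebraMap K⟦X⟧ E g, g.2.1⟩ : k) := fun g => by
      have h1 : IsIntegral (Polynomial K) (algebraMap K⟦X⟧ E g) :=
        (show IsIntegral (Polynomial K) (g : K⟦X⟧) from g.2.2).algebraMap
      have : IsScalarTower (Polynomial K) k E := IsScalarTower.of_algebraMap_eq fun P => by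
        rw [IsScalarTower.algebraMap_apply (Polynomial K) F E,
          IsScalarTower.algebraMap_apply (Polynomial K) F k, ← IsScalarTower.algebraMap_apply F k E]
      exact (isIntegral_algebraMap_iff (A := k) (B := E) (algebraMap k E).injective).1 h1
    let φ : (Subalgebra.toSubmodule (seriesIn (K := K) k ⊓ integralClosure (Polynomial K) K⟦X⟧))
        →ₗ[Polynomial K] integralClosure (Polynomial K) k :=
      { toFun := fun g => ⟨⟨algebraMap K⟦X⟧ E g, g.2.1⟩, hint g⟩
        map_add' := fun g h => Subtype.ext (Subtype.ext (map_add (algebraMap K⟦X⟧ E) _ _))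
        map_smul' := fun c g => Subtype.ext (Subtype.ext
          (map_smul (IsScalarTower.toAlgHom (Polynomial K) K⟦X⟧ E) c (g : K⟦X⟧))) }
    refine Module.Finite.of_injective φ fun g h hgh => Subtype.ext (hinj ?_)
    exact congrArg (fun x => ((x : integralClosure (Polynomial K) k) : k).1) hgh

theorem mem_bot_of_finite_of_stable [CharZero K] {q : ℕ} (hq2 : 2 ≤ q) (hq : q ≠ 0) {ζ : K}
    (hζ : IsPrimitiveRoot ζ q) (k : IntermediateField F E) [FiniteDimensional F k]
    (hσ : ∀ g : K⟦X⟧, algebraMap K⟦X⟧ E g ∈ k → algebraMap K⟦X⟧ E (expand q hq g) ∈ k)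
    {x : E} (hx : x ∈ k) : ∃ a : F, algebraMap F E a = x := by
  obtain ⟨n, g, hg⟩ := exists_X_pow_smul_eq K x
  have hgk : g ∈ seriesIn (K := K) k := by
    rw [mem_seriesIn, ← hg, ← algebraMap_smul F]
    exact k.smul_mem hx
  obtain ⟨P, Q, hQ, h⟩ := (isMahlerStable_seriesIn hq k hσ).exists_poly_mul_eq hζ hq2 hgk
  have h1 := congrArg (algebraMap K⟦X⟧ E) h
  rw [map_mul, ← hg, algebraMap_coe_poly, algebraMap_coe_poly, Algebra.smul_def,
    IsScalarTower.algebraMap_apply (Polynomial K) F E,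
    IsScalarTower.algebraMap_apply (Polynomial K) F E,
    IsScalarTower.algebraMap_apply (Polynomial K) F E, ← mul_assoc, ← map_mul] at h1
  refine ⟨algebraMap (Polynomial K) F P / (algebraMap (Polynomial K) F Q *
    algebraMap (Polynomial K) F (Polynomial.X ^ n)), ?_⟩
  have h2 : algebraMap (Polynomial K) F Q * algebraMap (Polynomial K) F (Polynomial.X ^ n) ≠ 0 := by
    simp [hQ]
  rw [map_div₀, ← h1, mul_div_cancel_left₀]
  exact (map_ne_zero (algebraMap F E)).2 h2

end Field
end MahlerAux

namespace MahlerAux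

section FinGen

open scoped IntermediateField.algebraAdjoinAdjoin

variable {F L : Type*} [Field F] [Field L] [Algebra F L]

lemma linearIndependent_adjoin_of_algebraic {s : Set L}
    (hs : AlgebraicIndependent F ((↑) : s → L)) {ι : Type*} {b : ι → algebraicClosure F L}
    (hb : LinearIndependent F b) :
    LinearIndependent (IntermediateField.adjoin F s) fun i => (b i : L) := by
  have : IsScalarTower (Algebra.adjoin F s) (IntermediateField.adjoin F s) L :=
    IsScalarTower.of_algebraMap_eq fun _ => rfl
  rw [← LinearIndependent.iff_fractionRing (Algebra.adjoin F s), linearIndependent_iff']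
  intro t c hc
  have hP : ∀ i, ∃ P : MvPolynomial s F, MvPolynomial.aeval ((↑) : s → L) P = (c i : L) := by
    intro i
    have h : ∀ x ∈ Algebra.adjoin F s, ∃ P : MvPolynomial s F,
        MvPolynomial.aeval ((↑) : s → L) P = x := by
      rw [Algebra.adjoin_eq_range]
      exact fun x hx => hx
    exact h _ (c i).2
  choose P hP using hP
  have hs' := hs.algebraicClosure
  have h1 : ∑ i ∈ t, MvPolynomial.C (b i) *
      MvPolynomial.map (algebraMap F (algebraicClosure F L)) (P i) = 0 := by
    refine hs' ?_
    rw [map_zero, map_sum, ← hc]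
    refine Finset.sum_congr rfl fun i _ => ?_
    rw [map_mul, MvPolynomial.aeval_C, MvPolynomial.aeval_map_algebraMap, hP, mul_comm]
    rfl
  intro i hi
  have h2 : P i = 0 := by
    ext v
    have h3 := congrArg (MvPolynomial.coeff v) h1
    rw [MvPolynomial.coeff_sum] at h3
    simp only [MvPolynomial.coeff_C_mul, MvPolynomial.coeff_map, MvPolynomial.coeff_zero] at h3
    rw [linearIndependent_iff'] at hb
    exact hb t (fun i => MvPolynomial.coeff v (P i)) (by
      rw [← h3]
      refine Finset.sum_congr rfl fun i _ => ?_
      rw [Algebra.smul_def, mul_comm]) i hi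
  refine Subtype.ext ?_
  rw [← hP, h2]
  simp

theorem finite_algebraicClosure (F L : Type*) [Field F] [Field L] [Algebra F L]
    [Algebra.EssFiniteType F L] : FiniteDimensional F (algebraicClosure F L) := by
  obtain ⟨s, hs⟩ := exists_isTranscendenceBasis F L
  have halg := hs.isAlgebraic_field
  rw [Subtype.range_coe] at halg
  have : Algebra.EssFiniteType (IntermediateField.adjoin F s) L := .of_comp F _ L
  have : Module.Finite (IntermediateField.adjoin F s) L :=
    Algebra.finite_of_essFiniteType_of_isAlgebraic
  let b := Module.Basis.ofVectorSpace F (algebraicClosure F L)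
  have h := linearIndependent_adjoin_of_algebraic hs.1 b.linearIndependent
  have := h.finite
  exact Module.Finite.of_basis b

end FinGen

section RelAlgClosed

open PowerSeries

variable {K : Type*} [Field K] {F E : Type*} [Field F] [Field E]
  [Algebra (Polynomial K) F] [IsFractionRing (Polynomial K) F]
  [Algebra K⟦X⟧ E] [IsFractionRing K⟦X⟧ E] [Algebra (Polynomial K) E]
  [IsScalarTower (Polynomial K) K⟦X⟧ E] [Algebra F E] [IsScalarTower (Polynomial K) F E]

lemma algebraMap_expand_mem_adjoin {q : ℕ} (hq : q ≠ 0) (s : Set K⟦X⟧)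
    (hs : ∀ g ∈ s, algebraMap K⟦X⟧ E (expand q hq g) ∈
      IntermediateField.adjoin F (algebraMap K⟦X⟧ E '' s)) {g : K⟦X⟧}
    (hg : algebraMap K⟦X⟧ E g ∈ IntermediateField.adjoin F (algebraMap K⟦X⟧ E '' s)) :
    algebraMap K⟦X⟧ E (expand q hq g) ∈ IntermediateField.adjoin F (algebraMap K⟦X⟧ E '' s) := by
  have hinj : Function.Injective ((algebraMap K⟦X⟧ E).comp
      ((expand q hq : K⟦X⟧ →ₐ[K] K⟦X⟧) : K⟦X⟧ →+* K⟦X⟧)) :=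
    (IsFractionRing.injective K⟦X⟧ E).comp (expand_injective hq)
  let σ : E →+* E := IsFractionRing.lift hinj
  have hσ : ∀ g, σ (algebraMap K⟦X⟧ E g) = algebraMap K⟦X⟧ E (expand q hq g) := fun g =>
    IsFractionRing.lift_algebraMap hinj g
  have key : ∀ x ∈ IntermediateField.adjoin F (algebraMap K⟦X⟧ E '' s),
      σ x ∈ IntermediateField.adjoin F (algebraMap K⟦X⟧ E '' s) := by
    intro x hx
    have hpoly : ∀ P : Polynomial K, σ (algebraMap F E (algebraMap (Polynomial K) F P)) ∈
        IntermediateField.adjoin F (algebraMap K⟦X⟧ E '' s) := fun P => by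
      rw [← IsScalarTower.algebraMap_apply, ← algebraMap_coe_poly, hσ, ← coe_polyExpand hq,
        algebraMap_coe_poly, IsScalarTower.algebraMap_apply (Polynomial K) F E]
      exact IntermediateField.algebraMap_mem _ _
    induction hx using IntermediateField.adjoin_induction with
    | mem x hx =>
      obtain ⟨g, hg, rfl⟩ := hx
      rw [hσ]
      exact hs g hg
    | algebraMap x =>
      obtain ⟨P, Q, -, rfl⟩ := IsFractionRing.div_surjective (Polynomial K) x
      rw [map_div₀, map_div₀]
      exact div_mem (hpoly P) (hpoly Q)
    | add x y _ _ hx hy => rw [map_add]; exact add_mem hx hy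
    | inv x _ hx => rw [map_inv₀]; exact inv_mem hx
    | mul x y _ _ hx hy => rw [map_mul]; exact mul_mem hx hy
  rw [← hσ]
  exact key _ hg

lemma isAlgebraic_expand {q : ℕ} (hq : q ≠ 0) {g : K⟦X⟧} (hg : IsAlgebraic (Polynomial K) g) :
    IsAlgebraic (Polynomial K) (expand q hq g) := by
  obtain ⟨Q, hQ, hQg⟩ := hg.exists_integral_multiple
  have h1 := (isIntegral_expand hq hQg).isAlgebraic
  rw [poly_smul, map_mul, ← coe_polyExpand hq, ← poly_smul] at h1
  have hQ' : Polynomial.expand K q Q ≠ 0 := by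
    rwa [Ne, Polynomial.expand_eq_zero (Nat.pos_of_ne_zero hq)]
  exact h1.of_smul (mem_nonZeroDivisors_of_ne_zero hQ')

/-- An algebraic element of a finitely generated Mahler-stable field of Laurent series is a
rational function. -/
theorem isAlgebraic_mem_range [CharZero K] {q : ℕ} (hq2 : 2 ≤ q) (hq : q ≠ 0) {ζ : K}
    (hζ : IsPrimitiveRoot ζ q) (s : Set K⟦X⟧) (hfin : s.Finite)
    (hs : ∀ g ∈ s, algebraMap K⟦X⟧ E (expand q hq g) ∈
      IntermediateField.adjoin F (algebraMap K⟦X⟧ E '' s)) {x : E}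
    (hx : x ∈ IntermediateField.adjoin F (algebraMap K⟦X⟧ E '' s)) (hxa : IsAlgebraic F x) :
    ∃ a : F, algebraMap F E a = x := by
  set L := IntermediateField.adjoin F (algebraMap K⟦X⟧ E '' s) with hL
  let k : IntermediateField F E := L ⊓ algebraicClosure F E
  have : Algebra.EssFiniteType F L :=
    IntermediateField.essFiniteType_iff.2 (IntermediateField.fg_adjoin_of_finite (hfin.image _))
  have := finite_algebraicClosure F L
  let φ : k →ₗ[F] algebraicClosure F L :=
    { toFun := fun x => ⟨⟨x.1, x.2.1⟩, (mem_algebraicClosure_iff).2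
        ((isAlgebraic_algebraMap_iff (A := E) (algebraMap L E).injective).1
          (mem_algebraicClosure_iff.1 x.2.2))⟩
      map_add' := fun x y => rfl
      map_smul' := fun c x => rfl }
  have : FiniteDimensional F k := Module.Finite.of_injective φ fun x y h => Subtype.ext
    (congrArg (fun z => ((z : algebraicClosure F L) : L).1) h)
  have hinj : Function.Injective (algebraMap K⟦X⟧ E) := IsFractionRing.injective _ _
  refine mem_bot_of_finite_of_stable (K := K) hq2 hq hζ k (fun g hg => ?_)
    (show x ∈ k from ⟨hx, mem_algebraicClosure_iff.2 hxa⟩)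
  refine ⟨algebraMap_expand_mem_adjoin hq s hs hg.1, mem_algebraicClosure_iff.2 ?_⟩
  have h1 := mem_algebraicClosure_iff.1 hg.2
  rw [← IsFractionRing.isAlgebraic_iff (Polynomial K) F, isAlgebraic_algebraMap_iff hinj] at h1 ⊢
  exact isAlgebraic_expand hq h1

end RelAlgClosed

end MahlerAux

namespace MahlerAux

section RelClosed

variable {F L M : Type*} [Field F] [Field L] [Field M] [Algebra F L] [Algebra L M] [Algebra F M]
  [IsScalarTower F L M]

lemma natDegree_minpoly_eq_of_relClosed
    (hL : ∀ x : L, IsAlgebraic F x → ∃ a : F, algebraMap F L a = x) {θ : M} (hθ : IsIntegral F θ) :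
    (minpoly L θ).natDegree = (minpoly F θ).natDegree := by
  have hθL : IsIntegral L θ := hθ.tower_top
  have hlift := integralClosure.mem_lifts_of_monic_of_dvd_map L (minpoly.monic hθ)
    (minpoly.monic hθL) (minpoly.dvd_map_of_isScalarTower F L θ)
  have hcoeff : ∀ n, ∃ a : F, algebraMap F L a = (minpoly L θ).coeff n := by
    intro n
    obtain ⟨a, ha⟩ := (Polynomial.lifts_iff_coeff_lifts _).1 hlift n
    refine hL _ ?_
    rw [← ha]
    exact (show IsIntegral F (a : L) from a.2).isAlgebraic
  obtain ⟨h, hh⟩ : ∃ h : Polynomial F, h.map (algebraMap F L) = minpoly L θ := by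
    have : minpoly L θ ∈ Polynomial.lifts (algebraMap F L) :=
      (Polynomial.lifts_iff_coeff_lifts _).2 hcoeff
    exact (Polynomial.mem_lifts _).1 this
  refine le_antisymm ?_ ?_
  · have := Polynomial.natDegree_le_of_dvd (minpoly.dvd_map_of_isScalarTower F L θ)
      ((minpoly.monic hθ).map _).ne_zero
    rwa [Polynomial.natDegree_map] at this
  · rw [← hh, Polynomial.natDegree_map]
    have h0 : h ≠ 0 := by
      rintro rfl
      rw [Polynomial.map_zero] at hh
      exact minpoly.ne_zero hθL hh.symm
    refine Polynomial.natDegree_le_of_dvd (minpoly.dvd F θ ?_) h0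
    rw [← Polynomial.aeval_map_algebraMap L, hh, minpoly.aeval]

/-- Elements of `L` independent over a relatively algebraically closed subfield stay independent
over finite extensions of that subfield. -/
lemma eq_zero_of_sum_algHom_mul_eq_zero [CharZero F]
    (hL : ∀ x : L, IsAlgebraic F x → ∃ a : F, algebraMap F L a = x) {N : Type*} [Field N]
    [Algebra F N] [FiniteDimensional F N] (ψ : N →ₐ[F] M) {ι : Type*} [Fintype ι] {g : ι → L}
    (hg : LinearIndependent F g) {b : ι → N} (h : ∑ j, ψ (b j) * algebraMap L M (g j) = 0) (j : ι) :
    b j = 0 := by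
  let pb := Field.powerBasisOfFiniteOfSeparable F N
  have hint : IsIntegral F pb.gen := Algebra.IsIntegral.isIntegral _
  have hdeg : (minpoly L (ψ pb.gen)).natDegree = pb.dim := by
    rw [natDegree_minpoly_eq_of_relClosed hL (hint.map ψ), minpoly.algHom_eq ψ ψ.injective,
      pb.natDegree_minpoly]
  have hli := linearIndependent_pow (K := L) (ψ pb.gen)
  rw [hdeg, Fintype.linearIndependent_iff] at hli
  have hb : ∀ j, b j = ∑ k, pb.basis.repr (b j) k • pb.gen ^ (k : ℕ) := by
    intro j
    conv_lhs => rw [← pb.basis.sum_repr (b j)]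
    simp
  have h1 := hli (fun k => ∑ j, pb.basis.repr (b j) k • g j) (by
    rw [← h]
    simp only [Finset.sum_smul]
    rw [Finset.sum_comm]
    refine Finset.sum_congr rfl fun j _ => ?_
    conv_rhs => rw [hb j]
    rw [map_sum, Finset.sum_mul]
    refine Finset.sum_congr rfl fun k _ => ?_
    simp only [map_pow, Algebra.smul_def, map_mul]
    rw [← IsScalarTower.algebraMap_apply, ψ.commutes]
    ring)
  rw [Fintype.linearIndependent_iff] at hg
  have h2 : ∀ k, pb.basis.repr (b j) k = 0 := fun k => hg _ (h1 k) j
  rw [hb j]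
  simp [h2]

end RelClosed

section Rank

variable {F L B : Type*} [Field F] [Field L] [Algebra F L] [CommRing B] [IsDomain B] [Algebra F B]

lemma exists_maximal_notMem [Algebra.FiniteType F B] {b : B} (hb : b ≠ 0) :
    ∃ m : Ideal B, m.IsMaximal ∧ b ∉ m := by
  have : IsJacobsonRing B := isJacobsonRing_of_finiteType (A := F)
  have h : (⊥ : Ideal B).jacobson = ⊥ := IsJacobsonRing.out ‹_› (Ideal.isPrime_bot.isRadical)
  by_contra hcon
  push Not at hcon
  have : b ∈ (⊥ : Ideal B).jacobson := by
    rw [Ideal.jacobson, Ideal.mem_sInf]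
    rintro m ⟨-, hm⟩
    exact hcon m hm
  rw [h] at this
  exact hb this

theorem linearIndependent_rows [CharZero F] [Algebra.FiniteType F B]
    (hL : ∀ x : L, IsAlgebraic F x → ∃ a : F, algebraMap F L a = x)
    {ι κ κ' : Type*} [Fintype ι] [Fintype κ] [Fintype κ'] {f : ι → L} (hf : LinearIndependent F f)
    {t : ι → B} {i₀ : ι} (ht : t i₀ ≠ 0) {e' : κ' → B} (he' : LinearIndependent F e') {e : κ → B}
    {c : ι → κ' → κ → F} (hc : ∀ i l, t i * e' l = ∑ s, c i l s • e s) :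
    LinearIndependent L fun l s => ∑ i, c i l s • f i := by
  rw [Fintype.linearIndependent_iff]
  intro u hu
  by_contra hne
  push Not at hne
  obtain ⟨l₀, hl₀⟩ := hne
  let U := Submodule.span F (Set.range u)
  have : FiniteDimensional F U := FiniteDimensional.span_of_finite F (Set.finite_range u)
  let w := Module.finBasis F U
  let u' : κ' → U := fun l => ⟨u l, Submodule.subset_span ⟨l, rfl⟩⟩
  let γ : κ' → Fin (Module.finrank F U) → F := fun l j => w.repr (u' l) j
  have hγ : ∀ l, u l = ∑ j, γ l j • (w j : L) := by
    intro l
    have := congrArg Subtype.val (w.sum_repr (u' l))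
    rw [AddSubmonoidClass.coe_finsetSum] at this
    exact this.symm
  obtain ⟨j₀, hj₀⟩ : ∃ j, γ l₀ j ≠ 0 := by
    by_contra hcon
    push Not at hcon
    exact hl₀ (by rw [hγ l₀]; simp [hcon])
  let v : Fin (Module.finrank F U) → B := fun j => ∑ l, γ l j • e' l
  have hv : v j₀ ≠ 0 := fun h =>
    hj₀ (Fintype.linearIndependent_iff.1 he' (fun l => γ l j₀) h l₀)
  obtain ⟨m, hm, hmem⟩ := exists_maximal_notMem (F := F) (mul_ne_zero ht hv)
  letI : Field (B ⧸ m) := Ideal.Quotient.field m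
  have : Module.Finite F (B ⧸ m) := finite_of_finite_type_of_isJacobsonRing F (B ⧸ m)
  suffices key : ∀ (M : Type _) [Field M] [Algebra F M] [Algebra L M] [IsScalarTower F L M]
      (ψ : (B ⧸ m) →ₐ[F] M), False from key (AlgebraicClosure L) IsAlgClosed.lift
  intro M _ _ _ _ ψ
  let π : B →ₐ[F] (B ⧸ m) := Ideal.Quotient.mkₐ F m
  have hprod : (∑ i, ψ (π (t i)) * algebraMap L M (f i)) *
      (∑ j, ψ (π (v j)) * algebraMap L M (w j : L)) = 0 := by
    have h1 : ∀ l, ∑ i, ψ (π (t i * e' l)) * algebraMap L M (f i) =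
        ∑ s, ψ (π (e s)) * algebraMap L M (∑ i, c i l s • f i) := by
      intro l
      simp only [hc, map_sum, map_smul, Finset.sum_mul, Finset.mul_sum]
      rw [Finset.sum_comm]
      refine Finset.sum_congr rfl fun s _ => Finset.sum_congr rfl fun i _ => ?_
      rw [Algebra.smul_def, Algebra.smul_def, map_mul, ← IsScalarTower.algebraMap_apply]
      ring
    have h2 : (∑ j, ψ (π (v j)) * algebraMap L M (w j : L)) =
        ∑ l, ψ (π (e' l)) * algebraMap L M (u l) := by
      simp only [hγ, v, map_sum, map_smul, Finset.sum_mul, Finset.mul_sum]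
      rw [Finset.sum_comm]
      refine Finset.sum_congr rfl fun s _ => Finset.sum_congr rfl fun i _ => ?_
      rw [Algebra.smul_def, Algebra.smul_def, map_mul, ← IsScalarTower.algebraMap_apply]
      ring
    rw [h2, Finset.mul_sum]
    have h3 : ∀ l, (∑ i, ψ (π (t i)) * algebraMap L M (f i)) *
        (ψ (π (e' l)) * algebraMap L M (u l)) =
        ∑ s, ψ (π (e s)) * (algebraMap L M (u l * ∑ i, c i l s • f i)) := by
      intro l
      have : (∑ i, ψ (π (t i)) * algebraMap L M (f i)) * (ψ (π (e' l)) * algebraMap L M (u l)) =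
          (∑ i, ψ (π (t i * e' l)) * algebraMap L M (f i)) * algebraMap L M (u l) := by
        simp only [Finset.sum_mul, map_mul]
        exact Finset.sum_congr rfl fun i _ => by ring
      rw [this, h1, Finset.sum_mul]
      refine Finset.sum_congr rfl fun s _ => ?_
      rw [map_mul]
      ring
    simp only [h3]
    rw [Finset.sum_comm]
    refine Finset.sum_eq_zero fun s _ => ?_
    rw [← Finset.mul_sum, ← map_sum]
    have := congrFun hu s
    simp only [Finset.sum_apply, Pi.smul_apply, smul_eq_mul, Pi.zero_apply] at this
    rw [this, map_zero, mul_zero]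
  have hw : LinearIndependent F fun j => (w j : L) :=
    w.linearIndependent.map' U.subtype (Submodule.ker_subtype U)
  apply hmem
  rw [← Ideal.Quotient.eq_zero_iff_mem, map_mul]
  rcases mul_eq_zero.1 hprod with h | h
  · rw [show Ideal.Quotient.mk m (t i₀) = 0 from
      eq_zero_of_sum_algHom_mul_eq_zero hL ψ hf (b := fun i => π (t i)) h i₀, zero_mul]
  · rw [show Ideal.Quotient.mk m (v j₀) = 0 from
      eq_zero_of_sum_algHom_mul_eq_zero hL ψ hw (b := fun j => π (v j)) h j₀, mul_zero]

lemma exists_det_submatrix_ne_zero {κ κ' : Type} [Fintype κ] [Fintype κ'] [DecidableEq κ']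
    {A : Matrix κ' κ L} (hA : LinearIndependent L A.row) :
    ∃ a : κ' → κ, Function.Injective a ∧ (A.submatrix id a).det ≠ 0 := by
  obtain ⟨μ, b, hb, hsp, hli⟩ := exists_linearIndependent' L A.col
  have : Fintype μ := Fintype.ofInjective b hb
  have h1 : Fintype.card μ = Fintype.card κ' := by
    rw [← hA.rank_matrix, Matrix.rank_eq_finrank_span_cols, ← hsp, finrank_span_eq_card hli]
  let ε : κ' ≃ μ := (Fintype.equivOfCardEq h1).symm
  refine ⟨b ∘ ε, hb.comp ε.injective, ?_⟩
  rw [← isUnit_iff_ne_zero, ← Matrix.isUnit_iff_isUnit_det,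
    ← Matrix.linearIndependent_cols_iff_isUnit]
  exact hli.comp ε ε.injective

end Rank

end MahlerAux

namespace MahlerAux

section Height

variable {K : Type*} [Field K]

/-- `D` is a denominator of `y`, and it bounds all conjugates of `y`. -/
def HeightBound (D : ℕ) (y : K) : Prop :=
  0 < D ∧ IsIntegral ℤ ((D : K) * y) ∧ ∀ σ : K →+* ℂ, ‖σ y‖ ≤ D

namespace HeightBound

variable {D E : ℕ} {x y : K}

lemma mul (hx : HeightBound D x) (hy : HeightBound E y) : HeightBound (D * E) (x * y) := by
  refine ⟨Nat.mul_pos hx.1 hy.1, ?_, fun σ => ?_⟩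
  · have := hx.2.1.mul hy.2.1
    rwa [show ((D * E : ℕ) : K) * (x * y) = (D : K) * x * ((E : K) * y) by push_cast; ring]
  · rw [map_mul, norm_mul]
    push_cast
    exact mul_le_mul (hx.2.2 σ) (hy.2.2 σ) (norm_nonneg _) (Nat.cast_nonneg _)

lemma isIntegral_natCast (n : ℕ) : IsIntegral ℤ (n : K) := by
  simpa using (isIntegral_algebraMap (R := ℤ) (A := K) (x := (n : ℤ)))

lemma of_dvd (hx : HeightBound D x) (h : D ∣ E) (hE : 0 < E) : HeightBound E x := by
  obtain ⟨k, rfl⟩ := h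
  refine ⟨hE, ?_, fun σ => (hx.2.2 σ).trans ?_⟩
  · have := hx.2.1.mul (isIntegral_natCast k)
    rwa [show ((D * k : ℕ) : K) * x = (D : K) * x * (k : K) by push_cast; ring]
  · exact_mod_cast Nat.le_of_dvd hE (Dvd.intro k rfl)

lemma one : HeightBound 1 (1 : K) := by
  refine ⟨one_pos, by simpa using isIntegral_one, fun σ => by simp⟩

lemma pow (hx : HeightBound D x) (n : ℕ) : HeightBound (D ^ n) (x ^ n) := by
  induction n with
  | zero => simpa using one
  | succ n ih => rw [pow_succ, pow_succ]; exact ih.mul hx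

lemma prod {ι : Type*} (s : Finset ι) {D : ι → ℕ} {x : ι → K}
    (h : ∀ i ∈ s, HeightBound (D i) (x i)) : HeightBound (∏ i ∈ s, D i) (∏ i ∈ s, x i) := by
  classical
  induction s using Finset.induction_on with
  | empty => simpa using one
  | insert a s ha ih =>
    rw [Finset.prod_insert ha, Finset.prod_insert ha]
    exact (h a (by simp)).mul (ih fun i hi => h i (by simp [hi]))

lemma neg (hx : HeightBound D x) : HeightBound D (-x) := by
  refine ⟨hx.1, ?_, fun σ => by simpa using hx.2.2 σ⟩
  rw [mul_neg]
  exact hx.2.1.neg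

lemma sum {ι : Type*} {s : Finset ι} (hs : s.Nonempty) {x : ι → K}
    (h : ∀ i ∈ s, HeightBound D (x i)) : HeightBound (s.card * D) (∑ i ∈ s, x i) := by
  obtain ⟨i₀, hi₀⟩ := hs
  have hc : 0 < s.card := Finset.card_pos.2 ⟨i₀, hi₀⟩
  refine ⟨Nat.mul_pos hc (h i₀ hi₀).1, ?_, fun σ => ?_⟩
  · have : ((s.card * D : ℕ) : K) * ∑ i ∈ s, x i = (s.card : K) * ∑ i ∈ s, (D : K) * x i := by
      rw [← Finset.mul_sum]
      push_cast
      ring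
    rw [this]
    exact (isIntegral_natCast _).mul (IsIntegral.sum _ fun i hi => (h i hi).2.1)
  · rw [map_sum]
    refine (norm_sum_le _ _).trans ?_
    refine (Finset.sum_le_card_nsmul _ _ (D : ℝ) fun i hi => (h i hi).2.2 σ).trans ?_
    simp

variable [NumberField K]

lemma exists_bound (x : K) : ∃ D, HeightBound D x := by
  obtain ⟨d, hd, hi⟩ := exists_integral_multiples ℤ ℚ ({x} : Finset K)
  obtain ⟨c, hc⟩ : ∃ c : ℕ, ∀ σ : K →+* ℂ, ‖σ x‖ ≤ c := by
    obtain ⟨c, hc⟩ := exists_nat_ge (∑ σ : K →+* ℂ, ‖σ x‖)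
    exact ⟨c, fun σ => (Finset.single_le_sum (f := fun σ : K →+* ℂ => ‖σ x‖)
      (fun _ _ => norm_nonneg _) (Finset.mem_univ σ)).trans hc⟩
  have hd0 : 0 < d.natAbs := Int.natAbs_pos.2 hd
  refine ⟨d.natAbs * (c + 1), Nat.mul_pos hd0 (Nat.succ_pos c), ?_, fun σ => (hc σ).trans ?_⟩
  · have h1 : IsIntegral ℤ ((d.natAbs : K) * x) := by
      have h2 : IsIntegral ℤ ((d : K) * x) := by
        simpa [zsmul_eq_mul] using hi x (by simp)
      rcases Int.natAbs_eq d with h | h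
      · rw [h] at h2
        simpa using h2
      · rw [h] at h2
        simpa using h2.neg
    have := (isIntegral_natCast (K := K) (c + 1)).mul h1
    rwa [show ((d.natAbs * (c + 1) : ℕ) : K) * x = ((c + 1 : ℕ) : K) * ((d.natAbs : K) * x) by push_cast; ring]
  · have : c ≤ d.natAbs * (c + 1) := by nlinarith
    exact_mod_cast this

lemma exists_common_bound {ι : Type*} [Finite ι] (x : ι → K) : ∃ D, ∀ i, HeightBound D (x i) := by
  classical
  have := Fintype.ofFinite ι
  choose D hD using fun i => exists_bound (x i)
  exact ⟨∏ i, D i, fun i => (hD i).of_dvd (Finset.dvd_prod_of_mem D (Finset.mem_univ i))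
    (Finset.prod_pos fun i _ => (hD i).1)⟩

/-- Liouville's inequality. -/
lemma one_le_norm_mul_pow (hy : HeightBound D y) (h0 : y ≠ 0) (ι : K →+* ℂ) :
    1 ≤ ‖ι y‖ * (D : ℝ) ^ (2 * Module.finrank ℚ K) := by
  have hD : (1 : ℝ) ≤ D := by exact_mod_cast hy.1
  have hD0 : (D : K) ≠ 0 := by exact_mod_cast hy.1.ne'
  obtain ⟨k, hk⟩ := IsIntegrallyClosed.isIntegral_iff.1 (Algebra.isIntegral_norm ℚ hy.2.1)
  have hk0 : k ≠ 0 := by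
    rintro rfl
    rw [map_zero, eq_comm, Algebra.norm_eq_zero_iff] at hk
    exact mul_ne_zero hD0 h0 hk
  have hnorm := Algebra.norm_eq_prod_embeddings ℚ ℂ ((D : K) * y)
  rw [← hk] at hnorm
  have h1 : (1 : ℝ) ≤ ∏ σ : K →ₐ[ℚ] ℂ, ‖σ ((D : K) * y)‖ := by
    rw [← norm_prod, ← hnorm]
    simp only [eq_intCast, map_intCast, Complex.norm_intCast]
    exact_mod_cast Int.one_le_abs hk0
  have hσ : ∀ σ : K →ₐ[ℚ] ℂ, ‖σ ((D : K) * y)‖ ≤ (D : ℝ) ^ 2 := by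
    intro σ
    rw [map_mul, norm_mul, map_natCast, Complex.norm_natCast, sq]
    exact mul_le_mul_of_nonneg_left (hy.2.2 σ.toRingHom) (by positivity)
  classical
  rw [← Finset.mul_prod_erase Finset.univ _ (Finset.mem_univ ι.toRatAlgHom)] at h1
  refine h1.trans ?_
  have hcard : Fintype.card (K →ₐ[ℚ] ℂ) = Module.finrank ℚ K := AlgHom.card ℚ K ℂ
  have hpos : 0 < Module.finrank ℚ K := Module.finrank_pos
  have h2 : ∏ σ ∈ Finset.univ.erase ι.toRatAlgHom, ‖σ ((D : K) * y)‖ ≤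
      ((D : ℝ) ^ 2) ^ (Module.finrank ℚ K - 1) := by
    refine (Finset.prod_le_prod (fun _ _ => norm_nonneg _) fun σ _ => hσ σ).trans ?_
    rw [Finset.prod_const, Finset.card_erase_of_mem (Finset.mem_univ _), Finset.card_univ, hcard]
  have h3 : ‖ι.toRatAlgHom ((D : K) * y)‖ = D * ‖ι y‖ := by
    rw [map_mul, norm_mul, map_natCast, Complex.norm_natCast]
    rfl
  rw [h3]
  calc (D : ℝ) * ‖ι y‖ * ∏ σ ∈ Finset.univ.erase ι.toRatAlgHom, ‖σ ((D : K) * y)‖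
      ≤ D * ‖ι y‖ * ((D : ℝ) ^ 2) ^ (Module.finrank ℚ K - 1) := by gcongr
    _ ≤ D ^ 2 * ‖ι y‖ * ((D : ℝ) ^ 2) ^ (Module.finrank ℚ K - 1) := by
      gcongr
      nlinarith
    _ = ‖ι y‖ * ((D : ℝ) ^ 2) ^ (Module.finrank ℚ K - 1 + 1) := by ring
    _ = _ := by rw [Nat.sub_add_cancel hpos, ← pow_mul]

end HeightBound

end Height

end MahlerAux

namespace MahlerAux
open PowerSeries

section AbsConv

variable {K : Type*} [Field K] (ι : K →+* ℂ) (ρ : ℝ)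

/-- Power series which converge absolutely at radius `ρ` through the embedding `ι`. -/
def IsAbsConv (g : K⟦X⟧) : Prop := Summable fun n => ‖ι (coeff n g)‖ * ρ ^ n

/-- The value at `z` of a power series through the embedding `ι`. -/
noncomputable def evalAt (z : ℂ) (g : K⟦X⟧) : ℂ := ∑' n, ι (coeff n g) * z ^ n

variable {ι ρ} {g h : K⟦X⟧} {z : ℂ}

lemma IsAbsConv.summable_norm (hg : IsAbsConv ι ρ g) (hz : ‖z‖ ≤ ρ) :
    Summable fun n => ‖ι (coeff n g) * z ^ n‖ := by
  refine Summable.of_nonneg_of_le (fun _ => norm_nonneg _) (fun n => ?_) hg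
  rw [norm_mul, norm_pow]
  gcongr

lemma IsAbsConv.summable (hg : IsAbsConv ι ρ g) (hz : ‖z‖ ≤ ρ) :
    Summable fun n => ι (coeff n g) * z ^ n := (hg.summable_norm hz).of_norm

lemma IsAbsConv.add (hρ : 0 ≤ ρ) (hg : IsAbsConv ι ρ g) (hh : IsAbsConv ι ρ h) :
    IsAbsConv ι ρ (g + h) := by
  refine Summable.of_nonneg_of_le (fun _ => by positivity) (fun n => ?_) (Summable.add hg hh)
  rw [map_add, map_add, ← add_mul]
  gcongr
  exact norm_add_le _ _

lemma evalAt_add (hg : IsAbsConv ι ρ g) (hh : IsAbsConv ι ρ h) (hz : ‖z‖ ≤ ρ) :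
    evalAt ι z (g + h) = evalAt ι z g + evalAt ι z h := by
  unfold evalAt
  rw [← (hg.summable hz).tsum_add (hh.summable hz)]
  simp only [map_add, add_mul]

lemma coeff_mul_pow (z : ℂ) (n : ℕ) : ι (coeff n (g * h)) * z ^ n =
    ∑ kl ∈ Finset.HasAntidiagonal.antidiagonal n, (ι (coeff kl.1 g) * z ^ kl.1) * (ι (coeff kl.2 h) * z ^ kl.2) := by
  rw [coeff_mul, map_sum, Finset.sum_mul]
  refine Finset.sum_congr rfl fun kl hkl => ?_
  rw [← Finset.HasAntidiagonal.mem_antidiagonal.1 hkl, map_mul, pow_add]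
  ring

lemma IsAbsConv.mul (hρ : 0 ≤ ρ) (hg : IsAbsConv ι ρ g) (hh : IsAbsConv ι ρ h) :
    IsAbsConv ι ρ (g * h) := by
  have hz : ‖(ρ : ℂ)‖ ≤ ρ := by rw [Complex.norm_real, Real.norm_of_nonneg hρ]
  have := summable_norm_sum_mul_antidiagonal_of_summable_norm (hg.summable_norm hz)
    (hh.summable_norm hz)
  refine this.congr fun n => ?_
  rw [← coeff_mul_pow, norm_mul, norm_pow, Complex.norm_real, Real.norm_of_nonneg hρ]

lemma evalAt_mul (hg : IsAbsConv ι ρ g) (hh : IsAbsConv ι ρ h) (hz : ‖z‖ ≤ ρ) :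
    evalAt ι z (g * h) = evalAt ι z g * evalAt ι z h := by
  unfold evalAt
  rw [tsum_mul_tsum_eq_tsum_sum_antidiagonal_of_summable_norm (hg.summable_norm hz)
    (hh.summable_norm hz)]
  exact tsum_congr fun n => coeff_mul_pow z n

lemma isAbsConv_poly (P : Polynomial K) : IsAbsConv ι ρ (P : K⟦X⟧) := by
  refine summable_of_ne_finset_zero (s := P.support) fun n hn => ?_
  rw [Polynomial.coeff_coe, Polynomial.notMem_support_iff.1 hn]
  simp

lemma evalAt_poly (P : Polynomial K) : evalAt ι z (P : K⟦X⟧) = P.eval₂ ι z := by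
  unfold evalAt
  rw [tsum_eq_sum (s := P.support) fun n hn => ?_, Polynomial.eval₂_eq_sum, Polynomial.sum]
  · simp
  · rw [Polynomial.coeff_coe, Polynomial.notMem_support_iff.1 hn]
    simp

variable (ι ρ) in
/-- The ring of power series which converge absolutely at radius `ρ`. -/
def absConv (hρ : 0 ≤ ρ) : Subring K⟦X⟧ where
  carrier := {g | IsAbsConv ι ρ g}
  mul_mem' := IsAbsConv.mul hρ
  add_mem' := IsAbsConv.add hρ
  one_mem' := by simpa using isAbsConv_poly (1 : Polynomial K)
  zero_mem' := by simpa using isAbsConv_poly (0 : Polynomial K)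
  neg_mem' := by
    intro g hg
    have : IsAbsConv ι ρ g := hg
    simpa [IsAbsConv] using this

variable (ι) in
/-- Evaluation at `z` as a ring homomorphism. -/
noncomputable def evalHom (hρ : 0 ≤ ρ) (z : ℂ) (hz : ‖z‖ ≤ ρ) : absConv ι ρ hρ →+* ℂ where
  toFun g := evalAt ι z g
  map_one' := by simpa using evalAt_poly (ι := ι) (z := z) (1 : Polynomial K)
  map_mul' g h := evalAt_mul g.2 h.2 hz
  map_zero' := by simpa using evalAt_poly (ι := ι) (z := z) (0 : Polynomial K)
  map_add' g h := evalAt_add g.2 h.2 hz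

lemma exists_norm_evalAt_le (hg : IsAbsConv ι ρ g) : ∃ C, 0 ≤ C ∧ ∀ z : ℂ, ‖z‖ ≤ ρ →
    ‖evalAt ι z g‖ ≤ C := by
  by_cases hρ : 0 ≤ ρ
  · refine ⟨∑' n, ‖ι (coeff n g)‖ * ρ ^ n, tsum_nonneg fun n => by positivity, fun z hz => ?_⟩
    refine (norm_tsum_le_tsum_norm (hg.summable_norm hz)).trans ?_
    refine (hg.summable_norm hz).tsum_le_tsum (fun n => ?_) hg
    rw [norm_mul, norm_pow]
    gcongr
  · exact ⟨0, le_rfl, fun z hz => absurd ((norm_nonneg z).trans hz) hρ⟩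

lemma IsAbsConv.of_X_pow_mul (hρ : 0 < ρ) {T : ℕ} (hg : IsAbsConv ι ρ ((X : K⟦X⟧) ^ T * g)) :
    IsAbsConv ι ρ g := by
  have h1 := (summable_nat_add_iff T).2 hg
  have h2 := h1.mul_right ((ρ ^ T)⁻¹)
  refine h2.congr fun n => ?_
  rw [coeff_X_pow_mul, pow_add]
  field_simp

lemma evalAt_X_pow_mul (hρ : 0 < ρ) {T : ℕ} (hg : IsAbsConv ι ρ g) (hz : ‖z‖ ≤ ρ) :
    evalAt ι z ((X : K⟦X⟧) ^ T * g) = z ^ T * evalAt ι z g := by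
  have h := isAbsConv_poly (ι := ι) (ρ := ρ) ((Polynomial.X : Polynomial K) ^ T)
  have h2 := evalAt_poly (ι := ι) (z := z) ((Polynomial.X : Polynomial K) ^ T)
  rw [Polynomial.coe_pow, Polynomial.coe_X] at h h2
  rw [evalAt_mul h hg hz, h2]
  simp

lemma exists_norm_evalAt_le_of_X_pow_dvd (hρ : 0 < ρ) (hg : IsAbsConv ι ρ g) {T : ℕ}
    (hT : (X : K⟦X⟧) ^ T ∣ g) : ∃ C, 0 ≤ C ∧ ∀ z : ℂ, ‖z‖ ≤ ρ →
    ‖evalAt ι z g‖ ≤ C * ‖z‖ ^ T := by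
  obtain ⟨h, rfl⟩ := hT
  have hh := hg.of_X_pow_mul hρ
  obtain ⟨C, hC0, hC⟩ := exists_norm_evalAt_le hh
  refine ⟨C, hC0, fun z hz => ?_⟩
  rw [evalAt_X_pow_mul hρ hh hz, norm_mul, norm_pow, mul_comm]
  gcongr
  exact hC z hz

lemma exists_le_norm_evalAt (hρ : 0 < ρ) (hg : IsAbsConv ι ρ g) (h0 : g ≠ 0) :
    ∃ (T : ℕ) (c δ : ℝ), 0 < c ∧ 0 < δ ∧ ∀ z : ℂ, ‖z‖ ≤ ρ → ‖z‖ ≤ δ →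
      c * ‖z‖ ^ T ≤ ‖evalAt ι z g‖ := by
  obtain ⟨T, h, hgh, hc0⟩ : ∃ (T : ℕ) (h : K⟦X⟧), g = (X : K⟦X⟧) ^ T * h ∧
      constantCoeff h ≠ 0 := by
    refine ⟨g.order.toNat, divXPowOrder g, X_pow_order_mul_divXPowOrder.symm, ?_⟩
    rw [constantCoeff_divXPowOrder]
    exact coeff_order h0
  rw [hgh] at hg ⊢
  have hh := hg.of_X_pow_mul hρ
  have hsub : (X : K⟦X⟧) ^ 1 ∣ h - ((Polynomial.C (constantCoeff h) : Polynomial K) : K⟦X⟧) := by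
    rw [pow_one, X_dvd_iff]
    simp
  have hconst := isAbsConv_poly (ι := ι) (ρ := ρ) (Polynomial.C (constantCoeff h) : Polynomial K)
  have hdiff : IsAbsConv ι ρ (h - ((Polynomial.C (constantCoeff h) : Polynomial K) : K⟦X⟧)) :=
    (absConv ι ρ hρ.le).sub_mem hh hconst
  obtain ⟨C, hC0, hC⟩ := exists_norm_evalAt_le_of_X_pow_dvd hρ hdiff hsub
  have hpos : 0 < ‖ι (constantCoeff h)‖ := norm_pos_iff.2 ((map_ne_zero ι).2 hc0)
  refine ⟨T, ‖ι (constantCoeff h)‖ / 2, ‖ι (constantCoeff h)‖ / (2 * (C + 1)), by positivity,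
    by positivity, fun z hz hzδ => ?_⟩
  rw [evalAt_X_pow_mul hρ hh hz, norm_mul, norm_pow, mul_comm]
  gcongr
  have h1 : evalAt ι z h = ι (constantCoeff h) +
      evalAt ι z (h - ((Polynomial.C (constantCoeff h) : Polynomial K) : K⟦X⟧)) := by
    have h2 := evalAt_poly (ι := ι) (z := z) (Polynomial.C (constantCoeff h) : Polynomial K)
    rw [Polynomial.eval₂_C] at h2
    rw [← h2, ← evalAt_add hconst hdiff hz, add_sub_cancel]
  have h3 := hC z hz
  rw [pow_one] at h3
  have h4 : C * ‖z‖ ≤ ‖ι (constantCoeff h)‖ / 2 := by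
    calc C * ‖z‖ ≤ (C + 1) * (‖ι (constantCoeff h)‖ / (2 * (C + 1))) := by gcongr; linarith
      _ = _ := by field_simp
  rw [h1]
  have h5 := norm_sub_le_norm_add (ι (constantCoeff h))
    (evalAt ι z (h - ((Polynomial.C (constantCoeff h) : Polynomial K) : K⟦X⟧)))
  linarith

lemma IsAbsConv.expand {q : ℕ} (hq : q ≠ 0) (hρ : 0 ≤ ρ) (hρ1 : ρ ≤ 1) (hg : IsAbsConv ι ρ g) :
    IsAbsConv ι ρ (expand q hq g) := by
  have hinj : Function.Injective fun n : ℕ => q * n := fun a b h => Nat.eq_of_mul_eq_mul_left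
    (Nat.pos_of_ne_zero hq) h
  refine (hinj.summable_iff ?_).1 ?_
  · intro n hn
    rw [coeff_expand_of_not_dvd q hq g]
    · simp
    · rintro ⟨k, rfl⟩
      exact hn ⟨k, rfl⟩
  · refine Summable.of_nonneg_of_le (fun n => by
      simp only [Function.comp_apply]; positivity) (fun n => ?_) hg
    simp only [Function.comp_apply, coeff_expand_mul]
    gcongr ?_ * ?_
    exact pow_le_pow_of_le_one hρ hρ1 (Nat.le_mul_of_pos_left n (Nat.pos_of_ne_zero hq))

lemma evalAt_expand {q : ℕ} (hq : q ≠ 0) (g : K⟦X⟧) (z : ℂ) :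
    evalAt ι z (expand q hq g) = evalAt ι (z ^ q) g := by
  have hinj : Function.Injective fun n : ℕ => q * n := fun a b h => Nat.eq_of_mul_eq_mul_left
    (Nat.pos_of_ne_zero hq) h
  unfold evalAt
  rw [← hinj.tsum_eq]
  · refine tsum_congr fun n => ?_
    rw [coeff_expand_mul, pow_mul]
  · intro n hn
    by_contra hcon
    apply hn
    show ι (coeff n _) * z ^ n = 0
    rw [coeff_expand_of_not_dvd q hq g]
    · simp
    · rintro ⟨k, rfl⟩
      exact hcon ⟨k, rfl⟩

end AbsConv

end MahlerAux

namespace MahlerAux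

section Growth

lemma exists_mul_lt_add_of_le_pow {r : ℕ → ℕ} {m M : ℕ} (hM : 0 < M) (h0 : 0 < r 0)
    (hr : ∀ d, r d ≤ (d + 1) ^ m) : ∃ d, M * r (d + 1) < r (d + 1) + M * r d := by
  by_contra hcon
  push Not at hcon
  have hMR : (0 : ℝ) < M := by exact_mod_cast hM
  set x : ℝ := (M - 1) / M with hx
  have hx0 : 0 ≤ x := div_nonneg (by
    have : (1 : ℝ) ≤ M := by exact_mod_cast hM
    linarith) hMR.le
  have hx1 : x < 1 := by rw [hx, div_lt_one hMR]; linarith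
  have hstep : ∀ d, (r d : ℝ) ≤ x * r (d + 1) := by
    intro d
    have : ((r (d + 1) + M * r d : ℕ) : ℝ) ≤ ((M * r (d + 1) : ℕ) : ℝ) := by
      exact_mod_cast hcon d
    push_cast at this
    rw [hx, div_mul_eq_mul_div, le_div_iff₀ hMR]
    linarith
  have hpow : ∀ d, (1 : ℝ) ≤ x ^ d * r d := by
    intro d
    induction d with
    | zero => simpa using (by exact_mod_cast h0 : (1 : ℝ) ≤ r 0)
    | succ d ih =>
      refine ih.trans ?_
      rw [pow_succ, mul_assoc]
      exact mul_le_mul_of_nonneg_left (hstep d) (pow_nonneg hx0 d)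
  have hlim := (tendsto_pow_const_mul_const_pow_of_abs_lt_one m
    (show |x| < 1 by rwa [abs_of_nonneg hx0])).comp (Filter.tendsto_add_atTop_nat 1)
  have hx' : ∀ d : ℕ, x ≤ ((d + 1 : ℕ) : ℝ) ^ m * x ^ (d + 1) := by
    intro d
    have h1 : (r d : ℝ) ≤ ((d + 1 : ℕ) : ℝ) ^ m := by exact_mod_cast hr d
    calc x = x * 1 := by ring
      _ ≤ x * (x ^ d * r d) := mul_le_mul_of_nonneg_left (hpow d) hx0
      _ ≤ x * (x ^ d * ((d + 1 : ℕ) : ℝ) ^ m) := by gcongr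
      _ = _ := by ring
  have hle : x ≤ 0 := ge_of_tendsto' hlim hx'
  have h1 := hstep 0
  have h2 : (1 : ℝ) ≤ r 0 := by exact_mod_cast h0
  rw [le_antisymm hle hx0] at h1
  linarith

variable {F Ω : Type*} [Field F] [Field Ω] [Algebra F Ω] {ι : Type} [Fintype ι]

/-- Among the monomials in `t` with bounded exponents one finds linearly independent families
such that multiplication by each `t i` sends the second into the span of the first, and the
cardinalities are as close as one wishes. -/
lemma exists_linearIndependent_monomials (t : ι → Ω) {M : ℕ} (hM : 0 < M) :
    ∃ (d : ℕ) (κ κ' : Type) (_ : Fintype κ) (_ : Fintype κ') (v : κ → ι → ℕ) (v' : κ' → ι → ℕ),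
      (∀ s i, v s i ≤ d) ∧ LinearIndependent F (fun s => ∏ i, t i ^ v s i) ∧
      LinearIndependent F (fun s => ∏ i, t i ^ v' s i) ∧
      M * Fintype.card κ < Fintype.card κ + M * Fintype.card κ' ∧
      ∀ i l, t i * ∏ k, t k ^ v' l k ∈
        Submodule.span F (Set.range fun s => ∏ i, t i ^ v s i) := by
  classical
  let mono : ∀ d : ℕ, (ι → Fin (d + 1)) → Ω := fun d v => ∏ i, t i ^ (v i : ℕ)
  choose κ a ha hspan hli using fun d => exists_linearIndependent' F (mono d)
  letI : ∀ d, Fintype (κ d) := fun d => Fintype.ofInjective (a d) (ha d)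
  obtain ⟨d, hd⟩ := exists_mul_lt_add_of_le_pow (r := fun d => Fintype.card (κ d))
    (m := Fintype.card ι) hM (by
      rw [Fintype.card_pos_iff]
      by_contra hemp
      rw [not_nonempty_iff] at hemp
      have h1 : (1 : Ω) ∈ Submodule.span F (Set.range (mono 0)) :=
        Submodule.subset_span ⟨fun _ => 0, by simp [mono]⟩
      rw [← hspan 0, Set.range_eq_empty, Submodule.span_empty, Submodule.mem_bot] at h1
      exact one_ne_zero h1) (by
      intro d
      refine (Fintype.card_le_of_injective (a d) (ha d)).trans ?_
      simp)
  refine ⟨d + 1, κ (d + 1), κ d, inferInstance, inferInstance, fun s i => a (d + 1) s i,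
    fun s i => a d s i, fun s i => Nat.lt_succ_iff.1 (a (d + 1) s i).2, hli (d + 1), hli d, hd, ?_⟩
  intro i l
  change _ ∈ Submodule.span F (Set.range (mono (d + 1) ∘ a (d + 1)))
  rw [hspan (d + 1)]
  refine Submodule.subset_span ⟨fun k => ⟨(a d l k : ℕ) + if k = i then 1 else 0, ?_⟩, ?_⟩
  · have := (a d l k).2
    split_ifs <;> omega
  · simp only [mono, pow_add, Finset.prod_mul_distrib, pow_ite, pow_one, pow_zero]
    rw [mul_comm, Finset.prod_ite_eq' Finset.univ i]
    simp

end Growth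

end MahlerAux

namespace MahlerAux
open PowerSeries
open scoped Polynomial

section Core

variable {K : Type} [Field K] [CharZero K] {q : ℕ} {ζ : K}
variable (F E : Type) [Field F] [Field E] [Algebra K[X] F] [IsFractionRing K[X] F]
  [Algebra K⟦X⟧ E] [IsFractionRing K⟦X⟧ E] [Algebra K[X] E] [IsScalarTower K[X] K⟦X⟧ E]
  [Algebra F E] [IsScalarTower K[X] F E]
variable {Ω : Type} [Field Ω] [Algebra K[X] Ω] [Algebra F Ω] [IsScalarTower K[X] F Ω]

theorem exists_det_ne_zero (hq2 : 2 ≤ q) (hq : q ≠ 0) (hζ : IsPrimitiveRoot ζ q)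
    {ι : Type} [Fintype ι] {g : ι → K⟦X⟧} (hg : LinearIndependent K[X] g)
    (hstab : ∀ i, algebraMap K⟦X⟧ E (expand q hq (g i)) ∈
      IntermediateField.adjoin F (algebraMap K⟦X⟧ E '' Set.range g))
    {t : ι → Ω} {i₀ : ι} (ht : t i₀ ≠ 0) {M : ℕ} (hM : 0 < M) :
    ∃ (d : ℕ) (κ κ' : Type) (_ : Fintype κ) (_ : Fintype κ') (_ : DecidableEq κ')
      (v : κ → ι → ℕ) (v' : κ' → ι → ℕ)
      (Q : K[X]) (c : ι → κ' → κ → K[X]) (a : κ' → κ),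
      (∀ s i, v s i ≤ d) ∧ LinearIndependent K[X] (fun s => ∏ i, t i ^ v s i) ∧
      M * Fintype.card κ < Fintype.card κ + M * Fintype.card κ' ∧
      (∀ i l, Q • (t i * ∏ k, t k ^ v' l k) = ∑ s, c i l s • ∏ k, t k ^ v s k) ∧
      Function.Injective a ∧
      ((Matrix.of fun l s => ∑ i, (c i l s : K⟦X⟧) * g i).submatrix id a).det ≠ 0 := by
  classical
  obtain ⟨d, κ, κ', _, _, v, v', hv, hli, hli', hcard, hmem⟩ :=
    exists_linearIndependent_monomials (F := F) t hM
  have hex : ∀ i l, ∃ c : κ → F, ∑ s, c s • ∏ k, t k ^ v s k = t i * ∏ k, t k ^ v' l k :=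
    fun i l => (Submodule.mem_span_range_iff_exists_fun F).1 (hmem i l)
  choose c₀ hc₀ using hex
  obtain ⟨⟨Q, hQ⟩, hint⟩ := IsLocalization.exist_integer_multiples_of_finite (nonZeroDivisors K[X])
    (fun p : ι × κ' × κ => c₀ p.1 p.2.1 p.2.2)
  have hint' : ∀ i l s, ∃ P : K[X], algebraMap K[X] F P = algebraMap K[X] F Q * c₀ i l s := by
    intro i l s
    obtain ⟨P, hP⟩ := hint (i, l, s)
    exact ⟨P, by rw [hP, Algebra.smul_def]⟩
  choose c hc using hint'
  have hcz : CharZero F := charZero_of_injective_algebraMap (IsFractionRing.injective K[X] F)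
  let B := Algebra.adjoin F (Set.range t)
  have hB : Algebra.FiniteType F B :=
    (Subalgebra.fg_iff_finiteType _).1 (Subalgebra.fg_def.2 ⟨Set.range t, Set.finite_range t, rfl⟩)
  let t' : ι → B := fun i => ⟨t i, Algebra.subset_adjoin ⟨i, rfl⟩⟩
  let L := IntermediateField.adjoin F (algebraMap K⟦X⟧ E '' Set.range g)
  let f : ι → L := fun i => ⟨algebraMap K⟦X⟧ E (g i),
    IntermediateField.subset_adjoin F _ ⟨g i, ⟨i, rfl⟩, rfl⟩⟩
  have hf : LinearIndependent F f := by
    refine LinearIndependent.of_comp L.val.toLinearMap ?_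
    exact linearIndependent_algebraMap_iff.1 hg
  have hL : ∀ x : L, IsAlgebraic F x → ∃ a : F, algebraMap F L a = x := by
    intro x hx
    obtain ⟨a, ha⟩ := isAlgebraic_mem_range (F := F) (E := E) hq2 hq hζ (Set.range g)
      (Set.finite_range g) (by rintro _ ⟨i, rfl⟩; exact hstab i) x.2
      ((isAlgebraic_algebraMap_iff (A := E) (algebraMap L E).injective).2 hx)
    exact ⟨a, Subtype.ext ha⟩
  have hmono : ∀ w : ι → ℕ, B.val (∏ i, t' i ^ w i) = ∏ i, t i ^ w i := by
    intro w
    simp [t', map_prod]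
  have he' : LinearIndependent F fun l => ∏ i, t' i ^ v' l i := by
    refine LinearIndependent.of_comp B.val.toLinearMap ?_
    convert hli' using 2 with l
    exact hmono (v' l)
  have hrel : ∀ i l, t' i * ∏ k, t' k ^ v' l k = ∑ s, c₀ i l s • ∏ k, t' k ^ v s k := by
    intro i l
    apply Subtype.val_injective
    have h1 : B.val (t' i * ∏ k, t' k ^ v' l k) = B.val (∑ s, c₀ i l s • ∏ k, t' k ^ v s k) := by
      rw [map_mul, map_sum, hmono]
      simp only [map_smul, hmono]
      exact (hc₀ i l).symm
    exact h1
  have hrows := linearIndependent_rows hL hf (t := t') (i₀ := i₀)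
    (fun h => ht (congrArg Subtype.val h)) he' hrel
  obtain ⟨a, hainj, hdet⟩ := exists_det_submatrix_ne_zero
    (A := Matrix.of fun l s => ∑ i, c₀ i l s • f i) hrows
  refine ⟨d, κ, κ', inferInstance, inferInstance, inferInstance, v, v', Q, c, a, hv, ?_, hcard, ?_,
    hainj, ?_⟩
  · exact (LinearIndependent.iff_fractionRing K[X] F).2 hli
  · intro i l
    rw [← hc₀, Finset.smul_sum]
    refine Finset.sum_congr rfl fun s _ => ?_
    rw [← algebraMap_smul F Q, ← algebraMap_smul F (c i l s), hc, mul_smul]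
  · intro h0
    have h1 := congrArg (algebraMap K⟦X⟧ E) h0
    rw [map_zero, RingHom.map_det] at h1
    have h2 : ((algebraMap K⟦X⟧ E).mapMatrix
        ((Matrix.of fun l s => ∑ i, (c i l s : K⟦X⟧) * g i).submatrix id a)) =
        algebraMap K[X] E Q • (L.val.toRingHom).mapMatrix
          ((Matrix.of fun l s => ∑ i, c₀ i l s • f i).submatrix id a) := by
      ext l s
      simp only [RingHom.mapMatrix_apply, Matrix.map_apply, Matrix.submatrix_apply, Matrix.of_apply,
        map_sum, map_mul, Matrix.smul_apply, Finset.smul_sum]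
      refine Finset.sum_congr rfl fun i _ => ?_
      rw [algebraMap_coe_poly, IsScalarTower.algebraMap_apply K[X] F E, hc, map_mul,
        ← IsScalarTower.algebraMap_apply K[X] F E, smul_eq_mul, mul_assoc]
      congr 1
      exact (Algebra.smul_def (c₀ i (id l) (a s)) (algebraMap K⟦X⟧ E (g i))).symm
    rw [h2, Matrix.det_smul, ← RingHom.map_det] at h1
    rcases mul_eq_zero.1 h1 with h | h
    · have h3 : algebraMap K[X] E Q = 0 := eq_zero_of_pow_eq_zero h
      rw [IsScalarTower.algebraMap_apply K[X] F E, _root_.map_eq_zero] at h3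
      exact nonZeroDivisors.ne_zero hQ
        ((map_eq_zero_iff _ (IsFractionRing.injective K[X] F)).1 h3)
    · exact hdet ((_root_.map_eq_zero _).1 h)

end Core

end MahlerAux

namespace MahlerAux
open PowerSeries Filter
open scoped Polynomial

section Pade

variable {K : Type} [Field K] {κ κ' : Type} [Fintype κ] [Fintype κ'] [DecidableEq κ']

/-- If the columns `a` of `𝓔` form a matrix of determinant `Δ`, then modulo the rows of `𝓔` the
linear form `Δ * ∑ s, P s * x s` equals `∑ s, elimForm 𝓔 a P s * x s`, which does not involve the
variables indexed by `a`. -/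
def elimForm {W : Type*} [CommRing W] (A : Matrix κ' κ W) (a : κ' → κ) (P : κ → W) (u : κ) : W :=
  (A.submatrix id a).det * P u - ∑ k, P (a k) * ((A.submatrix id a).adjugate * A) k u

lemma elimForm_apply_eq_zero {W : Type*} [CommRing W] (A : Matrix κ' κ W) (a : κ' → κ)
    (P : κ → W) (k : κ') : elimForm A a P (a k) = 0 := by
  have h : ∀ k', ((A.submatrix id a).adjugate * A) k' (a k) =
      if k' = k then (A.submatrix id a).det else 0 := by
    intro k'
    have := congrFun (congrFun (A.submatrix id a).adjugate_mul k') k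
    rw [Matrix.smul_apply, Matrix.one_apply] at this
    simpa [Matrix.mul_apply] using this
  simp [elimForm, h, mul_comm]

lemma sum_elimForm_mul {W : Type*} [CommRing W] (A : Matrix κ' κ W) (a : κ' → κ) (P : κ → W)
    {S : Type*} [CommRing S] (φ : W →+* S) {x : κ → S} (hx : ∀ l, ∑ s, φ (A l s) * x s = 0) :
    ∑ u, φ (elimForm A a P u) * x u = φ (A.submatrix id a).det * ∑ u, φ (P u) * x u := by
  have h : ∀ k, ∑ u, φ (((A.submatrix id a).adjugate * A) k u) * x u = 0 := by
    intro k
    simp only [Matrix.mul_apply, map_sum, map_mul, Finset.sum_mul]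
    rw [Finset.sum_comm]
    refine Finset.sum_eq_zero fun l _ => ?_
    simp only [mul_assoc]
    rw [← Finset.mul_sum, hx, mul_zero]
  simp only [elimForm, map_sub, map_mul, map_sum, sub_mul, Finset.sum_sub_distrib, Finset.sum_mul]
  rw [Finset.sum_comm]
  simp only [mul_assoc]
  simp only [← Finset.mul_sum, h, mul_zero, Finset.sum_const_zero, sub_zero]

lemma map_elimForm {W V : Type*} [CommRing W] [CommRing V] (φ : W →+* V) (A : Matrix κ' κ W)
    (a : κ' → κ) (P : κ → W) (u : κ) :
    φ (elimForm A a P u) = elimForm (A.map φ) a (fun s => φ (P s)) u := by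
  have h : (A.map φ).submatrix id a = φ.mapMatrix (A.submatrix id a) := rfl
  simp only [elimForm, map_sub, map_mul, map_sum, h, ← RingHom.map_det, ← RingHom.map_adjugate,
    Matrix.mul_apply]
  rfl

lemma exists_X_pow_dvd_elimForm (A : Matrix κ' κ K⟦X⟧) {a : κ' → κ} (ha : Function.Injective a)
    {M N : ℕ} (hM : M * Fintype.card κ < Fintype.card κ + M * Fintype.card κ') (hN : 0 < N) :
    ∃ P : κ → K[X], P ≠ 0 ∧ (∀ s, (P s).natDegree < N) ∧
      ∀ u, (X : K⟦X⟧) ^ (M * N) ∣ elimForm A a (fun s => (P s : K⟦X⟧)) u := by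
  classical
  let pol : (κ → Fin N → K) → κ → K⟦X⟧ := fun p s => ((Polynomial.ofFn N (p s) : K[X]) : K⟦X⟧)
  let Φ : (κ → Fin N → K) →ₗ[K] ({u : κ // u ∉ Set.range a} → Fin (M * N) → K) :=
    { toFun := fun p u n => coeff n (elimForm A a (pol p) u)
      map_add' := by
        intro p p'
        ext u n
        simp only [Pi.add_apply, ← map_add]
        congr 1
        simp only [elimForm, pol, Pi.add_apply, map_add, Polynomial.coe_add, add_mul,
          Finset.sum_add_distrib]
        ring
      map_smul' := by
        intro c p
        ext u n
        simp only [Pi.smul_apply, RingHom.id_apply, ← map_smul]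
        congr 1
        simp only [elimForm, pol, Pi.smul_apply, map_smul, Polynomial.coe_smul, smul_sub,
          Finset.smul_sum, smul_mul_assoc, mul_smul_comm] }
  have hcard : Fintype.card {u : κ // u ∉ Set.range a} = Fintype.card κ - Fintype.card κ' := by
    rw [Fintype.card_subtype_compl]
    congr 1
    exact Set.card_range_of_injective ha
  have hle := Fintype.card_le_of_injective a ha
  have hker : LinearMap.ker Φ ≠ ⊥ := by
    refine LinearMap.ker_ne_bot_of_finrank_lt ?_
    simp only [Module.finrank_pi_fintype, Module.finrank_self, Finset.sum_const, Finset.card_univ,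
      Fintype.card_fin, smul_eq_mul, mul_one, hcard]
    obtain ⟨e, he⟩ := Nat.exists_eq_add_of_le hle
    rw [he] at hM ⊢
    rw [Nat.add_sub_cancel_left]
    nlinarith
  obtain ⟨p, hp, hp0⟩ := (Submodule.ne_bot_iff _).1 hker
  refine ⟨fun s => Polynomial.ofFn N (p s), ?_, fun s => Polynomial.ofFn_natDegree_lt hN _, ?_⟩
  · intro h
    apply hp0
    ext s k
    have := congrArg (fun Q : κ → K[X] => (Q s).coeff k) h
    simpa using this
  · intro u
    by_cases hu : u ∈ Set.range a
    · obtain ⟨k, rfl⟩ := hu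
      rw [elimForm_apply_eq_zero]
      exact dvd_zero _
    · rw [X_pow_dvd_iff]
      intro n hn
      exact congrFun (congrFun (LinearMap.mem_ker.1 hp) ⟨u, hu⟩) ⟨n, hn⟩

end Pade

section Ultraproduct

lemma exists_ultraproduct (K : Type) [Field K] : ∃ (U : Ultrafilter ℕ) (Ω : Type) (_ : Field Ω)
    (π : (ℕ → K) →+* Ω), (U : Filter ℕ) ≤ atTop ∧ ∀ x, π x = 0 ↔ ∀ᶠ j in (U : Filter ℕ), x j = 0 := by
  refine ⟨hyperfilter ℕ, Filter.Germ (hyperfilter ℕ : Filter ℕ) K, inferInstance,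
    Filter.Germ.coeRingHom _, Nat.hyperfilter_le_atTop, fun x => ?_⟩
  rw [← Filter.Germ.coe_zero]
  exact Filter.Germ.coe_eq

end Ultraproduct

end MahlerAux

namespace MahlerAux
open PowerSeries Filter
open scoped Polynomial

section Specialization

variable {K : Type} [Field K]

lemma HeightBound.eval [NumberField K] {P : K[X]} {D A N e : ℕ} {α : K}
    (hP : ∀ k < N, HeightBound D (P.coeff k)) (hN : P.natDegree < N) (hα : HeightBound A α) :
    HeightBound (N * (D * (A ^ N) ^ e)) (P.eval (α ^ e)) := by
  rw [Polynomial.eval_eq_sum_range' hN]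
  have hne : (Finset.range N).Nonempty := ⟨0, Finset.mem_range.2 (by omega)⟩
  have := HeightBound.sum (s := Finset.range N) hne (D := D * (A ^ N) ^ e)
    (x := fun k => P.coeff k * (α ^ e) ^ k) fun k hk => ?_
  · simpa using this
  · refine (hP k (Finset.mem_range.1 hk)).mul ?_
    refine ((hα.pow e).pow k).of_dvd ?_ (pow_pos (pow_pos hα.1 _) _)
    rw [← pow_mul, ← pow_mul, mul_comm N e]
    exact pow_dvd_pow _ (Nat.mul_le_mul_left _ (Finset.mem_range.1 hk).le)

lemma HeightBound.monomial {ι : Type} [Fintype ι] {C d : ℕ} {x : ι → K} {v : ι → ℕ}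
    (hv : ∀ i, v i ≤ d) (hx : ∀ i, HeightBound C (x i)) (hC : 0 < C) :
    HeightBound (C ^ (Fintype.card ι * d)) (∏ i, x i ^ v i) := by
  refine (HeightBound.prod Finset.univ fun i _ => (hx i).pow (v i)).of_dvd ?_ (pow_pos hC _)
  rw [Finset.prod_pow_eq_pow_sum]
  refine pow_dvd_pow _ ?_
  calc ∑ i, v i ≤ ∑ _i : ι, d := Finset.sum_le_sum fun i _ => hv i
    _ = _ := by simp

/-- Evaluation of polynomials along a sequence, as a map into an ultraproduct. -/
noncomputable def seqEval {Ω : Type*} [CommRing Ω] (π : (ℕ → K) →+* Ω) (x : ℕ → K) : K[X] →+* Ω :=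
  π.comp (RingHom.pi fun j => Polynomial.evalRingHom (x j))

lemma seqEval_injective {Ω : Type*} [Field Ω] {π : (ℕ → K) →+* Ω} {U : Ultrafilter ℕ}
    (hU : (U : Filter ℕ) ≤ atTop) (hπ : ∀ x, π x = 0 ↔ ∀ᶠ j in (U : Filter ℕ), x j = 0)
    {x : ℕ → K} (hx : Function.Injective x) : Function.Injective (seqEval π x) := by
  classical
  rw [injective_iff_map_eq_zero]
  intro P hP
  by_contra h0
  have h1 : ∀ᶠ j in (U : Filter ℕ), P.eval (x j) = 0 := (hπ _).1 hP
  have h2 : {j | P.eval (x j) = 0}.Finite :=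
    (P.roots.toFinset.finite_toSet.preimage hx.injOn).subset fun j hj => by
      simpa [h0] using hj
  have h3 : ∀ᶠ j in (U : Filter ℕ), P.eval (x j) ≠ 0 := by
    refine hU ?_
    rw [← Nat.cofinite_eq_atTop]
    exact h2.compl_mem_cofinite
  obtain ⟨j, hj, hj'⟩ := (h1.and h3).exists
  exact hj' hj

lemma pow_pow_injective {q : ℕ} (hq2 : 2 ≤ q) {ι₀ : K →+* ℂ} {α : K} (hα0 : α ≠ 0)
    (hα1 : ‖ι₀ α‖ < 1) : Function.Injective fun j : ℕ => α ^ q ^ j := by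
  intro i j hij
  have h1 : ‖ι₀ α‖ ^ q ^ i = ‖ι₀ α‖ ^ q ^ j := by
    simpa using congrArg (fun x => ‖ι₀ x‖) hij
  exact Nat.pow_right_injective hq2 (pow_right_injective₀
    (norm_pos_iff.2 ((_root_.map_ne_zero ι₀).2 hα0)) hα1.ne h1)

lemma eventually_mul_pow_pow_lt {q : ℕ} (hq2 : 2 ≤ q) {b : ℝ} (hb0 : 0 ≤ b) (hb1 : b < 1) (C : ℝ)
    {c : ℝ} (hc : 0 < c) : ∀ᶠ j in atTop, C * b ^ q ^ j < c := by
  have h1 : Tendsto (fun j => q ^ j) atTop atTop := tendsto_pow_atTop_atTop_of_one_lt hq2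
  have h2 := ((tendsto_pow_atTop_nhds_zero_of_lt_one hb0 hb1).comp h1).const_mul C
  rw [mul_zero] at h2
  exact h2.eventually_lt_const hc

variable (F E : Type) [Field F] [Field E] [Algebra K[X] F] [IsFractionRing K[X] F]
  [Algebra K⟦X⟧ E] [IsFractionRing K⟦X⟧ E] [Algebra K[X] E] [IsScalarTower K[X] K⟦X⟧ E]
  [Algebra F E] [IsScalarTower K[X] F E]

/-- Values of independent Mahler functions along the orbit of an algebraic point do not satisfy
linear relations of small height. -/
theorem false_of_linear_relations [NumberField K] {q : ℕ} {ζ : K} (ι₀ : K →+* ℂ) (hq2 : 2 ≤ q)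
    (hq : q ≠ 0) (hζ : IsPrimitiveRoot ζ q)
    {ι : Type} [Fintype ι] {g : ι → K⟦X⟧} (hg : LinearIndependent K[X] g)
    (hstab : ∀ i, algebraMap K⟦X⟧ E (expand q hq (g i)) ∈
      IntermediateField.adjoin F (algebraMap K⟦X⟧ E '' Set.range g))
    {ρ : ℝ} (hρ : 0 < ρ) (hgc : ∀ i, IsAbsConv ι₀ ρ (g i)) {α : K} (hα0 : α ≠ 0)
    (hαρ : ‖ι₀ α‖ ≤ ρ) (hα1 : ‖ι₀ α‖ < 1) {τ : ℕ → ι → K} (hτ : ∀ j, τ j ≠ 0) {C : ℕ}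
    (hC : ∀ j i, HeightBound (C ^ q ^ j) (τ j i))
    (hrel : ∀ j, ∑ i, ι₀ (τ j i) * evalAt ι₀ (ι₀ α ^ q ^ j) (g i) = 0) : False := by
  classical
  have ha0 : 0 < ‖ι₀ α‖ := norm_pos_iff.2 ((_root_.map_ne_zero ι₀).2 hα0)
  have hz : ∀ j, ‖ι₀ α ^ q ^ j‖ ≤ ρ := fun j => by
    rw [norm_pow]
    exact (pow_le_of_le_one ha0.le hα1.le (pow_pos (by omega) j).ne').trans hαρ
  obtain ⟨U, Ω, _, π, hU, hπ⟩ := exists_ultraproduct K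
  have hπ' : ∀ x, π x ≠ 0 ↔ ∀ᶠ j in (U : Filter ℕ), x j ≠ 0 := fun x => by
    rw [Ne, hπ, ← Ultrafilter.eventually_not]
  have hinj := seqEval_injective hU hπ (pow_pow_injective hq2 hα0 hα1)
  letI : Algebra K[X] Ω := (seqEval π fun j => α ^ q ^ j).toAlgebra
  letI : Algebra F Ω := (IsFractionRing.lift hinj : F →+* Ω).toAlgebra
  have : IsScalarTower K[X] F Ω :=
    IsScalarTower.of_algebraMap_eq fun P => (IsFractionRing.lift_algebraMap hinj P).symm
  have hsmul : ∀ (P : K[X]) (x : ℕ → K), P • π x = π fun j => P.eval (α ^ q ^ j) * x j := by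
    intro P x
    rw [Algebra.smul_def]
    exact (map_mul π _ _).symm
  let t : ι → Ω := fun i => π fun j => τ j i
  have hmono : ∀ w : ι → ℕ, ∏ i, t i ^ w i = π fun j => ∏ i, τ j i ^ w i := by
    intro w
    simp only [t, ← map_pow, ← map_prod]
    congr 1
    ext j
    simp
  obtain ⟨i₀, ht⟩ : ∃ i, t i ≠ 0 := by
    by_contra hcon
    push Not at hcon
    have h1 : ∀ᶠ j in (U : Filter ℕ), ∀ i, τ j i = 0 := eventually_all.2 fun i => (hπ _).1 (hcon i)
    obtain ⟨j, hj⟩ := h1.exists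
    exact hτ j (funext hj)
  obtain ⟨A, hA⟩ := HeightBound.exists_bound α
  set n := Module.finrank ℚ K
  have hA1 : (1 : ℝ) ≤ A := by exact_mod_cast hA.1
  have hC0 : 0 < C := Nat.pos_of_ne_zero fun h => (hC 0 i₀).1.ne' (by simp [h])
  have hC1 : (1 : ℝ) ≤ C := by exact_mod_cast hC0
  obtain ⟨M, hM, hMA⟩ : ∃ M : ℕ, 0 < M ∧ (A : ℝ) ^ (2 * n) * ‖ι₀ α‖ ^ M < 1 := by
    obtain ⟨M, hM⟩ := exists_pow_lt_of_lt_one (show (0 : ℝ) < 1 / (A : ℝ) ^ (2 * n) by positivity)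
      hα1
    refine ⟨M + 1, M.succ_pos, ?_⟩
    rw [lt_div_iff₀ (by positivity), mul_comm] at hM
    refine lt_of_le_of_lt ?_ hM
    refine mul_le_mul_of_nonneg_left ?_ (by positivity)
    exact pow_le_pow_of_le_one ha0.le hα1.le (Nat.le_succ M)
  obtain ⟨d, κ, κ', _, _, _, v, v', Q, c, a, hv, hli, hcard, hlin, hainj, hdet⟩ :=
    exists_det_ne_zero F E hq2 hq hζ hg hstab ht hM
  let W := absConv ι₀ ρ hρ.le
  let A' : Matrix κ' κ W := Matrix.of fun l s =>
    ∑ i, (⟨(c i l s : K⟦X⟧), isAbsConv_poly _⟩ : W) * ⟨g i, hgc i⟩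
  have hA' : A'.map W.subtype = Matrix.of fun l s => ∑ i, (c i l s : K⟦X⟧) * g i := by
    ext1 l s
    simp [A']
  have hΔ : (((A'.submatrix id a).det : W) : K⟦X⟧) ≠ 0 := by
    have : W.subtype (A'.submatrix id a).det = ((A'.map W.subtype).submatrix id a).det :=
      RingHom.map_det _ _
    rw [hA'] at this
    exact fun h => hdet (this.symm.trans h)
  obtain ⟨T, c₀, δ, hc₀, hδ, hlow⟩ := exists_le_norm_evalAt hρ (A'.submatrix id a).det.2 hΔ
  let e : ℕ → κ → K := fun j s => ∏ i, τ j i ^ v s i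
  set C' := C ^ (Fintype.card ι * d)
  have hC'1 : (1 : ℝ) ≤ C' := by exact_mod_cast Nat.one_le_pow _ _ hC0
  have he : ∀ j s, HeightBound (C' ^ q ^ j) (e j s) := by
    intro j s
    have := HeightBound.monomial (hv s) (hC j) (pow_pos hC0 _)
    rwa [← pow_mul, mul_comm, pow_mul] at this
  let ev : ℕ → W →+* ℂ := fun j => evalHom ι₀ hρ.le (ι₀ α ^ q ^ j) (hz j)
  have hevP : ∀ j (P : K[X]), ev j ⟨(P : K⟦X⟧), isAbsConv_poly _⟩ = ι₀ (P.eval (α ^ q ^ j)) := by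
    intro j P
    change evalAt ι₀ _ (P : K⟦X⟧) = _
    rw [evalAt_poly, ← map_pow, Polynomial.eval₂_at_apply]
  have hker : ∀ᶠ j in (U : Filter ℕ), ∀ l, ∑ s, ev j (A' l s) * ι₀ (e j s) = 0 := by
    have h1 : ∀ᶠ j in (U : Filter ℕ), ∀ i l, Q.eval (α ^ q ^ j) * (τ j i * ∏ k, τ j k ^ v' l k) -
        ∑ s, (c i l s).eval (α ^ q ^ j) * e j s = 0 := by
      refine eventually_all.2 fun i => eventually_all.2 fun l => ?_
      have h2 := hlin i l
      simp only [hmono, t, ← map_mul, hsmul, ← map_sum] at h2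
      rw [← sub_eq_zero, ← map_sub, hπ] at h2
      simpa [e] using h2
    filter_upwards [h1] with j hj l
    have h3 : ∀ i, ∑ s, ι₀ ((c i l s).eval (α ^ q ^ j)) * ι₀ (e j s) =
        ι₀ (Q.eval (α ^ q ^ j)) * (ι₀ (τ j i) * ι₀ (∏ k, τ j k ^ v' l k)) := by
      intro i
      rw [← map_mul ι₀, ← map_mul ι₀, sub_eq_zero.1 (hj i l), map_sum]
      simp only [map_mul]
    have h4 : ∀ s, ev j (A' l s) = ∑ i, ι₀ ((c i l s).eval (α ^ q ^ j)) *
        evalAt ι₀ (ι₀ α ^ q ^ j) (g i) := by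
      intro s
      simp only [A', Matrix.of_apply, map_sum, map_mul, hevP]
      rfl
    simp only [h4, Finset.sum_mul]
    rw [Finset.sum_comm]
    have h5 : ∀ i, ∑ s, ι₀ ((c i l s).eval (α ^ q ^ j)) * evalAt ι₀ (ι₀ α ^ q ^ j) (g i) *
        ι₀ (e j s) = ι₀ (Q.eval (α ^ q ^ j)) * ι₀ (∏ k, τ j k ^ v' l k) *
          (ι₀ (τ j i) * evalAt ι₀ (ι₀ α ^ q ^ j) (g i)) := by
      intro i
      have : ∀ s, ι₀ ((c i l s).eval (α ^ q ^ j)) * evalAt ι₀ (ι₀ α ^ q ^ j) (g i) * ι₀ (e j s) =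
          evalAt ι₀ (ι₀ α ^ q ^ j) (g i) * (ι₀ ((c i l s).eval (α ^ q ^ j)) * ι₀ (e j s)) :=
        fun s => by ring
      simp only [this]
      rw [← Finset.mul_sum, h3]
      ring
    simp only [h5]
    rw [← Finset.mul_sum, hrel, mul_zero]
  obtain ⟨N, hN, hNb⟩ : ∃ N : ℕ, 0 < N ∧ ((A : ℝ) ^ (2 * n) * ‖ι₀ α‖ ^ M) ^ N *
      ((‖ι₀ α‖ ^ T)⁻¹ * (C' : ℝ) ^ (1 + 2 * n)) < 1 := by
    have h1 := (tendsto_pow_atTop_nhds_zero_of_lt_one (by positivity) hMA).mul_const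
      ((‖ι₀ α‖ ^ T)⁻¹ * (C' : ℝ) ^ (1 + 2 * n))
    rw [zero_mul] at h1
    obtain ⟨N, hN1, hN2⟩ := ((h1.eventually_lt_const one_pos).and (eventually_gt_atTop 0)).exists
    exact ⟨N, hN2, hN1⟩
  obtain ⟨P, hP0, hPN, hPdvd⟩ := exists_X_pow_dvd_elimForm (A'.map W.subtype) hainj hcard hN
  let PW : κ → W := fun s => ⟨(P s : K⟦X⟧), isAbsConv_poly _⟩
  let G : κ → W := elimForm A' a PW
  have hG : ∀ u, (X : K⟦X⟧) ^ (M * N) ∣ (G u : K⟦X⟧) := by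
    intro u
    have : W.subtype (G u) = elimForm (A'.map W.subtype) a (fun s => W.subtype (PW s)) u :=
      map_elimForm _ _ _ _ _
    change _ ∣ W.subtype (G u)
    rw [this]
    exact hPdvd u
  choose CG hCG0 hCG using fun u => exists_norm_evalAt_le_of_X_pow_dvd hρ (G u).2 (hG u)
  obtain ⟨D, hD⟩ := HeightBound.exists_common_bound
    (fun p : κ × Fin N => (P p.1).coeff p.2)
  let x : ℕ → K := fun j => ∑ s, (P s).eval (α ^ q ^ j) * e j s
  have hκ : Nonempty κ := by
    by_contra hemp
    rw [not_nonempty_iff] at hemp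
    exact hP0 (Subsingleton.elim _ _)
  have hxH : ∀ j, HeightBound (Fintype.card κ * (N * (D * (A ^ N) ^ q ^ j) * C' ^ q ^ j)) (x j) :=
    fun j => HeightBound.sum Finset.univ_nonempty fun s _ =>
      (HeightBound.eval (fun k hk => hD (s, ⟨k, hk⟩)) (hPN s) hA).mul (he j s)
  have hx0 : ∀ᶠ j in (U : Filter ℕ), x j ≠ 0 := by
    rw [← hπ']
    intro h
    apply hP0
    refine funext fun s => Fintype.linearIndependent_iff.1 hli P ?_ s
    simp only [hmono, hsmul, ← map_sum]
    rw [← h]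
    congr 1
    ext j
    simp [x, e]
  set b : ℝ := ((A : ℝ) ^ (2 * n) * ‖ι₀ α‖ ^ M) ^ N * ((‖ι₀ α‖ ^ T)⁻¹ * (C' : ℝ) ^ (1 + 2 * n))
    with hb
  have hsmall : ∀ᶠ j in (U : Filter ℕ), 1 * ‖ι₀ α‖ ^ q ^ j < δ :=
    hU (eventually_mul_pow_pow_lt hq2 ha0.le hα1 1 hδ)
  have hfin : ∀ᶠ j in (U : Filter ℕ),
      ((∑ u, CG u) * (Fintype.card κ * N * D : ℝ) ^ (2 * n)) * b ^ q ^ j < c₀ :=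
    hU (eventually_mul_pow_pow_lt hq2 (by positivity) hNb _ hc₀)
  obtain ⟨j, ⟨hj1, hj2⟩, hj3, hj4⟩ := ((hker.and hx0).and (hsmall.and hfin)).exists
  have hL := (hxH j).one_le_norm_mul_pow hj2 ι₀
  have hlow' := hlow _ (hz j) (by rw [norm_pow]; linarith)
  rw [norm_pow] at hlow'
  have hid := sum_elimForm_mul A' a PW (ev j) hj1
  have hsum : ∑ u, ev j (PW u) * ι₀ (e j u) = ι₀ (x j) := by
    simp only [PW, hevP, x, map_sum, map_mul]
  rw [hsum] at hid
  have hup : ‖∑ u, ev j (G u) * ι₀ (e j u)‖ ≤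
      (∑ u, CG u) * (‖ι₀ α‖ ^ q ^ j) ^ (M * N) * (C' : ℝ) ^ q ^ j := by
    refine (norm_sum_le _ _).trans ?_
    rw [Finset.sum_mul, Finset.sum_mul]
    refine Finset.sum_le_sum fun u _ => ?_
    rw [norm_mul]
    have h1 := hCG u _ (hz j)
    rw [norm_pow] at h1
    have h2 := (he j u).2.2 ι₀
    push_cast at h2
    exact mul_le_mul h1 h2 (norm_nonneg _) (by have := hCG0 u; positivity)
  rw [hid, norm_mul] at hup
  have hy : c₀ * (‖ι₀ α‖ ^ q ^ j) ^ T * ‖ι₀ (x j)‖ ≤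
      (∑ u, CG u) * (‖ι₀ α‖ ^ q ^ j) ^ (M * N) * (C' : ℝ) ^ q ^ j :=
    (mul_le_mul_of_nonneg_right hlow' (norm_nonneg _)).trans hup
  push_cast at hL
  have hcT : 0 < c₀ * (‖ι₀ α‖ ^ q ^ j) ^ T := by positivity
  have h1 : c₀ * (‖ι₀ α‖ ^ q ^ j) ^ T ≤
      (∑ u, CG u) * (‖ι₀ α‖ ^ q ^ j) ^ (M * N) * (C' : ℝ) ^ q ^ j *
      (Fintype.card κ * (N * (D * ((A : ℝ) ^ N) ^ q ^ j) * (C' : ℝ) ^ q ^ j)) ^ (2 * n) := by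
    calc c₀ * (‖ι₀ α‖ ^ q ^ j) ^ T = c₀ * (‖ι₀ α‖ ^ q ^ j) ^ T * 1 := by ring
      _ ≤ c₀ * (‖ι₀ α‖ ^ q ^ j) ^ T * (‖ι₀ (x j)‖ * _) := mul_le_mul_of_nonneg_left hL hcT.le
      _ = c₀ * (‖ι₀ α‖ ^ q ^ j) ^ T * ‖ι₀ (x j)‖ * _ := by ring
      _ ≤ _ := mul_le_mul_of_nonneg_right hy (by positivity)
  have h2 : (∑ u, CG u) * (‖ι₀ α‖ ^ q ^ j) ^ (M * N) * (C' : ℝ) ^ q ^ j *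
      (Fintype.card κ * (N * (D * ((A : ℝ) ^ N) ^ q ^ j) * (C' : ℝ) ^ q ^ j)) ^ (2 * n) =
      ((∑ u, CG u) * (Fintype.card κ * N * D : ℝ) ^ (2 * n)) * b ^ q ^ j *
        (‖ι₀ α‖ ^ q ^ j) ^ T := by
    have hbT : b * ‖ι₀ α‖ ^ T = ‖ι₀ α‖ ^ (M * N) * C' * ((A : ℝ) ^ N * C') ^ (2 * n) := by
      rw [hb, pow_add, pow_one, mul_pow, mul_pow, ← pow_mul, ← pow_mul, ← pow_mul,
        mul_comm (2 * n) N]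
      field_simp
    have hbT' : b ^ q ^ j * (‖ι₀ α‖ ^ q ^ j) ^ T =
        (‖ι₀ α‖ ^ q ^ j) ^ (M * N) * (C' : ℝ) ^ q ^ j *
          (((A : ℝ) ^ N) ^ q ^ j * (C' : ℝ) ^ q ^ j) ^ (2 * n) := by
      have h3 := congrArg (· ^ q ^ j) hbT
      simp only [mul_pow] at h3
      rw [pow_right_comm ‖ι₀ α‖ (q ^ j) T, pow_right_comm ‖ι₀ α‖ (q ^ j) (M * N), h3, mul_pow,
        pow_right_comm ((A : ℝ) ^ N) (q ^ j) (2 * n), pow_right_comm (C' : ℝ) (q ^ j) (2 * n)]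
    rw [mul_assoc _ (b ^ q ^ j), hbT']
    rw [show (Fintype.card κ : ℝ) * (N * (D * ((A : ℝ) ^ N) ^ q ^ j) * (C' : ℝ) ^ q ^ j) =
      (Fintype.card κ * N * D) * (((A : ℝ) ^ N) ^ q ^ j * (C' : ℝ) ^ q ^ j) by ring, mul_pow]
    ring
  rw [h2] at h1
  have h3 := le_of_mul_le_mul_right h1 (by positivity)
  linarith

end Specialization

end MahlerAux

namespace MahlerAux
open PowerSeries
open scoped Polynomial

section Step

variable {R : Type*} [CommRing R]

/-- Elimination of the leading unknown of `∑ cᵢ yᵢ` by means of a relation `∑ Pᵢ yᵢ = 0`. -/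
def elimStep (P c : ℕ → R) (i : ℕ) : R := P 0 * c (i + 1) - c 0 * P (i + 1)

lemma mul_sum_eq_sum_elimStep {P c y : ℕ → R} {m : ℕ} (hP : ∑ i ∈ Finset.range (m + 1), P i * y i = 0)
    (hc : c m = 0) : P 0 * ∑ i ∈ Finset.range m, c i * y i =
      ∑ i ∈ Finset.range m, elimStep P c i * y (i + 1) := by
  have h1 : ∑ i ∈ Finset.range m, c i * y i = ∑ i ∈ Finset.range (m + 1), c i * y i := by
    rw [Finset.sum_range_succ, hc]; simp
  rw [Finset.sum_range_succ'] at hP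
  simp only [elimStep, sub_mul, Finset.sum_sub_distrib, mul_assoc, ← Finset.mul_sum]
  rw [h1, Finset.sum_range_succ']
  linear_combination c 0 * hP

lemma elimStep_ne_zero [IsDomain R] {P c : ℕ → R} {m : ℕ} (h0 : P 0 ≠ 0) (hm : P m ≠ 0)
    (hc : ∀ i, m ≤ i → c i = 0) (hne : ∃ i < m, c i ≠ 0) :
    ∃ i < m, elimStep P c i ≠ 0 := by
  obtain ⟨i, hi, hci⟩ := hne
  by_contra! h
  have hc0 : c 0 = 0 := by
    have := h (m - 1) (by omega)
    rw [elimStep, Nat.sub_add_cancel (by omega), hc m le_rfl] at this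
    simpa [hm] using this
  rcases i with _ | i
  · exact hci hc0
  · have := h i (by omega)
    simp [elimStep, hc0, h0] at this
    exact hci this

lemma elimStep_eq_zero {P c : ℕ → R} {m : ℕ} (hP : ∀ i, m < i → P i = 0)
    (hc : ∀ i, m ≤ i → c i = 0) {i : ℕ} (hi : m ≤ i) : elimStep P c i = 0 := by
  rw [elimStep, hc (i + 1) (by omega), hP (i + 1) (by omega)]; simp

end Step

section Expand

variable {K : Type*} [Field K] {q : ℕ} (hq : q ≠ 0)

/-- The iterates of the Mahler operator. -/
noncomputable def mahlerPow (i : ℕ) : K⟦X⟧ →ₐ[K] K⟦X⟧ := expand (q ^ i) (pow_ne_zero i hq)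

lemma mahlerPow_zero (f : K⟦X⟧) : mahlerPow hq 0 f = f := by
  ext n; simp [mahlerPow]

lemma mahlerPow_add (i j : ℕ) (f : K⟦X⟧) :
    mahlerPow hq (i + j) f = mahlerPow hq i (mahlerPow hq j f) := by
  simp only [mahlerPow]
  rw [← PowerSeries.expand_mul]
  congr 1
  simp only [pow_add]

lemma mahlerPow_one (f : K⟦X⟧) : mahlerPow hq 1 f = expand q hq f := by
  simp only [mahlerPow, pow_one]

lemma mahlerPow_succ' (i : ℕ) (f : K⟦X⟧) :
    mahlerPow hq (i + 1) f = expand q hq (mahlerPow hq i f) := by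
  rw [add_comm, mahlerPow_add, mahlerPow_one]

lemma mahlerPow_poly (i : ℕ) (P : K[X]) :
    mahlerPow hq i (P : K⟦X⟧) = ((Polynomial.expand K (q ^ i) P : K[X]) : K⟦X⟧) :=
  (coe_polyExpand (pow_ne_zero i hq) P).symm

lemma evalAt_mahlerPow (ι : K →+* ℂ) (i : ℕ) (g : K⟦X⟧) (z : ℂ) :
    evalAt ι z (mahlerPow hq i g) = evalAt ι (z ^ q ^ i) g := evalAt_expand _ g z

lemma IsAbsConv.mahlerPow {ι : K →+* ℂ} {ρ : ℝ} (hρ : 0 ≤ ρ) (hρ1 : ρ ≤ 1) {g : K⟦X⟧}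
    (hg : IsAbsConv ι ρ g) (i : ℕ) : IsAbsConv ι ρ (mahlerPow hq i g) :=
  IsAbsConv.expand _ hρ hρ1 hg

lemma evalAt_sum {ι : K →+* ℂ} {ρ : ℝ} (hρ : 0 ≤ ρ) {s : Finset ℕ} {g : ℕ → K⟦X⟧}
    (hg : ∀ i, IsAbsConv ι ρ (g i)) {z : ℂ} (hz : ‖z‖ ≤ ρ) :
    evalAt ι z (∑ i ∈ s, g i) = ∑ i ∈ s, evalAt ι z (g i) := by
  have := map_sum (evalHom ι hρ z hz) (fun i => (⟨g i, hg i⟩ : absConv ι ρ hρ)) s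
  refine Eq.trans ?_ this
  change _ = evalAt ι z _
  congr 1
  simp

lemma evalAt_poly_mul {ι : K →+* ℂ} {ρ : ℝ} (hρ : 0 ≤ ρ) {g : K⟦X⟧} (hg : IsAbsConv ι ρ g)
    {z : ℂ} (hz : ‖z‖ ≤ ρ) (P : K[X]) :
    evalAt ι z ((P : K⟦X⟧) * g) = P.eval₂ ι z * evalAt ι z g := by
  rw [evalAt_mul (isAbsConv_poly P) hg hz, evalAt_poly]

/-- A relation between the iterates of `f` can be evaluated. -/
lemma sum_eval₂_mul_evalAt {ι : K →+* ℂ} {ρ : ℝ} (hρ : 0 ≤ ρ) (hρ1 : ρ ≤ 1) {f : K⟦X⟧}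
    (hf : IsAbsConv ι ρ f) {z : ℂ} (hz : ‖z‖ ≤ ρ) (s : Finset ℕ) (p : ℕ → K[X]) (k : ℕ) :
    evalAt ι z (∑ i ∈ s, (p i : K⟦X⟧) * mahlerPow hq (k + i) f) =
      ∑ i ∈ s, (p i).eval₂ ι z * evalAt ι (z ^ q ^ (k + i)) f := by
  have h1 := fun i => hf.mahlerPow hq hρ hρ1 i
  rw [evalAt_sum hρ (fun i => (isAbsConv_poly (p i)).mul hρ (h1 _)) hz]
  exact Finset.sum_congr rfl fun i _ => by
    rw [evalAt_poly_mul hρ (h1 _) hz, evalAt_mahlerPow]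

end Expand

section Heights
variable {K : Type} [Field K]

lemma HeightBound.zero {D : ℕ} (hD : 0 < D) : HeightBound D (0 : K) :=
  ⟨hD, by simpa using isIntegral_zero, by simp⟩

lemma HeightBound.elimStep {P c : ℕ → K} {A T i : ℕ} (hP : HeightBound A (P 0))
    (hP' : HeightBound A (P (i + 1)))
    (hc : HeightBound T (c 0)) (hc' : HeightBound T (c (i + 1))) :
    HeightBound (2 * (A * T)) (elimStep P c i) := by
  have h2 := (hP'.mul hc).neg
  have := HeightBound.sum (s := Finset.univ) (D := A * T)
    (x := fun b : Bool => if b then P 0 * c (i + 1) else - (P (i + 1) * c 0))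
    Finset.univ_nonempty fun b _ => by
      cases b
      · simpa using h2
      · simpa using hP.mul hc'
  simpa [MahlerAux.elimStep, sub_eq_add_neg, mul_comm] using this

end Heights
end MahlerAux

namespace MahlerAux
open PowerSeries
open scoped Polynomial

section NumberFieldCase

variable {K : Type} [Field K] {q : ℕ}

/-- The orbit under elimination of a relation at the point `α`. -/
noncomputable def orbitRel (q : ℕ) (p : ℕ → K[X]) (α : K) (c : ℕ → K) : ℕ → ℕ → K
  | 0 => c
  | j + 1 => elimStep (fun i => (p i).eval (α ^ q ^ j)) (orbitRel q p α c j)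

variable {p : ℕ → K[X]} {α : K} {c : ℕ → K} {m : ℕ}

lemma orbitRel_eq_zero (hp : ∀ i, m < i → p i = 0) (hc : ∀ i, m ≤ i → c i = 0) (j : ℕ) :
    ∀ i, m ≤ i → orbitRel q p α c j i = 0 := by
  induction j with
  | zero => exact hc
  | succ j ih => exact fun i hi => elimStep_eq_zero (fun i hi => by simp [hp i hi]) ih hi

lemma exists_orbitRel_ne_zero (hp : ∀ i, m < i → p i = 0) (hc : ∀ i, m ≤ i → c i = 0)
    (h0 : ∀ j, (p 0).eval (α ^ q ^ j) ≠ 0) (hm : ∀ j, (p m).eval (α ^ q ^ j) ≠ 0)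
    (hne : ∃ i < m, c i ≠ 0) (j : ℕ) : ∃ i < m, orbitRel q p α c j i ≠ 0 := by
  induction j with
  | zero => exact hne
  | succ j ih => exact elimStep_ne_zero (h0 j) (hm j) (orbitRel_eq_zero hp hc j) ih

lemma exists_heightBound_orbitRel [NumberField K] (hq2 : 2 ≤ q) (hp : ∀ i, m < i → p i = 0)
    (hc : ∀ i, m ≤ i → c i = 0) :
    ∃ C : ℕ, ∀ j i, HeightBound (C ^ q ^ j) (orbitRel q p α c j i) := by
  obtain ⟨N, hN⟩ : ∃ N, ∀ i, (p i).natDegree < N := by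
    refine ⟨(Finset.range (m + 1)).sup (fun i => (p i).natDegree) + 1, fun i => ?_⟩
    by_cases hi : m < i
    · simp [hp i hi]
    · exact Nat.lt_succ_of_le (Finset.le_sup (f := fun i => (p i).natDegree)
        (Finset.mem_range.2 (by omega)))
  obtain ⟨D, hD⟩ := HeightBound.exists_common_bound fun x : Fin (m + 1) × Fin N => (p x.1).coeff x.2
  obtain ⟨A, hA⟩ := HeightBound.exists_common_bound fun _ : Unit => α
  obtain ⟨T, hT⟩ := HeightBound.exists_common_bound fun i : Fin (m + 1) => c i
  have hN0 : 0 < N := (Nat.zero_le _).trans_lt (hN 0)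
  have hD0 : 0 < D := (hD (0, ⟨0, hN0⟩)).1
  have hA0 : 0 < A := (hA ()).1
  have hT0 : 0 < T := (hT 0).1
  have hcoeff : ∀ i k, k < N → HeightBound D ((p i).coeff k) := fun i k hk => by
    by_cases hi : m < i
    · rw [hp i hi]; exact HeightBound.zero hD0
    · exact hD (⟨i, by omega⟩, ⟨k, hk⟩)
  have hcb : ∀ i, HeightBound T (c i) := fun i => by
    by_cases hi : m < i
    · rw [hc i hi.le]; exact HeightBound.zero hT0
    · exact hT ⟨i, by omega⟩
  set B := 2 * (N * (D * A ^ N)) with hB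
  have hB0 : 0 < B := by positivity
  refine ⟨T * B, fun j => ?_⟩
  have hpos : ∀ j : ℕ, 0 < (T * B) ^ q ^ j := fun j => by positivity
  induction j with
  | zero => exact fun i => (hcb i).of_dvd (by simp) (hpos 0)
  | succ j ih =>
    intro i
    have hev : ∀ i, HeightBound (N * (D * (A ^ N) ^ q ^ j)) ((p i).eval (α ^ q ^ j)) :=
      fun i => HeightBound.eval (hcoeff i) (hN i) (hA ())
    refine (HeightBound.elimStep (P := fun i => (p i).eval (α ^ q ^ j)) (hev 0) (hev (i + 1)) (ih 0)
      (ih (i + 1))).of_dvd ?_ (hpos _)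
    have h1 : ∀ x : ℕ, x ∣ x ^ q ^ j := fun x => dvd_pow_self _ (pow_pos (by omega) j).ne'
    have h2 : 2 * (N * (D * (A ^ N) ^ q ^ j)) ∣ B ^ q ^ j := by
      rw [hB, mul_pow, mul_pow, mul_pow]
      exact mul_dvd_mul (h1 2) (mul_dvd_mul (h1 N) (mul_dvd_mul (h1 D) dvd_rfl))
    calc 2 * (N * (D * (A ^ N) ^ q ^ j) * (T * B) ^ q ^ j)
        = 2 * (N * (D * (A ^ N) ^ q ^ j)) * (T * B) ^ q ^ j := by ring
      _ ∣ (T * B) ^ q ^ j * (T * B) ^ q ^ j :=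
          mul_dvd_mul (h2.trans (pow_dvd_pow_of_dvd (Dvd.intro_left _ rfl) _)) dvd_rfl
      _ = (T * B) ^ (q ^ j * 2) := by rw [pow_mul, sq]
      _ ∣ (T * B) ^ q ^ (j + 1) := pow_dvd_pow _ (by rw [pow_succ]; gcongr)

lemma orbitRel_relation {ι₀ : K →+* ℂ} (hq : q ≠ 0) {f : K⟦X⟧}
    (hp : ∀ i, m < i → p i = 0) (hc : ∀ i, m ≤ i → c i = 0)
    (hpf : ∑ i ∈ Finset.range (m + 1), (p i : K⟦X⟧) * mahlerPow hq i f = 0)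
    {ρ : ℝ} (hρ : 0 < ρ) (hρ1 : ρ ≤ 1) (hfc : IsAbsConv ι₀ ρ f) (hαρ : ‖ι₀ α‖ ≤ ρ)
    (hrel : ∑ i ∈ Finset.range m, ι₀ (c i) * evalAt ι₀ (ι₀ α ^ q ^ i) f = 0) (j : ℕ) :
    ∑ i ∈ Finset.range m, ι₀ (orbitRel q p α c j i) * evalAt ι₀ (ι₀ α ^ q ^ (j + i)) f = 0 := by
  induction j with
  | zero => simpa [orbitRel] using hrel
  | succ j ih =>
    have hz : ‖ι₀ α ^ q ^ j‖ ≤ ρ := by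
      rw [norm_pow]
      exact (pow_le_of_le_one (norm_nonneg _) (hαρ.trans hρ1)
        (pow_pos (by omega) j).ne').trans hαρ
    have h1 := sum_eval₂_mul_evalAt hq hρ.le hρ1 hfc hz (Finset.range (m + 1)) p 0
    simp only [zero_add] at h1
    rw [hpf] at h1
    have h2 := mul_sum_eq_sum_elimStep (m := m)
      (P := fun i => ι₀ ((p i).eval (α ^ q ^ j))) (c := fun i => ι₀ (orbitRel q p α c j i))
      (y := fun i => evalAt ι₀ (ι₀ α ^ q ^ (j + i)) f) ?_
      (by simp [orbitRel_eq_zero hp hc j m le_rfl])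
    · rw [ih, mul_zero] at h2
      rw [h2]
      refine Finset.sum_congr rfl fun i _ => ?_
      rw [add_right_comm, add_assoc]
      simp [orbitRel, elimStep]
    · have h0 : evalAt ι₀ (ι₀ α ^ q ^ j) (0 : K⟦X⟧) = 0 := by simp [evalAt]
      rw [h0] at h1
      rw [h1]
      refine Finset.sum_congr rfl fun i _ => ?_
      rw [← map_pow ι₀ α (q ^ j), Polynomial.eval₂_at_apply, map_pow, ← pow_mul, ← pow_add]

theorem false_of_relation_numberField [NumberField K] {ζ : K} (ι₀ : K →+* ℂ) (hq2 : 2 ≤ q)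
    (hq : q ≠ 0) (hζ : IsPrimitiveRoot ζ q) {f : K⟦X⟧}
    (hf : LinearIndependent K[X] fun i : Fin m => mahlerPow hq i f)
    (hp : ∀ i, m < i → p i = 0) (hc : ∀ i, m ≤ i → c i = 0)
    (hpf : ∑ i ∈ Finset.range (m + 1), (p i : K⟦X⟧) * mahlerPow hq i f = 0)
    {ρ : ℝ} (hρ : 0 < ρ) (hρ1 : ρ < 1) (hfc : IsAbsConv ι₀ ρ f) (hα0 : α ≠ 0) (hαρ : ‖ι₀ α‖ ≤ ρ)
    (h0 : ∀ j, (p 0).eval (α ^ q ^ j) ≠ 0) (hm : ∀ j, (p m).eval (α ^ q ^ j) ≠ 0)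
    (hne : ∃ i < m, c i ≠ 0)
    (hrel : ∑ i ∈ Finset.range m, ι₀ (c i) * evalAt ι₀ (ι₀ α ^ q ^ i) f = 0) : False := by
  have hinj : Function.Injective (algebraMap K⟦X⟧ (FractionRing K⟦X⟧)) := IsFractionRing.injective _ _
  have : FaithfulSMul K[X] (FractionRing K⟦X⟧) := by
    rw [faithfulSMul_iff_algebraMap_injective]
    rw [IsScalarTower.algebraMap_eq K[X] K⟦X⟧ (FractionRing K⟦X⟧), RingHom.coe_comp]
    refine hinj.comp fun P Q h => ?_
    rw [algebraMap_poly, algebraMap_poly] at h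
    exact Polynomial.coe_inj.1 h
  letI : Algebra (FractionRing K[X]) (FractionRing K⟦X⟧) := FractionRing.liftAlgebra _ _
  have : IsScalarTower K[X] (FractionRing K[X]) (FractionRing K⟦X⟧) :=
    FractionRing.isScalarTower_liftAlgebra _ _
  obtain ⟨C, hC⟩ := exists_heightBound_orbitRel (p := p) (α := α) (c := c) hq2 hp hc
  refine false_of_linear_relations (FractionRing K[X]) (FractionRing K⟦X⟧) ι₀ hq2 hq hζ hf ?_ hρ
    (fun i => hfc.mahlerPow hq hρ.le hρ1.le i) hα0 hαρ (hαρ.trans_lt hρ1)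
    (τ := fun j i => orbitRel q p α c j i) (fun j h => ?_) (fun j i => hC j i) fun j => ?_
  · intro i
    rw [← mahlerPow_succ']
    set k := IntermediateField.adjoin (FractionRing K[X])
      (algebraMap K⟦X⟧ (FractionRing K⟦X⟧) '' Set.range fun i : Fin m => mahlerPow hq i f) with hk
    have hmem : ∀ i < m, algebraMap K⟦X⟧ (FractionRing K⟦X⟧) (mahlerPow hq i f) ∈ k := fun i hi =>
      IntermediateField.subset_adjoin _ _ ⟨_, ⟨⟨i, hi⟩, rfl⟩, rfl⟩
    have hpoly : ∀ P : K[X], algebraMap K⟦X⟧ (FractionRing K⟦X⟧) (P : K⟦X⟧) ∈ k := fun P => by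
      rw [algebraMap_coe_poly, IsScalarTower.algebraMap_apply K[X] (FractionRing K[X])]
      exact k.algebraMap_mem _
    by_cases hi : (i : ℕ) + 1 < m
    · exact hmem _ hi
    have hi' : (i : ℕ) + 1 = m := by have := i.2; omega
    rw [hi']
    have hpm : algebraMap K⟦X⟧ (FractionRing K⟦X⟧) (p m : K⟦X⟧) ≠ 0 := by
      rw [Ne, map_eq_zero_iff _ hinj, Polynomial.coe_eq_zero_iff]
      intro h; simpa [h] using hm 0
    rw [Finset.sum_range_succ] at hpf
    have h1 := congrArg (algebraMap K⟦X⟧ (FractionRing K⟦X⟧)) hpf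
    rw [map_add, map_mul, map_zero, map_sum] at h1
    have h2 : algebraMap K⟦X⟧ (FractionRing K⟦X⟧) (mahlerPow hq m f) =
        -(∑ i ∈ Finset.range m, algebraMap K⟦X⟧ (FractionRing K⟦X⟧)
          ((p i : K⟦X⟧) * mahlerPow hq i f)) / algebraMap K⟦X⟧ (FractionRing K⟦X⟧) (p m : K⟦X⟧) := by
      rw [eq_div_iff hpm]
      linear_combination h1
    rw [h2]
    refine k.div_mem (k.neg_mem (k.sum_mem fun i hi => ?_)) (hpoly _)
    rw [map_mul]
    exact k.mul_mem (hpoly _) (hmem i (Finset.mem_range.1 hi))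
  · obtain ⟨i, hi, hi'⟩ := exists_orbitRel_ne_zero hp hc h0 hm hne j
    exact hi' (congrFun h ⟨i, hi⟩)
  · rw [← orbitRel_relation hq hp hc hpf hρ hρ1.le hfc hαρ hrel j, ← Fin.sum_univ_eq_sum_range
      (fun i => ι₀ (orbitRel q p α c j i) * evalAt ι₀ (ι₀ α ^ q ^ (j + i)) f)]
    refine Finset.sum_congr rfl fun i _ => ?_
    rw [evalAt_mahlerPow, ← pow_mul, ← pow_add]

end NumberFieldCase
end MahlerAux

namespace MahlerAux
open PowerSeries
open scoped Polynomial

section Descent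

variable {L : Type*} [Field L] {q : ℕ}

lemma coeff_mahlerPow (hq : q ≠ 0) (i n : ℕ) (f : L⟦X⟧) :
    coeff n (mahlerPow hq i f) = if q ^ i ∣ n then coeff (n / q ^ i) f else 0 :=
  coeff_expand _ _ _

/-- The coefficients of a solution of a Mahler equation lie in the field generated by those of the
equation and finitely many initial ones. -/
lemma coeff_mem_of_relation {S : Type*} [SetLike S L] [SubfieldClass S L] (K : S) (hq2 : 2 ≤ q)
    (hq : q ≠ 0) {f : L⟦X⟧} {p : ℕ → L[X]}
    {m : ℕ} (hp0 : p 0 ≠ 0) (hpK : ∀ i k, (p i).coeff k ∈ K)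
    (hpf : ∑ i ∈ Finset.range (m + 1), (p i : L⟦X⟧) * mahlerPow hq i f = 0)
    (hfK : ∀ n ≤ (p 0).natTrailingDegree, coeff n f ∈ K) (n : ℕ) : coeff n f ∈ K := by
  set v := (p 0).natTrailingDegree with hv
  have hv0 : (p 0).coeff v ≠ 0 := by
    change (p 0).trailingCoeff ≠ 0
    simpa using hp0
  induction n using Nat.strong_induction_on with
  | _ n ih =>
    by_cases hn : n ≤ v
    · exact hfK n hn
    have h1 := congrArg (coeff (n + v)) hpf
    rw [Finset.sum_range_succ', map_add, map_sum, map_zero, mahlerPow_zero, coeff_mul,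
      ← Finset.add_sum_erase _ _ (show (v, n) ∈ Finset.HasAntidiagonal.antidiagonal (n + v) by
        simp [add_comm])] at h1
    have h2 : ∑ i ∈ Finset.range m, coeff (n + v) ((p (i + 1) : L⟦X⟧) * mahlerPow hq (i + 1) f) ∈ K := by
      refine sum_mem fun i _ => ?_
      rw [coeff_mul]
      refine sum_mem fun x hx => ?_
      rw [Finset.HasAntidiagonal.mem_antidiagonal] at hx
      rw [coeff_mahlerPow, Polynomial.coeff_coe]
      refine mul_mem (hpK _ _) ?_
      split_ifs
      · refine ih _ ?_
        have : 2 ≤ q ^ (i + 1) := hq2.trans (Nat.le_self_pow (by omega) q)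
        calc x.2 / q ^ (i + 1) ≤ x.2 / 2 := Nat.div_le_div_left this (by norm_num)
          _ < n := by omega
      · exact zero_mem _
    have h3 : ∑ x ∈ (Finset.HasAntidiagonal.antidiagonal (n + v)).erase (v, n),
        coeff x.1 (p 0 : L⟦X⟧) * coeff x.2 f ∈ K := by
      refine sum_mem fun x hx => ?_
      rw [Finset.mem_erase, Finset.HasAntidiagonal.mem_antidiagonal] at hx
      rw [Polynomial.coeff_coe]
      rcases lt_trichotomy x.1 v with h | h | h
      · rw [Polynomial.coeff_eq_zero_of_lt_natTrailingDegree h, zero_mul]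
        exact zero_mem _
      · exact absurd (Prod.ext h (by simp only; omega)) hx.1
      · exact mul_mem (hpK _ _) (ih _ (by omega))
    rw [Polynomial.coeff_coe] at h1
    have h4 : coeff n f = -((∑ x ∈ (Finset.HasAntidiagonal.antidiagonal (n + v)).erase (v, n),
        coeff x.1 (p 0 : L⟦X⟧) * coeff x.2 f) + ∑ i ∈ Finset.range m,
          coeff (n + v) ((p (i + 1) : L⟦X⟧) * mahlerPow hq (i + 1) f)) / (p 0).coeff v := by
      rw [eq_div_iff hv0]
      linear_combination h1
    rw [h4]
    exact div_mem (neg_mem (add_mem h3 h2)) (hpK _ _)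

lemma map_mahlerPow {K : Type*} [Field K] (φ : K →+* L) (hq : q ≠ 0) (i : ℕ) (f : K⟦X⟧) :
    PowerSeries.map φ (mahlerPow hq i f) = mahlerPow hq i (PowerSeries.map φ f) := by
  ext n
  rw [coeff_map, coeff_mahlerPow, coeff_mahlerPow]
  split_ifs <;> simp

lemma map_coe_poly {K : Type*} [Field K] (φ : K →+* L) (P : K[X]) :
    PowerSeries.map φ (P : K⟦X⟧) = ((P.map φ : L[X]) : L⟦X⟧) := by
  ext n; simp

lemma map_injective {K : Type*} [Field K] (φ : K →+* L) :
    Function.Injective (PowerSeries.map φ) := fun f g h => by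
  ext n
  have := congrArg (coeff n) h
  rw [coeff_map, coeff_map] at this
  exact φ.injective this

lemma linearIndependent_of_map {K : Type*} [Field K] (φ : K →+* L) {ι : Type*} {y : ι → K⟦X⟧}
    (hy : LinearIndependent L[X] fun i => PowerSeries.map φ (y i)) : LinearIndependent K[X] y := by
  rw [linearIndependent_iff'] at hy ⊢
  intro s P hP i hi
  have := hy s (fun i => (P i).map φ) ?_ i hi
  · simpa using this
  · have := congrArg (PowerSeries.map φ) hP
    rw [map_sum, map_zero] at this
    rw [← this]
    exact Finset.sum_congr rfl fun j _ => by rw [poly_smul, poly_smul, map_mul, map_coe_poly]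

theorem false_of_relation {L : Type} [Field L] [CharZero L] [Algebra.IsAlgebraic ℚ L] [IsAlgClosed L] {m : ℕ}
    {p : ℕ → L[X]} {α : L} {c : ℕ → L} (J : L →+* ℂ) (hq2 : 2 ≤ q)
    (hq : q ≠ 0) {f : L⟦X⟧}
    (hf : LinearIndependent L[X] fun i : Fin m => mahlerPow hq i f)
    (hp : ∀ i, m < i → p i = 0) (hc : ∀ i, m ≤ i → c i = 0)
    (hpf : ∑ i ∈ Finset.range (m + 1), (p i : L⟦X⟧) * mahlerPow hq i f = 0)
    {ρ : ℝ} (hρ : 0 < ρ) (hρ1 : ρ < 1) (hfc : IsAbsConv J ρ f) (hα0 : α ≠ 0) (hαρ : ‖J α‖ ≤ ρ)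
    (h0 : ∀ j, (p 0).eval (α ^ q ^ j) ≠ 0) (hm : ∀ j, (p m).eval (α ^ q ^ j) ≠ 0)
    (hne : ∃ i < m, c i ≠ 0)
    (hrel : ∑ i ∈ Finset.range m, J (c i) * evalAt J (J α ^ q ^ i) f = 0) : False := by
  classical
  have : NeZero (q : L) := ⟨by exact_mod_cast hq⟩
  obtain ⟨ζ, hζ⟩ := HasEnoughRootsOfUnity.exists_primitiveRoot L q
  let v := (p 0).natTrailingDegree
  let S : Finset L := (Finset.range (m + 1)).biUnion (fun i => (p i).coeffs) ∪
    (Finset.range m).image c ∪ (Finset.range (v + 1)).image (fun n => coeff n f) ∪ {α, ζ}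
  let K := IntermediateField.adjoin ℚ (S : Set L)
  have hSK : ∀ x ∈ S, x ∈ K := fun x hx => IntermediateField.subset_adjoin _ _ hx
  have : FiniteDimensional ℚ K :=
    IntermediateField.finiteDimensional_adjoin fun x _ => Algebra.IsIntegral.isIntegral x
  have : NumberField K := { }
  have hpK : ∀ i k, (p i).coeff k ∈ K := fun i k => by
    by_cases hi : m < i
    · simp [hp i hi]
    by_cases hk : (p i).coeff k = 0
    · rw [hk]; exact zero_mem _
    refine hSK _ ?_
    simp only [S, Finset.mem_union, Finset.mem_biUnion]
    exact Or.inl (Or.inl (Or.inl ⟨i, by simp; omega, Polynomial.coeff_mem_coeffs hk⟩))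
  have hcK : ∀ i, c i ∈ K := fun i => by
    by_cases hi : m ≤ i
    · rw [hc i hi]; exact zero_mem _
    refine hSK _ ?_
    simp only [S, Finset.mem_union, Finset.mem_image]
    exact Or.inl (Or.inl (Or.inr ⟨i, by simp; omega, rfl⟩))
  have hfK : ∀ n, coeff n f ∈ K := by
    refine coeff_mem_of_relation K hq2 hq (fun h => ?_) hpK hpf fun n hn => hSK _ ?_
    · simpa [h] using h0 0
    · simp only [S, Finset.mem_union, Finset.mem_image]
      exact Or.inl (Or.inr ⟨n, by simp [v]; omega, rfl⟩)
  have hαK : α ∈ K := hSK _ (by simp [S])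
  have hζK : ζ ∈ K := hSK _ (by simp [S])
  let φ : K →+* L := algebraMap K L
  have hφ : Function.Injective φ := φ.injective
  choose p' hp' using fun i => (Polynomial.mem_lifts (f := φ) (p i)).1
    ((Polynomial.lifts_iff_coeff_lifts (f := φ) (p i)).2 fun k => ⟨⟨_, hpK i k⟩, rfl⟩)
  let f' : K⟦X⟧ := PowerSeries.mk fun n => ⟨coeff n f, hfK n⟩
  have hf' : PowerSeries.map φ f' = f := by ext n; simp [f', φ]
  let α' : K := ⟨α, hαK⟩
  have hα' : φ α' = α := rfl
  have hev : ∀ z, evalAt (J.comp φ) z f' = evalAt J z f := fun z => by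
    simp [← hf', evalAt]
  have heval : ∀ i x, φ ((p' i).eval x) = (p i).eval (φ x) := fun i x => by
    rw [← hp', Polynomial.eval_map, Polynomial.eval₂_at_apply]
  refine false_of_relation_numberField (K := K) (ζ := ⟨ζ, hζK⟩) (f := f') (p := p') (α := α')
    (c := fun i => ⟨c i, hcK i⟩) (m := m) (J.comp φ) hq2 hq ?_ ?_ ?_ ?_ ?_ hρ hρ1 ?_ ?_ ?_ ?_ ?_ ?_ ?_
  · exact IsPrimitiveRoot.of_map_of_injective (f := φ) hζ hφ
  · refine linearIndependent_of_map φ ?_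
    simpa only [map_mahlerPow, hf'] using hf
  · intro i hi
    refine Polynomial.map_injective φ hφ ?_
    rw [hp', hp i hi, Polynomial.map_zero]
  · exact fun i hi => Subtype.ext (hc i hi)
  · refine map_injective φ ?_
    rw [map_sum, map_zero, ← hpf]
    exact Finset.sum_congr rfl fun i _ => by rw [map_mul, map_mahlerPow, map_coe_poly, hp', hf']
  · simpa [IsAbsConv, ← hf'] using hfc
  · exact fun h => hα0 (congrArg φ h)
  · exact hαρ
  · intro j h
    refine h0 j ?_
    rw [← hα', ← map_pow, ← heval, h, map_zero]
  · intro j h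
    refine hm j ?_
    rw [← hα', ← map_pow, ← heval, h, map_zero]
  · obtain ⟨i, hi, hi'⟩ := hne
    exact ⟨i, hi, fun h => hi' (congrArg φ h)⟩
  · simp only [hev]
    exact hrel

end Descent
end MahlerAux

namespace MahlerAux
open PowerSeries Filter
open scoped Polynomial

section Reduction

section Relations

variable {L : Type*} [Field L] {q : ℕ}

lemma exists_minimal_relation (hq : q ≠ 0) {f : L⟦X⟧}
    (hf : ∃ (m : ℕ) (p : ℕ → L[X]), (∃ i, i ≤ m ∧ p i ≠ 0) ∧
      ∑ i ∈ Finset.range (m + 1), (p i : L⟦X⟧) * mahlerPow hq i f = 0) :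
    ∃ (m : ℕ) (p : ℕ → L[X]), (LinearIndependent L[X] fun i : Fin m => mahlerPow hq i f) ∧
      (∀ i, m < i → p i = 0) ∧ p 0 ≠ 0 ∧ p m ≠ 0 ∧
      ∑ i ∈ Finset.range (m + 1), (p i : L⟦X⟧) * mahlerPow hq i f = 0 := by
  classical
  have hex : ∃ m, ¬ LinearIndependent L[X] fun i : Fin (m + 1) => mahlerPow hq i f := by
    obtain ⟨m, p, ⟨i, hi, hpi⟩, hp⟩ := hf
    refine ⟨m, Fintype.not_linearIndependent_iff.2 ⟨fun i => p i, ?_, ⟨i, by omega⟩, hpi⟩⟩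
    simp only [poly_smul]
    rw [← hp, Fin.sum_univ_eq_sum_range (fun i => (p i : L⟦X⟧) * mahlerPow hq i f)]
  obtain ⟨m, hm, hmin⟩ : ∃ m, (¬ LinearIndependent L[X] fun i : Fin (m + 1) => mahlerPow hq i f) ∧
      LinearIndependent L[X] fun i : Fin m => mahlerPow hq i f := by
    refine ⟨Nat.find hex, Nat.find_spec hex, ?_⟩
    rcases h : Nat.find hex with _ | k
    · exact linearIndependent_empty_type
    · exact not_not.1 (Nat.find_min hex (m := k) (by omega))
  obtain ⟨g, hg, i₀, hi₀⟩ := Fintype.not_linearIndependent_iff.1 hm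
  obtain ⟨p, hpg, hlt⟩ : ∃ p : ℕ → L[X], (∀ i : Fin (m + 1), p i = g i) ∧ ∀ i, m < i → p i = 0 :=
    ⟨fun i => if h : i < m + 1 then g ⟨i, h⟩ else 0, fun i => dif_pos i.2,
      fun i hi => dif_neg (by omega)⟩
  have hsum : ∑ i ∈ Finset.range (m + 1), (p i : L⟦X⟧) * mahlerPow hq i f = 0 := by
    rw [← hg, ← Fin.sum_univ_eq_sum_range (fun i => (p i : L⟦X⟧) * mahlerPow hq i f)]
    exact Finset.sum_congr rfl fun i _ => by rw [poly_smul, hpg]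
  refine ⟨m, p, hmin, hlt, fun h0 => ?_, fun h0 => ?_, hsum⟩
  · rw [Finset.sum_range_succ', h0, Polynomial.coe_zero, zero_mul, add_zero] at hsum
    have hexp : LinearIndependent L[X] fun i : Fin m => mahlerPow hq (i + 1) f := by
      simp only [mahlerPow_succ']
      exact linearIndependent_expand hq hmin
    have h1 := Fintype.linearIndependent_iff.1 hexp (fun i : Fin m => p ((i : ℕ) + 1)) (by
        rw [← hsum, ← Fin.sum_univ_eq_sum_range
          (fun i => (p (i + 1) : L⟦X⟧) * mahlerPow hq (i + 1) f)]
        exact Finset.sum_congr rfl fun i _ => by rw [poly_smul])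
    refine hi₀ ?_
    rw [← hpg]
    rcases hv : (i₀ : ℕ) with _ | k
    · exact h0
    · exact h1 ⟨k, by have := i₀.2; omega⟩
  · rw [Finset.sum_range_succ, h0, Polynomial.coe_zero, zero_mul, add_zero] at hsum
    have h1 := Fintype.linearIndependent_iff.1 hmin (fun i : Fin m => p i) (by
        rw [← hsum, ← Fin.sum_univ_eq_sum_range (fun i => (p i : L⟦X⟧) * mahlerPow hq i f)]
        exact Finset.sum_congr rfl fun i _ => by rw [poly_smul])
    refine hi₀ ?_
    rw [← hpg]
    by_cases hv : (i₀ : ℕ) = m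
    · rw [hv]; exact h0
    · exact h1 ⟨i₀, by have := i₀.2; omega⟩

lemma sum_expand_mul_mahlerPow {hq : q ≠ 0} {f : L⟦X⟧} {m : ℕ} {p : ℕ → L[X]}
    (hpf : ∑ i ∈ Finset.range (m + 1), (p i : L⟦X⟧) * mahlerPow hq i f = 0) (k : ℕ) :
    ∑ i ∈ Finset.range (m + 1), ((Polynomial.expand L (q ^ k) (p i) : L[X]) : L⟦X⟧) *
      mahlerPow hq (k + i) f = 0 := by
  have := congrArg (mahlerPow hq k) hpf
  rw [map_sum, map_zero] at this
  rw [← this]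
  exact Finset.sum_congr rfl fun i _ => by rw [map_mul, mahlerPow_poly, mahlerPow_add]

/-- `f` is a combination of `m` consecutive iterates with arbitrarily large indices. -/
lemma exists_shifted_relation {hq : q ≠ 0} {f : L⟦X⟧} (hf0 : f ≠ 0) {m : ℕ} {p : ℕ → L[X]}
    (hp : ∀ i, m < i → p i = 0) (hp0 : p 0 ≠ 0)
    (hpf : ∑ i ∈ Finset.range (m + 1), (p i : L⟦X⟧) * mahlerPow hq i f = 0) (k : ℕ) :
    ∃ (c : L[X]) (d : ℕ → L[X]), c ≠ 0 ∧ (∀ i, m ≤ i → d i = 0) ∧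
      (c : L⟦X⟧) * f = ∑ i ∈ Finset.range m, (d i : L⟦X⟧) * mahlerPow hq (k + i) f := by
  induction k with
  | zero =>
    have hm : 0 < m := by
      rcases Nat.eq_zero_or_pos m with rfl | h
      · simp [mahlerPow_zero, hp0, hf0] at hpf
      · exact h
    refine ⟨1, fun i => if i = 0 then 1 else 0, one_ne_zero, fun i hi => if_neg (by omega), ?_⟩
    rw [Finset.sum_eq_single_of_mem 0 (Finset.mem_range.2 hm)]
    · simp [mahlerPow_zero]
    · intro i _ hi
      simp [hi]
  | succ k ih =>
    obtain ⟨c, d, hc, hd, hcd⟩ := ih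
    have hp0' : Polynomial.expand L (q ^ k) (p 0) ≠ 0 :=
      (Polynomial.expand_ne_zero (pow_pos (Nat.pos_of_ne_zero hq) k)).2 hp0
    refine ⟨Polynomial.expand L (q ^ k) (p 0) * c,
      elimStep (fun i => Polynomial.expand L (q ^ k) (p i)) d,
      mul_ne_zero hp0' hc,
      fun i hi => elimStep_eq_zero (fun i hi => by simp [hp i hi]) hd hi, ?_⟩
    have h1 := mul_sum_eq_sum_elimStep (m := m) (c := fun i => ((d i : L[X]) : L⟦X⟧))
      (P := fun i => ((Polynomial.expand L (q ^ k) (p i) : L[X]) : L⟦X⟧))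
      (y := fun i => mahlerPow hq (k + i) f) (sum_expand_mul_mahlerPow hpf k) (by simp [hd])
    rw [Polynomial.coe_mul, mul_assoc, hcd, h1]
    refine Finset.sum_congr rfl fun i _ => ?_
    rw [add_right_comm, add_assoc]
    simp [elimStep]

end Relations

lemma exists_forall_eval₂_ne_zero {L : Type*} [Field L] (J : L →+* ℂ) {q : ℕ} (hq2 : 2 ≤ q) {R : ℝ}
    (hR0 : 0 < R) (hR1 : R < 1) {P : L[X]} (hP : P ≠ 0) :
    ∀ᶠ k in atTop, ∀ β : ℂ, β ≠ 0 → ‖β‖ < R → P.eval₂ J (β ^ q ^ k) ≠ 0 := by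
  have hP' : P.map J ≠ 0 := Polynomial.map_ne_zero hP
  have hfin : ({z : ℂ | (P.map J).IsRoot z} \ {0}).Finite :=
    (Polynomial.finite_setOfPred_isRoot hP').subset Set.sdiff_subset
  obtain ⟨δ, hδ, hball⟩ := Metric.isOpen_iff.1 hfin.isClosed.isOpen_compl 0 (by simp)
  filter_upwards [eventually_mul_pow_pow_lt hq2 hR0.le hR1 1 hδ] with k hk β hβ0 hβR h0
  refine hball (a := β ^ q ^ k) ?_ ⟨?_, ?_⟩
  · rw [mem_ball_zero_iff, norm_pow]
    refine lt_of_le_of_lt ?_ hk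
    rw [one_mul]
    exact pow_le_pow_left₀ (norm_nonneg _) hβR.le _
  · simpa [Polynomial.eval_map] using h0
  · exact pow_ne_zero _ hβ0

lemma exists_map_eq_of_eval₂_eq_zero {L : Type*} [Field L] [IsAlgClosed L] (J : L →+* ℂ) {P : L[X]}
    (hP : P ≠ 0) {β : ℂ} (h : P.eval₂ J β = 0) : ∃ β' : L, J β' = β ∧ P.eval β' = 0 := by
  have h1 : β ∈ (P.map J).roots := (Polynomial.mem_roots_map hP).2 h
  rw [(IsAlgClosed.splits P).roots_map, Multiset.mem_map] at h1
  obtain ⟨β', h2, h3⟩ := h1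
  exact ⟨β', h3, (Polynomial.mem_roots hP).1 h2⟩

theorem exists_regular_relation {L : Type} [Field L] [CharZero L] [Algebra.IsAlgebraic ℚ L]
    [IsAlgClosed L] (J : L →+* ℂ) {q : ℕ} (hq2 : 2 ≤ q) (hq : q ≠ 0) {R : ℝ} (hR1 : R < 1)
    {f : L⟦X⟧} (hf0 : f ≠ 0) (hfR : ∀ ρ, 0 < ρ → ρ < R → IsAbsConv J ρ f) {m : ℕ} {p : ℕ → L[X]}
    (hf : LinearIndependent L[X] fun i : Fin m => mahlerPow hq i f)
    (hp : ∀ i, m < i → p i = 0) (hp0 : p 0 ≠ 0)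
    (hpf : ∑ i ∈ Finset.range (m + 1), (p i : L⟦X⟧) * mahlerPow hq i f = 0) {k : ℕ}
    (hk : ∀ j, k ≤ j → ∀ β : ℂ, β ≠ 0 → ‖β‖ < R →
      (p 0).eval₂ J (β ^ q ^ j) ≠ 0 ∧ (p m).eval₂ J (β ^ q ^ j) ≠ 0) :
    ∃ (c : L[X]) (d : ℕ → L[X]),
      (c : L⟦X⟧) * f = ∑ i ∈ Finset.range m, (d i : L⟦X⟧) * mahlerPow hq (k + i) f ∧
      ∀ β : ℂ, β ≠ 0 → ‖β‖ < R → c.eval₂ J β ≠ 0 := by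
  classical
  have hex : ∃ n, ∃ (c : L[X]) (d : ℕ → L[X]), c.natDegree = n ∧ c ≠ 0 ∧
      (∀ i, m ≤ i → d i = 0) ∧
      (c : L⟦X⟧) * f = ∑ i ∈ Finset.range m, (d i : L⟦X⟧) * mahlerPow hq (k + i) f := by
    obtain ⟨c, d, h⟩ := exists_shifted_relation hf0 hp hp0 hpf k
    exact ⟨_, c, d, rfl, h⟩
  obtain ⟨c, d, hdeg, hc, hd, hcd⟩ := Nat.find_spec hex
  refine ⟨c, d, hcd, fun β hβ0 hβR hcβ => ?_⟩
  obtain ⟨β', rfl, hβ'⟩ := exists_map_eq_of_eval₂_eq_zero J hc hcβ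
  have hβ'0 : β' ≠ 0 := fun h => hβ0 (by simp [h])
  have hρ : 0 < ‖J β'‖ := norm_pos_iff.2 hβ0
  have hρ1 : ‖J β'‖ < 1 := hβR.trans hR1
  have hne : ∃ i < m, (d i).eval β' ≠ 0 := by
    by_contra! hall
    have hdvd : ∀ i, Polynomial.X - Polynomial.C β' ∣ d i := fun i => by
      by_cases hi : i < m
      · exact Polynomial.dvd_iff_isRoot.2 (hall i hi)
      · rw [hd i (by omega)]; exact dvd_zero _
    obtain ⟨c', rfl⟩ := Polynomial.dvd_iff_isRoot.2 hβ'
    choose d' hd' using hdvd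
    have hX : (Polynomial.X - Polynomial.C β' : L[X]) ≠ 0 := Polynomial.X_sub_C_ne_zero β'
    have hc' : c' ≠ 0 := right_ne_zero_of_mul hc
    refine Nat.find_min hex (m := c'.natDegree) ?_ ⟨c', d', rfl, hc', fun i hi => ?_, ?_⟩
    · rw [← hdeg, Polynomial.natDegree_mul hX hc', Polynomial.natDegree_X_sub_C]; omega
    · have := hd' i
      rw [hd i hi] at this
      exact (mul_eq_zero.1 this.symm).resolve_left hX
    · refine mul_left_cancel₀ (a := ((Polynomial.X - Polynomial.C β' : L[X]) : L⟦X⟧))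
        (by rwa [Ne, Polynomial.coe_eq_zero_iff]) ?_
      rw [← mul_assoc, ← Polynomial.coe_mul, hcd, Finset.mul_sum]
      exact Finset.sum_congr rfl fun i _ => by rw [← mul_assoc, ← Polynomial.coe_mul, ← hd']
  have hJ : ∀ (P : L[X]) j, P.eval ((β' ^ q ^ k) ^ q ^ j) = 0 → P.eval₂ J (J β' ^ q ^ (k + j)) = 0 := by
    intro P j h
    rw [← map_pow, Polynomial.eval₂_at_apply, pow_add, pow_mul, h, map_zero]
  refine false_of_relation (c := fun i => (d i).eval β') (α := β' ^ q ^ k) J hq2 hq hf hp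
    (fun i hi => by simp [hd i hi]) hpf hρ hρ1 (hfR _ hρ hβR) (pow_ne_zero _ hβ'0) ?_
    (fun j h => (hk (k + j) (by omega) _ hβ0 hβR).1 (hJ _ _ h))
    (fun j h => (hk (k + j) (by omega) _ hβ0 hβR).2 (hJ _ _ h)) hne ?_
  · rw [map_pow, norm_pow]
    exact pow_le_of_le_one hρ.le hρ1.le (pow_pos (by omega) k).ne'
  · have h1 := sum_eval₂_mul_evalAt hq hρ.le hρ1.le (hfR _ hρ hβR) le_rfl (Finset.range m) d k
    rw [← hcd, evalAt_poly_mul hρ.le (hfR _ hρ hβR) le_rfl, hcβ, zero_mul] at h1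
    rw [h1]
    refine Finset.sum_congr rfl fun i _ => ?_
    rw [Polynomial.eval₂_at_apply, map_pow, ← pow_mul, ← pow_add]

theorem exists_regular_operator {L : Type} [Field L] [CharZero L] [Algebra.IsAlgebraic ℚ L]
    [IsAlgClosed L] (J : L →+* ℂ) {q : ℕ} (hq2 : 2 ≤ q) (hq : q ≠ 0) {R : ℝ} (hR0 : 0 < R)
    (hR1 : R < 1) {f : L⟦X⟧} (hfR : ∀ ρ, 0 < ρ → ρ < R → IsAbsConv J ρ f)
    (hf : ∃ (m : ℕ) (p : ℕ → L[X]), (∃ i, i ≤ m ∧ p i ≠ 0) ∧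
      ∑ i ∈ Finset.range (m + 1), (p i : L⟦X⟧) * mahlerPow hq i f = 0) :
    ∃ (n : ℕ) (b : ℕ → L[X]),
      ∑ i ∈ Finset.range (n + 1), (b i : L⟦X⟧) * mahlerPow hq i f = 0 ∧
      ∀ β : ℂ, β ≠ 0 → ‖β‖ < R → (b 0).eval₂ J β ≠ 0 ∧ (b n).eval₂ J β ≠ 0 := by
  by_cases hf0 : f = 0
  · exact ⟨0, fun _ => 1, by simp [hf0], fun β _ _ => by simp⟩
  obtain ⟨m, p, hli, hp, hp0, hpm, hpf⟩ := exists_minimal_relation hq hf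
  obtain ⟨k, hk⟩ := eventually_atTop.1 ((exists_forall_eval₂_ne_zero J hq2 hR0 hR1 hp0).and
    (exists_forall_eval₂_ne_zero J hq2 hR0 hR1 hpm))
  obtain ⟨c, d, hcd, hc⟩ := exists_regular_relation J hq2 hq hR1 hf0 hfR hli hp hp0 hpf (k := k + 1)
    fun j hj β h0 hR => ⟨(hk j (by omega)).1 β h0 hR, (hk j (by omega)).2 β h0 hR⟩
  let N := k + 1 + m
  let b : ℕ → L[X] := fun l => if l = 0 then c else if l < k + 1 then 0 else
    if l < N then -d (l - (k + 1)) else Polynomial.expand L (q ^ N) (p (l - N))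
  refine ⟨N + m, b, ?_, fun β h0 hR => ⟨by simpa [b] using hc β h0 hR, ?_⟩⟩
  · have h1 : ∑ x ∈ Finset.range (k + 1), (b x : L⟦X⟧) * mahlerPow hq x f = (c : L⟦X⟧) * f := by
      rw [Finset.sum_eq_single_of_mem 0 (by simp)]
      · simp [b, mahlerPow_zero]
      · intro l hl hl0
        have : l < k + 1 := Finset.mem_range.1 hl
        simp only [b, if_neg hl0, if_pos this, Polynomial.coe_zero, zero_mul]
    have h2 : ∀ x ∈ Finset.range m, (b (k + 1 + x) : L⟦X⟧) * mahlerPow hq (k + 1 + x) f =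
        -((d x : L⟦X⟧) * mahlerPow hq (k + 1 + x) f) := fun x hx => by
      have hx' : k + 1 + x < N := by have := Finset.mem_range.1 hx; omega
      have : b (k + 1 + x) = - d x := by
        simp only [b]
        rw [if_neg (by omega), if_neg (by omega), if_pos hx']
        simp
      rw [this, Polynomial.coe_neg, neg_mul]
    have h3 : ∀ x ∈ Finset.range (m + 1), (b (N + x) : L⟦X⟧) * mahlerPow hq (N + x) f =
        ((Polynomial.expand L (q ^ N) (p x) : L[X]) : L⟦X⟧) * mahlerPow hq (N + x) f :=
      fun x hx => by
        have : b (N + x) = Polynomial.expand L (q ^ N) (p x) := by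
          simp only [b]
          rw [if_neg (by omega), if_neg (by omega), if_neg (by omega)]
          simp
        rw [this]
    rw [add_assoc, Finset.sum_range_add, Finset.sum_congr rfl h3, sum_expand_mul_mahlerPow hpf,
      Finset.sum_range_add, h1, Finset.sum_congr rfl h2, Finset.sum_neg_distrib, hcd]
    simp
  · have : b (N + m) = Polynomial.expand L (q ^ N) (p m) := by
      simp only [b]
      rw [if_neg (by omega), if_neg (by omega), if_neg (by omega)]
      simp
    rw [this, ← Polynomial.eval_map, Polynomial.map_expand, Polynomial.expand_eval,
      Polynomial.eval_map]
    exact (hk N (by omega)).2 β h0 hR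

end Reduction
end MahlerAux

namespace MahlerAux
open PowerSeries
open scoped Polynomial

lemma psSigma_iterate {q : ℕ} (hq : q ≠ 0) (i : ℕ) (f : ℂ⟦X⟧) :
    (psSigma q)^[i] f = mahlerPow hq i f := by
  induction i with
  | zero => rw [mahlerPow_zero]; rfl
  | succ i ih =>
    rw [Function.iterate_succ_apply', ih, mahlerPow_succ']
    ext n
    rw [psSigma, coeff_mk, coeff_expand]

lemma polyPS_apply (P : ℂ[X]) : polyPS P = (P : ℂ⟦X⟧) := rfl

lemma isAbsConv_of_anOnBall {L : Type*} [Field L] {J : L →+* ℂ} {f : L⟦X⟧} {R : ℝ}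
    (hf : AnOnBall (PowerSeries.map J f) R) {ρ : ℝ} (hρ : 0 < ρ) (hρR : ρ < R) :
    IsAbsConv J ρ f := by
  have h := (hf (ρ : ℂ) (by simpa [abs_of_pos hρ] using hρR)).norm
  simpa [IsAbsConv, abs_of_pos hρ] using h

end MahlerAux

/-- Every M_q-function analytic on the open disk `D(0,R)`, `0 < R < 1`, is
annihilated by a `σ_q`-operator `b₀ + b₁σ_q + ⋯ + b_nσ_q^n` without singularities on the
punctured disk `D*(0,R)`: `b₀(β^{q^ℓ}) ≠ 0` and `b_n(β^{q^ℓ}) ≠ 0` for all `β ∈ D*(0,R)`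
and all `ℓ ≥ 0`. -/
theorem Mq_function_killed_by_regular_operator
    (q : ℕ) (hq : 2 ≤ q) (R : ℝ) (hR0 : 0 < R) (hR1 : R < 1)
    (f : PowerSeries ℂ) (hf : IsM q f) (hfa : AnOnBall f R) :
    ∃ (n : ℕ) (b : ℕ → Polynomial ℂ),
      (∀ i k, IsAlgebraic ℚ ((b i).coeff k)) ∧
      (∑ i ∈ Finset.range (n + 1), polyPS (b i) * (psSigma q)^[i] f = 0) ∧
      ∀ β : ℂ, β ≠ 0 → ‖β‖ < R → ∀ ℓ : ℕ,
        Polynomial.eval (β ^ q ^ ℓ) (b 0) ≠ 0 ∧ Polynomial.eval (β ^ q ^ ℓ) (b n) ≠ 0 := by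
  have hq0 : q ≠ 0 := by omega
  obtain ⟨hfalg, m, p, hpalg, hpne, hpf⟩ := hf
  let J : algebraicClosure ℚ ℂ →+* ℂ := algebraMap _ ℂ
  have hlift : ∀ x : ℂ, IsAlgebraic ℚ x → x ∈ Set.range J := fun x hx =>
    ⟨⟨x, mem_algebraicClosure_iff.2 hx⟩, rfl⟩
  have : IsAlgClosed (algebraicClosure ℚ ℂ) := (algebraicClosure.isAlgClosure ℚ ℂ).isAlgClosed
  have : Algebra.IsAlgebraic ℚ (algebraicClosure ℚ ℂ) :=
    ⟨fun x => (isAlgebraic_algebraMap_iff (A := ℂ)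
      (algebraMap (algebraicClosure ℚ ℂ) ℂ).injective).1 (mem_algebraicClosure_iff.1 x.2)⟩
  choose a ha using fun n => hlift _ (hfalg n)
  choose p' hp' using fun i => (Polynomial.mem_lifts (f := J) (p i)).1
    ((Polynomial.lifts_iff_coeff_lifts (f := J) (p i)).2 fun k => hlift _ (hpalg i k))
  have hmap : PowerSeries.map J (PowerSeries.mk a) = f := by
    ext n
    simp [ha]
  generalize PowerSeries.mk a = g at hmap
  subst hmap
  have hop : ∃ (m : ℕ) (p : ℕ → Polynomial (algebraicClosure ℚ ℂ)), (∃ i, i ≤ m ∧ p i ≠ 0) ∧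
      ∑ i ∈ Finset.range (m + 1),
        (p i : PowerSeries (algebraicClosure ℚ ℂ)) * MahlerAux.mahlerPow hq0 i g = 0 := by
    refine ⟨m, p', ?_, MahlerAux.map_injective J ?_⟩
    · obtain ⟨i, hi, hpi⟩ := hpne
      refine ⟨i, hi, fun h => hpi ?_⟩
      rw [← hp' i, h, Polynomial.map_zero]
    · rw [map_sum, map_zero, ← hpf]
      refine Finset.sum_congr rfl fun i _ => ?_
      rw [MahlerAux.psSigma_iterate hq0, MahlerAux.polyPS_apply, map_mul, MahlerAux.map_mahlerPow,
        MahlerAux.map_coe_poly, hp']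
  obtain ⟨n, b, hb, hreg⟩ := MahlerAux.exists_regular_operator J hq hq0 hR0 hR1
    (fun ρ h1 h2 => MahlerAux.isAbsConv_of_anOnBall hfa h1 h2) hop
  refine ⟨n, fun i => (b i).map J, fun i k => ?_, ?_, fun β hβ0 hβR ℓ => ?_⟩
  · rw [Polynomial.coeff_map]
    exact mem_algebraicClosure_iff.1 ((b i).coeff k).2
  · have h := congrArg (PowerSeries.map J) hb
    rw [map_sum, map_zero] at h
    rw [← h]
    refine Finset.sum_congr rfl fun i _ => ?_
    rw [MahlerAux.psSigma_iterate hq0, MahlerAux.polyPS_apply, map_mul, MahlerAux.map_mahlerPow,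
      MahlerAux.map_coe_poly]
  · rw [Polynomial.eval_map, Polynomial.eval_map]
    refine hreg _ (pow_ne_zero _ hβ0) (lt_of_le_of_lt ?_ hβR)
    rw [norm_pow]
    exact pow_le_of_le_one (norm_nonneg _) (hβR.trans hR1).le (pow_ne_zero _ hq0)
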